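/- Let n ≥ 2, α = 1, 0 < γ < 1, and let f : ℝⁿ → ℂ be a Schwartz function. For each ε ∈ (0,1] let u^ε be a solution of (H) with datum f. Then for every fixed t with 0 ≤ t < π/2 and for A^ε equal to any of the operators Id, J^ε, or H^ε: sup_{0 ≤ τ ≤ t} ‖ A^ε(τ)( u^ε(τ,x) − (cos τ)^{−n/2} f(x/cos τ) exp( −i|x|² tan τ/(2ε) + i g(τ, x/cos τ) ) ) ‖_{L²_x} → 0 as ε → 0. -/

import Mathlib

open MeasureTheory Real Filter Topology
open scoped ENNReal NNReal ComplexConjugate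

noncomputable section

/-- Euclidean space ℝⁿ. -/
abbrev Rn (n : ℕ) := EuclideanSpace ℝ (Fin n)

/-- The gradient of a complex-valued function on ℝⁿ, as a ℂⁿ-valued function. -/
def grad {n : ℕ} (φ : Rn n → ℂ) (x : Rn n) : Fin n → ℂ :=
  fun j => fderiv ℝ φ x (EuclideanSpace.single j 1)

/-- The gradient, valued in the Euclidean space ℂⁿ (so that its pointwise norm is the
Euclidean norm). -/
def gradE {n : ℕ} (φ : Rn n → ℂ) (x : Rn n) : EuclideanSpace ℂ (Fin n) :=
  (WithLp.equiv 2 (Fin n → ℂ)).symm (grad φ x)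

/-- The Laplacian of a complex-valued function on ℝⁿ. -/
def lap {n : ℕ} (φ : Rn n → ℂ) (x : Rn n) : ℂ :=
  ∑ j, fderiv ℝ (fun y => fderiv ℝ φ y (EuclideanSpace.single j 1)) x (EuclideanSpace.single j 1)

/-- The operator J^ε(t) = (x/ε) sin t − i cos t ∇ₓ. -/
def Jop {n : ℕ} (ε t : ℝ) (φ : Rn n → ℂ) (x : Rn n) : Fin n → ℂ :=
  fun j => ((x j / ε : ℝ) : ℂ) * ((Real.sin t : ℝ) : ℂ) * φ x
    - Complex.I * ((Real.cos t : ℝ) : ℂ) * grad φ x j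

/-- The operator H^ε(t) = x cos t + iε sin t ∇ₓ. -/
def Hop {n : ℕ} (ε t : ℝ) (φ : Rn n → ℂ) (x : Rn n) : Fin n → ℂ :=
  fun j => ((x j : ℝ) : ℂ) * ((Real.cos t : ℝ) : ℂ) * φ x
    + Complex.I * (ε : ℂ) * ((Real.sin t : ℝ) : ℂ) * grad φ x j

/-- J^ε(t)φ viewed as valued in Euclidean ℂⁿ. -/
def JopE {n : ℕ} (ε t : ℝ) (φ : Rn n → ℂ) (x : Rn n) : EuclideanSpace ℂ (Fin n) :=
  (WithLp.equiv 2 (Fin n → ℂ)).symm (Jop ε t φ x)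

/-- H^ε(t)φ viewed as valued in Euclidean ℂⁿ. -/
def HopE {n : ℕ} (ε t : ℝ) (φ : Rn n → ℂ) (x : Rn n) : EuclideanSpace ℂ (Fin n) :=
  (WithLp.equiv 2 (Fin n → ℂ)).symm (Hop ε t φ x)

/-- Convolution (|x|^{−γ} ∗ ψ)(x) of a real-valued ψ with the kernel |x|^{−γ}. -/
def conv {n : ℕ} (γ : ℝ) (ψ : Rn n → ℝ) (x : Rn n) : ℝ :=
  ∫ y : Rn n, ‖x - y‖ ^ (-γ) * ψ y

/-- Convolution (|x|^{−γ} ∗ ψ)(x) of a complex-valued ψ with the kernel |x|^{−γ}. -/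
def convC {n : ℕ} (γ : ℝ) (ψ : Rn n → ℂ) (x : Rn n) : ℂ :=
  ∫ y : Rn n, ((‖x - y‖ ^ (-γ) : ℝ) : ℂ) * ψ y

/-- The Hartree potential |x|^{−γ} ∗ |u|². -/
def hartree {n : ℕ} (γ : ℝ) (u : Rn n → ℂ) (x : Rn n) : ℝ :=
  conv γ (fun y => Complex.normSq (u y)) x

/-- `u` is a (smooth, Schwartz-in-x) solution of the semiclassical Hartree equation with
harmonic potential: iε∂ₜu + (ε²/2)Δu = (|x|²/2)u + ε^α(|x|^{−γ}∗|u|²)u, u(0) = f. -/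
structure IsSolutionH (n : ℕ) (α γ ε : ℝ) (f : Rn n → ℂ) (u : ℝ → Rn n → ℂ) : Prop where
  smooth : ContDiff ℝ (⊤ : ℕ∞) (fun p : ℝ × Rn n => u p.1 p.2)
  schwartz : ∀ t, ∃ φ : SchwartzMap (Rn n) ℂ, u t = ⇑φ
  init : u 0 = f
  eq : ∀ t x, Complex.I * (ε : ℂ) * deriv (fun s => u s x) t
      + ((ε ^ 2 / 2 : ℝ) : ℂ) * lap (u t) x
    = ((‖x‖ ^ 2 / 2 : ℝ) : ℂ) * u t x
      + ((ε ^ α : ℝ) : ℂ) * ((hartree γ (u t) x : ℝ) : ℂ) * u t x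

/-- `u` is a (smooth, Schwartz-in-x) solution of the linear equation
iε∂ₜu + (ε²/2)Δu = (|x|²/2)u. -/
structure IsLinSol (n : ℕ) (ε : ℝ) (u : ℝ → Rn n → ℂ) : Prop where
  smooth : ContDiff ℝ (⊤ : ℕ∞) (fun p : ℝ × Rn n => u p.1 p.2)
  schwartz : ∀ t, ∃ φ : SchwartzMap (Rn n) ℂ, u t = ⇑φ
  eq : ∀ t x, Complex.I * (ε : ℂ) * deriv (fun s => u s x) t
      + ((ε ^ 2 / 2 : ℝ) : ℂ) * lap (u t) x
    = ((‖x‖ ^ 2 / 2 : ℝ) : ℂ) * u t x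

/-- The semiclassical harmonic-oscillator propagator U^ε(t), via Mehler's formula
(for 0 < t < π). -/
def Uprop (n : ℕ) (ε t : ℝ) (φ : Rn n → ℂ) (x : Rn n) : ℂ :=
  Complex.exp (-Complex.I * (n : ℂ) * (π : ℂ) / 4) *
    ((2 * π * ε * Real.sin t : ℝ) : ℂ) ^ (-(n : ℂ) / 2) *
    ∫ y : Rn n, Complex.exp ((Complex.I / ((ε * Real.sin t : ℝ) : ℂ)) *
      (((‖x‖ ^ 2 + ‖y‖ ^ 2) / 2 * Real.cos t - ∑ j, x j * y j : ℝ) : ℂ)) * φ y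

/-- The WKB approximation operator V^ε(t) (for t ∈ (0,π/2) ∪ (π/2,π)). -/
def Vprop (n : ℕ) (ε t : ℝ) (φ : Rn n → ℂ) (x : Rn n) : ℂ :=
  if t < π / 2 then
    ((Real.cos t ^ (-(n : ℝ) / 2) : ℝ) : ℂ) * φ ((Real.cos t)⁻¹ • x) *
      Complex.exp (-Complex.I * ((‖x‖ ^ 2 * Real.tan t / (2 * ε) : ℝ) : ℂ))
  else
    Complex.exp (-Complex.I * (n : ℂ) * ((π / 2 : ℝ) : ℂ)) *
      ((|Real.cos t| ^ (-(n : ℝ) / 2) : ℝ) : ℂ) * φ ((Real.cos t)⁻¹ • x) *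
      Complex.exp (-Complex.I * ((‖x‖ ^ 2 * Real.tan t / (2 * ε) : ℝ) : ℂ))

/-- The Σ-norm ‖φ‖_Σ = ‖φ‖_{L²} + ‖|x|φ‖_{L²} + ‖∇φ‖_{L²}, with values in ℝ≥0∞. -/
def SigmaNorm {n : ℕ} (φ : Rn n → ℂ) : ℝ≥0∞ :=
  eLpNorm φ 2 volume + eLpNorm (fun x => (‖x‖ : ℂ) * φ x) 2 volume
    + eLpNorm (gradE φ) 2 volume

/-- The H¹-norm (‖φ‖_{L²}² + ‖∇φ‖_{L²}²)^{1/2}, with values in ℝ≥0∞. -/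
def H1norm {n : ℕ} (φ : Rn n → ℂ) : ℝ≥0∞ :=
  (eLpNorm φ 2 volume ^ (2 : ℝ) + eLpNorm (gradE φ) 2 volume ^ (2 : ℝ)) ^ ((1 : ℝ) / 2)

/-- The nonlinear WKB phase g(t,x) = −(|x|^{−γ}∗|f|²)(x) ∫₀ᵗ |cos τ|^{−γ} dτ. -/
def gphase {n : ℕ} (γ : ℝ) (f : Rn n → ℂ) (t : ℝ) (x : Rn n) : ℝ :=
  -(conv γ (fun y => Complex.normSq (f y)) x) * ∫ τ in (0 : ℝ)..t, |Real.cos τ| ^ (-γ)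

/-- The Fourier transform Fφ(ξ) = (2π)^{−n/2} ∫ e^{−ix·ξ} φ(x) dx. -/
def FT {n : ℕ} (φ : Rn n → ℂ) (ξ : Rn n) : ℂ :=
  (((2 * π : ℝ) ^ (-(n : ℝ) / 2) : ℝ) : ℂ) *
    ∫ x : Rn n, Complex.exp (-Complex.I * ((∑ j, x j * ξ j : ℝ) : ℂ)) * φ x

/-- The inverse Fourier transform. -/
def FTinv {n : ℕ} (φ : Rn n → ℂ) (ξ : Rn n) : ℂ :=
  (((2 * π : ℝ) ^ (-(n : ℝ) / 2) : ℝ) : ℂ) *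
    ∫ x : Rn n, Complex.exp (Complex.I * ((∑ j, x j * ξ j : ℝ) : ℂ)) * φ x

/-- The nonlinear WKB profile (cos τ)^{−n/2} f(x/cos τ) e^{−i|x|²tan τ/(2ε) + i g(τ, x/cos τ)}. -/
def wkbProfile (n : ℕ) (γ : ℝ) (f : Rn n → ℂ) (ε τ : ℝ) (x : Rn n) : ℂ :=
  ((Real.cos τ ^ (-(n : ℝ) / 2) : ℝ) : ℂ) * f ((Real.cos τ)⁻¹ • x) *
    Complex.exp (Complex.I *
      ((-(‖x‖ ^ 2 * Real.tan τ / (2 * ε)) + gphase γ f τ ((Real.cos τ)⁻¹ • x) : ℝ) : ℂ))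


/-- the real-valued L² norm -/
def nrm {n : ℕ} {F : Type} [NormedAddCommGroup F] (q : Rn n → F) : ℝ := lpNorm q 2 volume

section
variable {n : ℕ} {F : Type} [NormedAddCommGroup F] {G : Type} [NormedAddCommGroup G]

lemma nrm_nonneg (q : Rn n → F) : 0 ≤ nrm q := lpNorm_nonneg

lemma nrm_sq {q : Rn n → F} (h : MemLp q 2 volume) : nrm q ^ 2 = ∫ x, ‖q x‖ ^ 2 := by
  unfold nrm
  rw [lpNorm_eq_integral_norm_rpow_toReal (by norm_num) (by norm_num) h.1]
  simp only [ENNReal.toReal_ofNat, Real.rpow_two]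
  rw [← Real.rpow_natCast, ← Real.rpow_mul (integral_nonneg fun x => by positivity)]
  norm_num

lemma nrm_eq_sqrt {q : Rn n → F} (h : MemLp q 2 volume) : nrm q = Real.sqrt (∫ x, ‖q x‖ ^ 2) := by
  rw [← nrm_sq h, Real.sqrt_sq (nrm_nonneg q)]

lemma ofReal_nrm {q : Rn n → F} (h : MemLp q 2 volume) :
    ENNReal.ofReal (nrm q) = eLpNorm q 2 volume := ofReal_lpNorm h

lemma memLp_sq_integrable {q : Rn n → F} (h : MemLp q 2 volume) :
    Integrable (fun x => ‖q x‖ ^ 2) := h.integrable_norm_pow (by norm_num)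

lemma l2_cs {f : Rn n → F} {g : Rn n → G} (hf : MemLp f 2 volume) (hg : MemLp g 2 volume) :
    Integrable (fun x => ‖f x‖ * ‖g x‖) ∧ ∫ x, ‖f x‖ * ‖g x‖ ≤ nrm f * nrm g := by
  refine ⟨hf.norm.integrable_mul hg.norm, ?_⟩
  have h := integral_mul_le_Lp_mul_Lq_of_nonneg (μ := (volume : Measure (Rn n)))
    (p := 2) (q := 2) (Real.HolderConjugate.two_two) (f := fun x => ‖f x‖) (g := fun x => ‖g x‖)
    (Eventually.of_forall fun x => norm_nonneg _) (Eventually.of_forall fun x => norm_nonneg _)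
    (by simpa using hf.norm) (by simpa using hg.norm)
  refine h.trans (le_of_eq ?_)
  rw [nrm_eq_sqrt hf, nrm_eq_sqrt hg, Real.sqrt_eq_rpow, Real.sqrt_eq_rpow]
  simp

lemma nrm_mono {f : Rn n → F} {g : Rn n → G} (hg : MemLp g 2 volume)
    (hf : AEStronglyMeasurable f volume) (h : ∀ x, ‖f x‖ ≤ ‖g x‖) :
    MemLp f 2 volume ∧ nrm f ≤ nrm g := by
  have hm : MemLp f 2 volume := hg.of_le hf (Eventually.of_forall h)
  refine ⟨hm, ?_⟩
  have := lpNorm_mono_real (p := 2) (μ := volume) (f := f) hg.norm h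
  unfold nrm
  rwa [lpNorm_norm hg.1] at this

lemma nrm_add_le {f g : Rn n → F} (hf : MemLp f 2 volume) :
    nrm (fun x => f x + g x) ≤ nrm f + nrm g :=
  lpNorm_add_le hf (by norm_num)

lemma nrm_sub_le {f g : Rn n → F} (hf : MemLp f 2 volume) :
    nrm (fun x => f x - g x) ≤ nrm f + nrm g :=
  lpNorm_sub_le hf (by norm_num)

lemma nrm_const_mul (c : ℂ) (f : Rn n → ℂ) : nrm (fun x => c * f x) = ‖c‖ * nrm f := by
  have := lpNorm_const_smul (p := 2) c f volume
  exact this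

lemma nrm_sum_le {ι : Type} (s : Finset ι) {f : ι → Rn n → F} (hf : ∀ i ∈ s, MemLp (f i) 2 volume) :
    nrm (fun x => ∑ i ∈ s, f i x) ≤ ∑ i ∈ s, nrm (f i) := by
  have := lpNorm_sum_le (p := 2) (μ := volume) hf (by norm_num)
  unfold nrm
  convert this using 2
  ext x; simp

lemma nrm_bdd_mul {V f : Rn n → ℂ} {C : ℝ} (hC : 0 ≤ C) (hf : MemLp f 2 volume)
    (hV : AEStronglyMeasurable (fun x => V x * f x) volume) (h : ∀ x, ‖V x‖ ≤ C) :
    MemLp (fun x => V x * f x) 2 volume ∧ nrm (fun x => V x * f x) ≤ C * nrm f := by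
  have h2 : MemLp (fun x => (C : ℂ) * f x) 2 volume := hf.const_mul _
  have := nrm_mono h2 hV (fun x => by
    simp only [norm_mul, Complex.norm_real, Real.norm_eq_abs, abs_of_nonneg hC]
    gcongr; exact h x)
  refine ⟨this.1, this.2.trans (le_of_eq ?_)⟩
  rw [nrm_const_mul]; simp [abs_of_nonneg hC]

lemma memLp_translate {f : Rn n → F} (hf : MemLp f 2 volume) (h : Rn n) :
    MemLp (fun x => f (x + h)) 2 volume :=
  hf.comp_measurePreserving (measurePreserving_add_right volume h)

lemma nrm_translate {f : Rn n → F} (hf : MemLp f 2 volume) (h : Rn n) :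
    nrm (fun x => f (x + h)) = nrm f := by
  rw [nrm_eq_sqrt hf, nrm_eq_sqrt (memLp_translate hf h)]
  congr 1
  exact integral_add_right_eq_self (fun x => ‖f x‖ ^ 2) h

end

/-- the j-th partial derivative -/
def dj {n : ℕ} (j : Fin n) (φ : Rn n → ℂ) (x : Rn n) : ℂ :=
  fderiv ℝ φ x (EuclideanSpace.single j 1)

/-- functions of class C¹ and H¹ -/
structure IsH1 {n : ℕ} (h : Rn n → ℂ) : Prop where
  diff : ContDiff ℝ 1 h
  mem : MemLp h 2 volume
  dmem : ∀ j, MemLp (dj j h) 2 volume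

/-- a norm on H¹ -/
def H1n {n : ℕ} (h : Rn n → ℂ) : ℝ := nrm h + ∑ j, nrm (dj j h)

section
variable {n : ℕ}

lemma H1n_nonneg (h : Rn n → ℂ) : 0 ≤ H1n h :=
  add_nonneg (nrm_nonneg _) (Finset.sum_nonneg fun _ _ => nrm_nonneg _)

lemma nrm_le_H1n (h : Rn n → ℂ) : nrm h ≤ H1n h :=
  le_add_of_nonneg_right (Finset.sum_nonneg fun _ _ => nrm_nonneg _)

lemma nrm_dj_le_H1n (h : Rn n → ℂ) (j : Fin n) : nrm (dj j h) ≤ H1n h := by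
  unfold H1n
  have := Finset.single_le_sum (f := fun j => nrm (dj j h)) (fun i _ => nrm_nonneg _)
    (Finset.mem_univ j)
  have h2 := nrm_nonneg h
  linarith

lemma dj_add {j : Fin n} {f g : Rn n → ℂ} (hf : Differentiable ℝ f) (hg : Differentiable ℝ g) :
    dj j (fun x => f x + g x) = fun x => dj j f x + dj j g x := by
  ext x
  unfold dj
  rw [fderiv_fun_add (hf x) (hg x)]; simp

lemma dj_sub {j : Fin n} {f g : Rn n → ℂ} (hf : Differentiable ℝ f) (hg : Differentiable ℝ g) :
    dj j (fun x => f x - g x) = fun x => dj j f x - dj j g x := by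
  ext x
  unfold dj
  rw [fderiv_fun_sub (hf x) (hg x)]; simp

lemma dj_const_mul {j : Fin n} {f : Rn n → ℂ} (c : ℂ) (hf : Differentiable ℝ f) :
    dj j (fun x => c * f x) = fun x => c * dj j f x := by
  ext x
  unfold dj
  rw [fderiv_const_mul (hf x)]; simp

lemma dj_mul {j : Fin n} {f g : Rn n → ℂ} (hf : Differentiable ℝ f) (hg : Differentiable ℝ g) :
    dj j (fun x => f x * g x) = fun x => f x * dj j g x + g x * dj j f x := by
  ext x
  unfold dj
  rw [fderiv_fun_mul (hf x) (hg x)]; simp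

lemma dj_translate {j : Fin n} {f : Rn n → ℂ} (h : Rn n) :
    dj j (fun x => f (x + h)) = fun x => dj j f (x + h) := by
  ext x
  unfold dj
  rw [fderiv_comp_add_right]

lemma lap_eq (φ : Rn n → ℂ) : lap φ = fun x => ∑ j, dj j (dj j φ) x := rfl

lemma dj_contDiff {j : Fin n} {f : Rn n → ℂ} {k m : WithTop ℕ∞} (hf : ContDiff ℝ m f)
    (h : k + 1 ≤ m) : ContDiff ℝ k (dj j f) :=
  (hf.fderiv_right h).clm_apply contDiff_const

lemma IsH1.differentiable {f : Rn n → ℂ} (hf : IsH1 f) : Differentiable ℝ f :=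
  hf.diff.differentiable (by norm_num)

lemma IsH1.sub {f g : Rn n → ℂ} (hf : IsH1 f) (hg : IsH1 g) : IsH1 (fun x => f x - g x) := by
  refine ⟨hf.diff.sub hg.diff, hf.mem.sub hg.mem, fun j => ?_⟩
  rw [dj_sub hf.differentiable hg.differentiable]
  exact (hf.dmem j).sub (hg.dmem j)

lemma IsH1.add {f g : Rn n → ℂ} (hf : IsH1 f) (hg : IsH1 g) : IsH1 (fun x => f x + g x) := by
  refine ⟨hf.diff.add hg.diff, hf.mem.add hg.mem, fun j => ?_⟩
  rw [dj_add hf.differentiable hg.differentiable]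
  exact (hf.dmem j).add (hg.dmem j)

lemma IsH1.const_mul {f : Rn n → ℂ} (c : ℂ) (hf : IsH1 f) : IsH1 (fun x => c * f x) := by
  refine ⟨contDiff_const.mul hf.diff, hf.mem.const_mul c, fun j => ?_⟩
  rw [dj_const_mul c hf.differentiable]
  exact (hf.dmem j).const_mul c

lemma IsH1.translate {f : Rn n → ℂ} (hf : IsH1 f) (h : Rn n) : IsH1 (fun x => f (x + h)) := by
  refine ⟨hf.diff.comp (contDiff_id.add contDiff_const), memLp_translate hf.mem h, fun j => ?_⟩
  rw [dj_translate]
  exact memLp_translate (hf.dmem j) h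

lemma H1n_translate {f : Rn n → ℂ} (hf : IsH1 f) (h : Rn n) : H1n (fun x => f (x + h)) = H1n f := by
  unfold H1n
  rw [nrm_translate hf.mem]
  congr 1
  refine Finset.sum_congr rfl fun j _ => ?_
  rw [dj_translate, nrm_translate (hf.dmem j)]

lemma H1n_add_le {f g : Rn n → ℂ} (hf : IsH1 f) (hg : IsH1 g) :
    H1n (fun x => f x + g x) ≤ H1n f + H1n g := by
  unfold H1n
  have h1 := nrm_add_le (g := g) hf.mem
  have h2 : ∑ j, nrm (dj j (fun x => f x + g x)) ≤ ∑ j, nrm (dj j f) + ∑ j, nrm (dj j g) := by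
    rw [← Finset.sum_add_distrib]
    refine Finset.sum_le_sum fun j _ => ?_
    rw [dj_add hf.differentiable hg.differentiable]
    exact nrm_add_le (hf.dmem j)
  linarith

lemma H1n_sub_le {f g : Rn n → ℂ} (hf : IsH1 f) (hg : IsH1 g) :
    H1n (fun x => f x - g x) ≤ H1n f + H1n g := by
  unfold H1n
  have h1 := nrm_sub_le (g := g) hf.mem
  have h2 : ∑ j, nrm (dj j (fun x => f x - g x)) ≤ ∑ j, nrm (dj j f) + ∑ j, nrm (dj j g) := by
    rw [← Finset.sum_add_distrib]
    refine Finset.sum_le_sum fun j _ => ?_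
    rw [dj_sub hf.differentiable hg.differentiable]
    exact nrm_sub_le (hf.dmem j)
  linarith

lemma H1n_const_mul {f : Rn n → ℂ} (c : ℂ) (hf : IsH1 f) :
    H1n (fun x => c * f x) = ‖c‖ * H1n f := by
  unfold H1n
  rw [nrm_const_mul, mul_add, Finset.mul_sum]
  congr 1
  refine Finset.sum_congr rfl fun j _ => ?_
  rw [dj_const_mul c hf.differentiable, nrm_const_mul]

lemma schwartz_memLp (φ : SchwartzMap (Rn n) ℂ) : MemLp (⇑φ) 2 volume := φ.memLp 2 volume

/-- the partial derivative of a Schwartz function -/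
def sdj (j : Fin n) (φ : SchwartzMap (Rn n) ℂ) : SchwartzMap (Rn n) ℂ :=
  SchwartzMap.evalCLM ℝ (Rn n) ℂ (EuclideanSpace.single j 1) (SchwartzMap.fderivCLM ℝ (Rn n) ℂ φ)

lemma sdj_coe (j : Fin n) (φ : SchwartzMap (Rn n) ℂ) : ⇑(sdj j φ) = dj j (⇑φ) := by
  ext x
  rfl

lemma schwartz_H1 (φ : SchwartzMap (Rn n) ℂ) : IsH1 (⇑φ) := by
  refine ⟨φ.smooth 1, schwartz_memLp φ, fun j => ?_⟩
  rw [← sdj_coe]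
  exact schwartz_memLp _

end

section
variable {n : ℕ}

lemma hardy_alg {c X A D : ℝ} (hc : 0 < c) (hA : 0 ≤ A) (hD : 0 ≤ D) (hX : 0 ≤ X)
    (h : c * X ^ 2 ≤ 2 * ((A + X) * D)) : X ≤ (1 + 4 / c) * (A + D) := by
  have h4 : 0 ≤ 4 / c := by positivity
  by_cases hXM : X ≤ A + D
  · nlinarith [mul_nonneg h4 (add_nonneg hA hD)]
  · push Not at hXM
    have hXpos : 0 < X := lt_of_le_of_lt (by positivity) hXM
    have h1 : c * X ^ 2 ≤ 4 * (A + D) * X := by nlinarith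
    have h2 : c * X ≤ 4 * (A + D) := by
      have : (c * X) * X ≤ (4 * (A + D)) * X := by nlinarith
      exact le_of_mul_le_mul_right this hXpos
    have h3 : X ≤ 4 / c * (A + D) := by
      rw [div_mul_eq_mul_div, le_div_iff₀ hc]; linarith
    nlinarith

lemma hasFDerivAt_weight (δ μ : ℝ) (hδ : 0 < δ) (y : Rn n) :
    HasFDerivAt (fun y : Rn n => (δ + ‖y‖ ^ 2) ^ (-μ))
      ((-μ * (δ + ‖y‖ ^ 2) ^ (-μ - 1)) • (2 • (innerSL ℝ y))) y := by
  have h1 : HasFDerivAt (fun y : Rn n => δ + ‖y‖ ^ 2) (2 • (innerSL ℝ y)) y :=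
    (hasStrictFDerivAt_norm_sq y).hasFDerivAt.const_add δ
  exact h1.rpow_const (Or.inl (by positivity))

lemma weight_bound {μ t : ℝ} (hμ : 1 / 2 ≤ μ) (hμ1 : μ < 1) (ht : 0 < t) :
    t ^ (1 / 2 - μ) ≤ 1 + t ^ (-μ / 2) := by
  have h0 : 0 ≤ t ^ (-μ / 2) := by positivity
  rcases le_total 1 t with h | h
  · have : t ^ (1 / 2 - μ) ≤ 1 := Real.rpow_le_one_of_one_le_of_nonpos h (by linarith)
    linarith
  · have : t ^ (1 / 2 - μ) ≤ t ^ (-μ / 2) :=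
      Real.rpow_le_rpow_of_exponent_ge ht h (by linarith)
    linarith

lemma coord_le_norm (y : Rn n) (j : Fin n) : |y j| ≤ ‖y‖ := by
  have := PiLp.norm_apply_le y j
  simpa using this

lemma hardy_delta (hn : 2 ≤ n) {μ : ℝ} (hμ : 1 / 2 ≤ μ) (hμ1 : μ < 1) {δ : ℝ} (hδ : 0 < δ)
    {h : Rn n → ℂ} (hh : IsH1 h) :
    MemLp (fun y => (((δ + ‖y‖ ^ 2) ^ (-μ / 2) : ℝ) : ℂ) * h y) 2 volume ∧
    nrm (fun y => (((δ + ‖y‖ ^ 2) ^ (-μ / 2) : ℝ) : ℂ) * h y) ≤ (1 + 4 / (2 - 2 * μ)) * H1n h := by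
  set t : Rn n → ℝ := fun y => δ + ‖y‖ ^ 2 with ht
  have htpos : ∀ y, 0 < t y := fun y => by simp only [ht]; positivity
  have htδ : ∀ y, δ ≤ t y := fun y => by simp only [ht]; nlinarith [sq_nonneg ‖y‖]
  have htc : Continuous t := by simp only [ht]; fun_prop
  have hpc : ∀ r : ℝ, Continuous fun y => t y ^ r := fun r =>
    htc.rpow_const fun y => Or.inl (htpos y).ne'
  have hb : ∀ r : ℝ, 0 ≤ r → ∀ y, t y ^ (-r) ≤ δ ^ (-r) := fun r hr y =>
    Real.rpow_le_rpow_of_nonpos hδ (htδ y) (by linarith)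
  have hmem := nrm_bdd_mul (V := fun y => ((t y ^ (-μ / 2) : ℝ) : ℂ)) (f := h)
    (C := δ ^ (-(μ / 2))) (by positivity) hh.mem
    (((Complex.continuous_ofReal.comp (hpc _)).mul hh.diff.continuous).aestronglyMeasurable)
    (fun y => by
      rw [Complex.norm_real, Real.norm_eq_abs, abs_of_nonneg (by have := htpos y; positivity)]
      have := hb (μ / 2) (by linarith) y
      rwa [show -(μ / 2) = -μ / 2 by ring] at this ⊢)
  refine ⟨hmem.1, ?_⟩
  set X := nrm (fun y => ((t y ^ (-μ / 2) : ℝ) : ℂ) * h y) with hX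
  refine hardy_alg (by linarith) (nrm_nonneg _) (Finset.sum_nonneg fun _ _ => nrm_nonneg _)
    (nrm_nonneg _) ?_
  change (2 - 2 * μ) * X ^ 2 ≤ _
  have hsq : ∀ y, ‖((t y ^ (-μ / 2) : ℝ) : ℂ) * h y‖ ^ 2 = t y ^ (-μ) * ‖h y‖ ^ 2 := fun y => by
    rw [norm_mul, mul_pow, Complex.norm_real, Real.norm_eq_abs, sq_abs, ← Real.rpow_natCast,
      ← Real.rpow_mul (htpos y).le]
    congr 2; push_cast; ring
  have hXsq : X ^ 2 = ∫ y, t y ^ (-μ) * ‖h y‖ ^ 2 := by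
    rw [hX, nrm_sq hmem.1]; simp_rw [hsq]
  have hIntg : Integrable fun y => t y ^ (-μ) * ‖h y‖ ^ 2 := by
    have := memLp_sq_integrable hmem.1
    simp_rw [hsq] at this; exact this
  -- integration by parts
  have hdiffh := hh.differentiable
  have hnd : ∀ y, HasFDerivAt (fun y => ‖h y‖ ^ 2)
      (2 • (innerSL ℝ (h y)).comp (fderiv ℝ h y)) y := fun y =>
    (hdiffh y).hasFDerivAt.norm_sq
  have hcd : ∀ j, Continuous (dj j h) := fun j => (dj_contDiff (k := 0) hh.diff (by norm_num)).continuous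
  have hch := hh.diff.continuous
  have key : ∀ j : Fin n, Integrable (fun y => (t y ^ (-μ) - 2 * μ * (y j) ^ 2 * t y ^ (-μ - 1)) * ‖h y‖ ^ 2) ∧
      ∫ y, (t y ^ (-μ) - 2 * μ * (y j) ^ 2 * t y ^ (-μ - 1)) * ‖h y‖ ^ 2
      ≤ 2 * ((nrm h + X) * nrm (dj j h)) := by
    intro j
    have hcoord : ∀ y : Rn n, HasFDerivAt (fun y : Rn n => y j) (EuclideanSpace.proj (𝕜 := ℝ) j) y := fun y =>
      (EuclideanSpace.proj (𝕜 := ℝ) j : Rn n →L[ℝ] ℝ).hasFDerivAt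
    have hf : ∀ y : Rn n, HasFDerivAt (fun y : Rn n => y j * t y ^ (-μ))
        (y j • ((-μ * (δ + ‖y‖ ^ 2) ^ (-μ - 1)) • (2 • (innerSL ℝ y))) +
          t y ^ (-μ) • (EuclideanSpace.proj (𝕜 := ℝ) j)) y := fun y =>
      (hcoord y).mul (hasFDerivAt_weight δ μ hδ y)
    have hfd : ∀ y : Rn n, fderiv ℝ (fun y : Rn n => y j * t y ^ (-μ)) y (EuclideanSpace.single j 1)
        = t y ^ (-μ) - 2 * μ * (y j) ^ 2 * t y ^ (-μ - 1) := fun y => by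
      rw [(hf y).fderiv]
      simp [EuclideanSpace.inner_single_right, ht]
      ring
    have hgd : ∀ y : Rn n, fderiv ℝ (fun y => ‖h y‖ ^ 2) y (EuclideanSpace.single j 1)
        = 2 * inner ℝ (h y) (dj j h y) := fun y => by
      rw [(hnd y).fderiv]; simp [dj]; ring
    have hycont : Continuous fun y : Rn n => y j := by fun_prop
    have hfb : ∀ y : Rn n, |y j * t y ^ (-μ)| ≤ t y ^ (1 / 2 - μ) := fun y => by
      rw [abs_mul, abs_of_nonneg (Real.rpow_nonneg (htpos y).le _)]
      have h1 : |y j| ≤ t y ^ (1 / 2 : ℝ) := by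
        rw [← Real.sqrt_eq_rpow]
        refine (coord_le_norm y j).trans (Real.le_sqrt_of_sq_le ?_)
        simp only [ht]; linarith
      calc |y j| * t y ^ (-μ) ≤ t y ^ (1 / 2 : ℝ) * t y ^ (-μ) := by
            gcongr
        _ = t y ^ (1 / 2 - μ) := by rw [← Real.rpow_add (htpos y)]; ring_nf
    have hfb2 : ∀ y : Rn n, |y j * t y ^ (-μ)| ≤ δ ^ (-(μ - 1 / 2)) := fun y =>
      (hfb y).trans (by
        have := hb (μ - 1 / 2) (by linarith) y
        rwa [show (1 / 2 - μ) = -(μ - 1 / 2) by ring])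
    have hsqI := memLp_sq_integrable hh.mem
    have hyt : ∀ y : Rn n, (y j) ^ 2 * t y ^ (-μ - 1) ≤ t y ^ (-μ) := fun y => by
      have h1 : (y j) ^ 2 ≤ t y := by
        have := coord_le_norm y j
        have h3 : (y j) ^ 2 ≤ ‖y‖ ^ 2 := by rw [← sq_abs]; gcongr
        simp only [ht]; linarith
      calc (y j) ^ 2 * t y ^ (-μ - 1) ≤ t y * t y ^ (-μ - 1) := by
            gcongr
        _ = t y ^ (1 : ℝ) * t y ^ (-μ - 1) := by rw [Real.rpow_one]
        _ = t y ^ (-μ) := by rw [← Real.rpow_add (htpos y)]; ring_nf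
    have hI1 : Integrable (fun y => (t y ^ (-μ) - 2 * μ * (y j) ^ 2 * t y ^ (-μ - 1)) * ‖h y‖ ^ 2) := by
      refine (hIntg.const_mul 3).mono' ?_ (Eventually.of_forall fun y => ?_)
      · exact ((((hpc _).sub ((continuous_const.mul (hycont.pow 2)).mul (hpc _)))).mul
          ((hch.norm).pow 2)).aestronglyMeasurable
      · rw [norm_mul, Real.norm_eq_abs, Real.norm_eq_abs, abs_of_nonneg (sq_nonneg ‖h y‖), ← mul_assoc]
        gcongr
        have h1 := hyt y
        have h2 : 0 ≤ (y j) ^ 2 * t y ^ (-μ - 1) := mul_nonneg (sq_nonneg _) (Real.rpow_nonneg (htpos y).le _)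
        rw [abs_le]; constructor <;> nlinarith
    refine ⟨hI1, ?_⟩
    have hhd := l2_cs hh.mem (hh.dmem j)
    have hI2 : Integrable (fun y : Rn n => (y j * t y ^ (-μ)) * (2 * inner ℝ (h y) (dj j h y))) := by
      refine (hhd.1.const_mul (2 * δ ^ (-(μ - 1 / 2)))).mono' ?_ (Eventually.of_forall fun y => ?_)
      · exact ((hycont.mul (hpc _)).mul (continuous_const.mul (hch.inner (hcd j)))).aestronglyMeasurable
      · rw [norm_mul, Real.norm_eq_abs, norm_mul, Real.norm_eq_abs]
        have h1 := hfb2 y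
        have h2 : ‖(inner ℝ (h y) (dj j h y) : ℝ)‖ ≤ ‖h y‖ * ‖dj j h y‖ := norm_inner_le_norm _ _
        calc |y j * t y ^ (-μ)| * (|2| * ‖(inner ℝ (h y) (dj j h y) : ℝ)‖)
            ≤ δ ^ (-(μ - 1 / 2)) * (|2| * (‖h y‖ * ‖dj j h y‖)) := by gcongr
          _ = _ := by rw [abs_of_pos (by norm_num : (0:ℝ) < 2)]; ring
    have hI3 : Integrable (fun y : Rn n => (y j * t y ^ (-μ)) * ‖h y‖ ^ 2) := by
      refine (hsqI.const_mul (δ ^ (-(μ - 1 / 2)))).mono' ?_ (Eventually.of_forall fun y => ?_)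
      · exact ((hycont.mul (hpc _)).mul ((hch.norm).pow 2)).aestronglyMeasurable
      · rw [norm_mul, Real.norm_eq_abs, Real.norm_eq_abs, abs_of_nonneg (sq_nonneg ‖h y‖)]
        gcongr
        exact hfb2 y
    have hibp := integral_mul_fderiv_eq_neg_fderiv_mul_of_integrable (μ := volume) (𝕜 := ℝ)
      (f := fun y : Rn n => y j * t y ^ (-μ)) (g := fun y => ‖h y‖ ^ 2)
      (v := EuclideanSpace.single j 1) (by simp_rw [hfd]; exact hI1) (by simp_rw [hgd]; exact hI2) hI3
      (fun y _ => (hf y).differentiableAt) (fun y _ => (hnd y).differentiableAt)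
    simp_rw [hfd, hgd] at hibp
    have hXd := l2_cs hmem.1 (hh.dmem j)
    calc ∫ y, (t y ^ (-μ) - 2 * μ * (y j) ^ 2 * t y ^ (-μ - 1)) * ‖h y‖ ^ 2
        = ∫ y, -((y j * t y ^ (-μ)) * (2 * inner ℝ (h y) (dj j h y))) := by
          rw [integral_neg, hibp]; ring
      _ ≤ ∫ y, 2 * (‖h y‖ * ‖dj j h y‖ + ‖((t y ^ (-μ / 2) : ℝ) : ℂ) * h y‖ * ‖dj j h y‖) := by
          refine integral_mono hI2.neg ((hhd.1.add hXd.1).const_mul 2) fun y => ?_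
          have h2 : |(inner ℝ (h y) (dj j h y) : ℝ)| ≤ ‖h y‖ * ‖dj j h y‖ := abs_real_inner_le_norm _ _
          have h3 := (hfb y).trans (weight_bound hμ hμ1 (htpos y))
          have h4 : ‖((t y ^ (-μ / 2) : ℝ) : ℂ) * h y‖ = t y ^ (-μ / 2) * ‖h y‖ := by
            rw [norm_mul, Complex.norm_real, Real.norm_eq_abs, abs_of_nonneg (Real.rpow_nonneg (htpos y).le _)]
          simp only [Pi.neg_apply]
          rw [h4]
          calc -((y j * t y ^ (-μ)) * (2 * inner ℝ (h y) (dj j h y)))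
              ≤ |(y j * t y ^ (-μ)) * (2 * inner ℝ (h y) (dj j h y))| := neg_le_abs _
            _ = 2 * (|y j * t y ^ (-μ)| * |(inner ℝ (h y) (dj j h y) : ℝ)|) := by
                rw [abs_mul (y j * t y ^ (-μ)), abs_mul 2, abs_of_pos (by norm_num : (0:ℝ) < 2)]; ring
            _ ≤ 2 * ((1 + t y ^ (-μ / 2)) * (‖h y‖ * ‖dj j h y‖)) := by gcongr
            _ = _ := by ring
      _ = 2 * ((∫ y, ‖h y‖ * ‖dj j h y‖) + ∫ y, ‖((t y ^ (-μ / 2) : ℝ) : ℂ) * h y‖ * ‖dj j h y‖) := by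
          rw [integral_const_mul, integral_add hhd.1 hXd.1]
      _ ≤ 2 * (nrm h * nrm (dj j h) + X * nrm (dj j h)) := by
          gcongr
          · exact hhd.2
          · exact hXd.2
      _ = _ := by ring
  -- sum
  have hsum : ∑ j, ∫ y, (t y ^ (-μ) - 2 * μ * (y j) ^ 2 * t y ^ (-μ - 1)) * ‖h y‖ ^ 2
      ≤ 2 * ((nrm h + X) * ∑ j, nrm (dj j h)) := by
    rw [Finset.mul_sum, Finset.mul_sum]
    exact Finset.sum_le_sum fun j _ => (key j).2
  refine le_trans ?_ hsum
  rw [← integral_finsetSum _ (fun j _ => (key j).1), hXsq, ← integral_const_mul]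
  refine integral_mono (hIntg.const_mul _) (integrable_finsetSum _ (fun j _ => (key j).1)) fun y => ?_
  simp only
  rw [← Finset.sum_mul, ← mul_assoc]
  gcongr
  have h1 : ∑ j : Fin n, (t y ^ (-μ) - 2 * μ * (y j) ^ 2 * t y ^ (-μ - 1))
      = n * t y ^ (-μ) - 2 * μ * (‖y‖ ^ 2 * t y ^ (-μ - 1)) := by
    rw [Finset.sum_sub_distrib, ← Finset.sum_mul, ← Finset.mul_sum, EuclideanSpace.norm_sq_eq]
    simp [mul_assoc]
  rw [h1]
  have h2 : ‖y‖ ^ 2 * t y ^ (-μ - 1) ≤ t y ^ (-μ) := by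
    calc ‖y‖ ^ 2 * t y ^ (-μ - 1) ≤ t y * t y ^ (-μ - 1) := by
          gcongr
          simp only [ht]; linarith
      _ = t y ^ (1 : ℝ) * t y ^ (-μ - 1) := by rw [Real.rpow_one]
      _ = t y ^ (-μ) := by rw [← Real.rpow_add (htpos y)]; ring_nf
  have h3 : (2 : ℝ) ≤ n := by exact_mod_cast hn
  have h4 : 0 ≤ t y ^ (-μ) := Real.rpow_nonneg (htpos y).le _
  nlinarith

end

section
variable {n : ℕ}

lemma memLp_nrm_of_tendsto {F : ℕ → Rn n → ℂ} {G : Rn n → ℂ} {C : ℝ}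
    (hF : ∀ k, MemLp (F k) 2 volume) (hC : ∀ k, nrm (F k) ≤ C)
    (hG : AEStronglyMeasurable G volume)
    (hlim : ∀ᵐ x, Tendsto (fun k => F k x) atTop (𝓝 (G x))) :
    MemLp G 2 volume ∧ nrm G ≤ C := by
  have hC0 : 0 ≤ C := (nrm_nonneg _).trans (hC 0)
  have h1 : eLpNorm G 2 volume ≤ ENNReal.ofReal C := by
    refine (Lp.eLpNorm_lim_le_liminf_eLpNorm (fun k => (hF k).1) G hlim).trans ?_
    refine (liminf_le_liminf (v := fun _ => ENNReal.ofReal C) (Eventually.of_forall fun k => ?_)).trans ?_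
    · rw [← ofReal_nrm (hF k)]
      exact ENNReal.ofReal_le_ofReal (hC k)
    · simp
  have hm : MemLp G 2 volume := ⟨hG, h1.trans_lt ENNReal.ofReal_lt_top⟩
  refine ⟨hm, ?_⟩
  rw [← ofReal_nrm hm] at h1
  exact (ENNReal.ofReal_le_ofReal_iff hC0).1 h1

lemma hardy_zero (hn : 2 ≤ n) {γ : ℝ} (hγ0 : 0 < γ) (hγ1 : γ < 1) :
    ∃ C, 0 ≤ C ∧ ∀ h : Rn n → ℂ, IsH1 h →
      MemLp (fun y => ((‖y‖ ^ (-γ) : ℝ) : ℂ) * h y) 2 volume ∧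
      nrm (fun y => ((‖y‖ ^ (-γ) : ℝ) : ℂ) * h y) ≤ C * H1n h := by
  have : Nonempty (Fin n) := ⟨⟨0, by omega⟩⟩
  set μ := max γ (1 / 2) with hμd
  have hμ : 1 / 2 ≤ μ := le_max_right _ _
  have hμ1 : μ < 1 := max_lt hγ1 (by norm_num)
  have hγμ : γ ≤ μ := le_max_left _ _
  have h2 : 0 ≤ 4 / (2 - 2 * μ) := div_nonneg (by norm_num) (by linarith)
  refine ⟨1 + (1 + 4 / (2 - 2 * μ)), by positivity, fun h hh => ?_⟩
  have hmeas : ∀ r : ℝ, AEStronglyMeasurable (fun y : Rn n => ((‖y‖ ^ r : ℝ) : ℂ) * h y) volume :=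
    fun r => ((Complex.measurable_ofReal.comp (measurable_norm.pow_const r)).aestronglyMeasurable).mul
      hh.diff.continuous.aestronglyMeasurable
  have hδ : ∀ k : ℕ, 0 < 1 / ((k : ℝ) + 1) := fun k => Nat.one_div_pos_of_nat
  have hμlim := memLp_nrm_of_tendsto
    (F := fun (k : ℕ) y => (((1 / ((k : ℝ) + 1) + ‖y‖ ^ 2) ^ (-μ / 2) : ℝ) : ℂ) * h y)
    (G := fun y => ((‖y‖ ^ (-μ) : ℝ) : ℂ) * h y)
    (fun k => (hardy_delta hn hμ hμ1 (hδ k) hh).1) (fun k => (hardy_delta hn hμ hμ1 (hδ k) hh).2)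
    (hmeas _) (by
      have h0 : ∀ᵐ y : Rn n, y ≠ 0 := by simp [ae_iff]
      filter_upwards [h0] with y hy
      refine Tendsto.mul_const _ ((Complex.continuous_ofReal.tendsto _).comp ?_)
      have hpos : 0 < ‖y‖ := norm_pos_iff.2 hy
      have e : ‖y‖ ^ (-μ) = (0 + ‖y‖ ^ 2) ^ (-μ / 2) := by
        rw [zero_add, ← Real.rpow_natCast, ← Real.rpow_mul hpos.le]; congr 1; push_cast; ring
      rw [e]
      exact (tendsto_one_div_add_atTop_nhds_zero_nat.add_const _).rpow_const (Or.inl (by positivity)))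
  have h3 := nrm_mono (f := fun y => ((‖y‖ ^ (-γ) : ℝ) : ℂ) * h y)
    (g := fun y => ‖h y‖ + ‖((‖y‖ ^ (-μ) : ℝ) : ℂ) * h y‖) (hh.mem.norm.add hμlim.1.norm) (hmeas _)
    (fun y => by
      rw [Real.norm_eq_abs, abs_of_nonneg (by positivity), norm_mul, norm_mul, Complex.norm_real,
        Complex.norm_real, Real.norm_eq_abs, Real.norm_eq_abs, abs_of_nonneg (by positivity),
        abs_of_nonneg (by positivity)]
      have : ‖y‖ ^ (-γ) ≤ 1 + ‖y‖ ^ (-μ) := by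
        rcases eq_or_lt_of_le (norm_nonneg y) with h0 | h0
        · rw [← h0, Real.zero_rpow (by linarith), Real.zero_rpow (by linarith)]; norm_num
        · have h4 : 0 ≤ ‖y‖ ^ (-μ) := by positivity
          rcases le_total 1 ‖y‖ with h | h
          · have := Real.rpow_le_one_of_one_le_of_nonpos h (show -γ ≤ 0 by linarith)
            linarith
          · have := Real.rpow_le_rpow_of_exponent_ge h0 h (show -μ ≤ -γ by linarith)
            linarith
      nlinarith [norm_nonneg (h y)])
  refine ⟨h3.1, h3.2.trans ?_⟩
  have h5 := nrm_add_le (f := fun y => ‖h y‖) (g := fun y => ‖((‖y‖ ^ (-μ) : ℝ) : ℂ) * h y‖) hh.mem.norm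
  have e1 : nrm (fun y => ‖h y‖) = nrm h := lpNorm_norm hh.mem.1 2
  have e2 : nrm (fun y => ‖((‖y‖ ^ (-μ) : ℝ) : ℂ) * h y‖) = nrm (fun y => ((‖y‖ ^ (-μ) : ℝ) : ℂ) * h y) :=
    lpNorm_norm (hmeas _) 2
  rw [e1, e2] at h5
  have := nrm_le_H1n h
  have := hμlim.2
  linarith

lemma hardy (hn : 2 ≤ n) {γ : ℝ} (hγ0 : 0 < γ) (hγ1 : γ < 1) :
    ∃ C, 0 ≤ C ∧ ∀ h : Rn n → ℂ, IsH1 h → ∀ x : Rn n,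
      MemLp (fun y => ((‖x - y‖ ^ (-γ) : ℝ) : ℂ) * h y) 2 volume ∧
      nrm (fun y => ((‖x - y‖ ^ (-γ) : ℝ) : ℂ) * h y) ≤ C * H1n h := by
  obtain ⟨C, hC, H⟩ := hardy_zero hn hγ0 hγ1
  refine ⟨C, hC, fun h hh x => ?_⟩
  have h1 := H _ (hh.translate x)
  have e : (fun y => ((‖x - y‖ ^ (-γ) : ℝ) : ℂ) * h y)
      = fun y => (fun z => ((‖z‖ ^ (-γ) : ℝ) : ℂ) * h (z + x)) (y + -x) := by
    ext y
    simp only [neg_add_cancel_right]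
    rw [← sub_eq_add_neg, norm_sub_rev]
  rw [e]
  refine ⟨memLp_translate h1.1 _, ?_⟩
  rw [nrm_translate h1.1, ← H1n_translate hh x]
  exact h1.2

/-- the kernel bound, in integrable form -/
def HardyC (n : ℕ) (γ C : ℝ) : Prop := 0 ≤ C ∧ ∀ g h : Rn n → ℂ, MemLp g 2 volume → IsH1 h →
  ∀ x : Rn n, Integrable (fun y => ‖x - y‖ ^ (-γ) * (‖g y‖ * ‖h y‖)) ∧
    ∫ y, ‖x - y‖ ^ (-γ) * (‖g y‖ * ‖h y‖) ≤ C * (nrm g * H1n h)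

lemma exists_hardyC (hn : 2 ≤ n) {γ : ℝ} (hγ0 : 0 < γ) (hγ1 : γ < 1) : ∃ C, HardyC n γ C := by
  obtain ⟨C, hC, H⟩ := hardy (n := n) hn hγ0 hγ1
  refine ⟨C, hC, fun g h hg hh x => ?_⟩
  have h1 := H h hh x
  have h2 := l2_cs hg h1.1
  have e : (fun y => ‖g y‖ * ‖((‖x - y‖ ^ (-γ) : ℝ) : ℂ) * h y‖)
      = fun y => ‖x - y‖ ^ (-γ) * (‖g y‖ * ‖h y‖) := by
    ext y
    rw [norm_mul, Complex.norm_real, Real.norm_eq_abs, abs_of_nonneg (by positivity)]; ring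
  rw [e] at h2
  refine ⟨h2.1, h2.2.trans ?_⟩
  calc nrm g * _ ≤ nrm g * (C * H1n h) := mul_le_mul_of_nonneg_left h1.2 (nrm_nonneg _)
    _ = _ := by ring

lemma kernel_meas (γ : ℝ) (x : Rn n) : Measurable fun y : Rn n => ‖x - y‖ ^ (-γ) :=
  ((measurable_const.sub measurable_id).norm).pow_const _

/-- the Hartree potential of a difference of densities -/
lemma HardyC.integrable {γ C : ℝ} (H : HardyC n γ C) {g h : Rn n → ℂ} (hg : MemLp g 2 volume)
    (hh : IsH1 h) {ρ : Rn n → ℝ} (hρ : AEStronglyMeasurable ρ volume)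
    (hle : ∀ y, |ρ y| ≤ ‖g y‖ * ‖h y‖) (x : Rn n) :
    Integrable (fun y => ‖x - y‖ ^ (-γ) * ρ y) := by
  refine ((H.2 g h hg hh x).1).mono' ((kernel_meas γ x).aestronglyMeasurable.mul hρ)
    (Eventually.of_forall fun y => ?_)
  rw [norm_mul, Real.norm_eq_abs, Real.norm_eq_abs, abs_of_nonneg (by positivity : 0 ≤ ‖x - y‖ ^ (-γ))]
  gcongr
  exact hle y

lemma HardyC.bound {γ C : ℝ} (H : HardyC n γ C) {g h : Rn n → ℂ} (hg : MemLp g 2 volume)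
    (hh : IsH1 h) {ρ : Rn n → ℝ}
    (hle : ∀ y, |ρ y| ≤ ‖g y‖ * ‖h y‖) (x : Rn n) :
    |conv γ ρ x| ≤ C * (nrm g * H1n h) := by
  unfold conv
  rw [← Real.norm_eq_abs]
  refine (norm_integral_le_of_norm_le (H.2 g h hg hh x).1 (Eventually.of_forall fun y => ?_)).trans
    (H.2 g h hg hh x).2
  rw [norm_mul, Real.norm_eq_abs, Real.norm_eq_abs, abs_of_nonneg (by positivity : 0 ≤ ‖x - y‖ ^ (-γ))]
  gcongr
  exact hle y

lemma hartree_nonneg (γ : ℝ) (u : Rn n → ℂ) (x : Rn n) : 0 ≤ hartree γ u x := by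
  unfold hartree conv
  exact integral_nonneg fun y => mul_nonneg (by positivity) (Complex.normSq_nonneg _)

lemma HardyC.hartree_int {γ C : ℝ} (H : HardyC n γ C) {g : Rn n → ℂ} (hg : IsH1 g) (x : Rn n) :
    Integrable (fun y => ‖x - y‖ ^ (-γ) * Complex.normSq (g y)) := by
  refine H.integrable hg.mem hg ?_ (fun y => ?_) x
  · exact (Complex.continuous_normSq.comp hg.diff.continuous).aestronglyMeasurable
  · rw [abs_of_nonneg (Complex.normSq_nonneg _), Complex.normSq_eq_norm_sq, sq]

lemma HardyC.hartree_le {γ C : ℝ} (H : HardyC n γ C) {g : Rn n → ℂ} (hg : IsH1 g) (x : Rn n) :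
    hartree γ g x ≤ C * (nrm g * H1n g) := by
  refine (le_abs_self _).trans (H.bound hg.mem hg (fun y => ?_) x)
  rw [abs_of_nonneg (Complex.normSq_nonneg _), Complex.normSq_eq_norm_sq, sq]

lemma HardyC.hartree_sub_le {γ C : ℝ} (H : HardyC n γ C) {g h : Rn n → ℂ} (hg : IsH1 g)
    (hh : IsH1 h) (x : Rn n) :
    |hartree γ g x - hartree γ h x| ≤ C * (nrm (fun y => g y - h y) * (H1n g + H1n h)) := by
  have h1 : hartree γ g x - hartree γ h x
      = conv γ (fun y => Complex.normSq (g y) - Complex.normSq (h y)) x := by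
    unfold hartree conv
    rw [← integral_sub (H.hartree_int hg x) (H.hartree_int hh x)]
    simp_rw [mul_sub]
  have hs := hg.sub hh
  have e : (fun y => Complex.normSq (g y) - Complex.normSq (h y))
      = fun y => (inner ℝ (g y - h y) (g y + h y) : ℝ) := by
    ext y
    rw [Complex.normSq_eq_norm_sq, Complex.normSq_eq_norm_sq, inner_sub_left, inner_add_right,
      inner_add_right, real_inner_self_eq_norm_sq, real_inner_self_eq_norm_sq,
      real_inner_comm (g y) (h y)]
    ring
  rw [h1, e]
  refine (H.bound (g := fun y => g y - h y) (h := fun y => g y + h y) hs.mem (hg.add hh)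
    (fun y => abs_real_inner_le_norm _ _) x).trans ?_
  have := H1n_add_le hg hh
  have h2 := nrm_nonneg (fun y => g y - h y)
  gcongr
  exact H.1

end


/-- joint regularity in time and space -/
def JC {n : ℕ} (k : WithTop ℕ∞) (q : ℝ → Rn n → ℂ) : Prop :=
  ContDiff ℝ k (fun p : ℝ × Rn n => q p.1 p.2)

/-- the time derivative -/
def dt {n : ℕ} (q : ℝ → Rn n → ℂ) (s : ℝ) (x : Rn n) : ℂ := deriv (fun σ => q σ x) s

/-- the Schrödinger operator -/
def FF {n : ℕ} (ε : ℝ) (q : ℝ → Rn n → ℂ) (s : ℝ) (x : Rn n) : ℂ :=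
  Complex.I * dt q s x + ((ε / 2 : ℝ) : ℂ) * lap (q s) x

section
variable {n : ℕ}

lemma JC.slice {k : WithTop ℕ∞} {q : ℝ → Rn n → ℂ} (h : JC k q) (s : ℝ) : ContDiff ℝ k (q s) :=
  ContDiff.comp (g := fun p : ℝ × Rn n => q p.1 p.2) h (contDiff_const.prodMk contDiff_id)

lemma JC.tslice {k : WithTop ℕ∞} {q : ℝ → Rn n → ℂ} (h : JC k q) (x : Rn n) :
    ContDiff ℝ k (fun s => q s x) :=
  ContDiff.comp (g := fun p : ℝ × Rn n => q p.1 p.2) h (contDiff_id.prodMk contDiff_const)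

lemma JC.hasDerivAt {q : ℝ → Rn n → ℂ} (h : JC 1 q) (s : ℝ) (x : Rn n) :
    HasDerivAt (fun σ => q σ x) (dt q s x) s :=
  (((h.tslice x).differentiable (by norm_num)) s).hasDerivAt

lemma dt_eq {q : ℝ → Rn n → ℂ} (h : JC 1 q) (s : ℝ) (x : Rn n) :
    dt q s x = fderiv ℝ (fun p : ℝ × Rn n => q p.1 p.2) (s, x) (1, 0) := by
  have h1 : HasDerivAt (fun σ : ℝ => (σ, x)) ((1 : ℝ), (0 : Rn n)) s :=
    (hasDerivAt_id s).prodMk (hasDerivAt_const s x)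
  have h2 := ((ContDiff.differentiable h (by norm_num)) (s, x)).hasFDerivAt.comp_hasDerivAt s h1
  exact h2.deriv

lemma dj_slice_eq {q : ℝ → Rn n → ℂ} (h : JC 1 q) (j : Fin n) (s : ℝ) (x : Rn n) :
    dj j (q s) x = fderiv ℝ (fun p : ℝ × Rn n => q p.1 p.2) (s, x) (0, EuclideanSpace.single j 1) := by
  have h1 : HasFDerivAt (fun y : Rn n => (s, y)) (ContinuousLinearMap.inr ℝ ℝ (Rn n)) x :=
    hasFDerivAt_prodMk_right s x
  have h2 := HasFDerivAt.comp x ((ContDiff.differentiable h (by norm_num)) (s, x)).hasFDerivAt h1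
  unfold dj
  have h3 : fderiv ℝ (q s) x = _ := h2.fderiv
  rw [h3]; simp

lemma JC.dt_contDiff {k m : WithTop ℕ∞} {q : ℝ → Rn n → ℂ} (h : JC m q) (hk : k + 1 ≤ m)
    : JC k (dt q) := by
  have h1 : JC 1 q := h.of_le (le_trans (by simp) hk)
  have : (fun p : ℝ × Rn n => dt q p.1 p.2)
      = fun p => fderiv ℝ (fun p : ℝ × Rn n => q p.1 p.2) p (1, 0) := by
    ext p; exact dt_eq h1 p.1 p.2
  unfold JC
  rw [this]
  exact (ContDiff.fderiv_right h hk).clm_apply contDiff_const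

lemma JC.dj_contDiff {k m : WithTop ℕ∞} {q : ℝ → Rn n → ℂ} (h : JC m q) (j : Fin n)
    (hk : k + 1 ≤ m) : JC k (fun s => dj j (q s)) := by
  have h1 : JC 1 q := h.of_le (le_trans (by simp) hk)
  have : (fun p : ℝ × Rn n => dj j (q p.1) p.2)
      = fun p => fderiv ℝ (fun p : ℝ × Rn n => q p.1 p.2) p (0, EuclideanSpace.single j 1) := by
    ext p; exact dj_slice_eq h1 j p.1 p.2
  unfold JC
  rw [this]
  exact (ContDiff.fderiv_right h hk).clm_apply contDiff_const

lemma conj_contDiff {E : Type*} [NormedAddCommGroup E] [NormedSpace ℝ E] {k : WithTop ℕ∞}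
    {f : E → ℂ} (hf : ContDiff ℝ k f) : ContDiff ℝ k (fun x => conj (f x)) :=
  Complex.conjCLE.contDiff.comp hf

lemma dj_conj {j : Fin n} {f : Rn n → ℂ} (hf : Differentiable ℝ f) :
    dj j (fun x => conj (f x)) = fun x => conj (dj j f x) := by
  ext x
  unfold dj
  have h := (Complex.conjCLE.toContinuousLinearMap.hasFDerivAt (x := f x)).comp x (hf x).hasFDerivAt
  have h3 : fderiv ℝ (fun x => conj (f x)) x = _ := h.fderiv
  rw [h3]; simp

lemma dt_conj {q : ℝ → Rn n → ℂ} (h : JC 1 q) :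
    dt (fun s x => conj (q s x)) = fun s x => conj (dt q s x) := by
  ext s x
  have h := (Complex.conjCLE.toContinuousLinearMap.hasFDerivAt (x := q s x)).comp_hasDerivAt s
    (h.hasDerivAt s x)
  exact h.deriv

lemma JC.mul {k : WithTop ℕ∞} {q r : ℝ → Rn n → ℂ} (hq : JC k q) (hr : JC k r) :
    JC k (fun s x => q s x * r s x) := ContDiff.mul hq hr

lemma JC.conj {k : WithTop ℕ∞} {q : ℝ → Rn n → ℂ} (hq : JC k q) :
    JC k (fun s x => conj (q s x)) := conj_contDiff hq

lemma hasDerivAt_int {g : ℝ → Rn n → ℂ} (hg : JC 1 g) {ψ : Rn n → ℂ} (hψ : Continuous ψ)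
    (hc : HasCompactSupport ψ) (s : ℝ) :
    HasDerivAt (fun s => ∫ x, ψ x * g s x) (∫ x, ψ x * dt g s x) s := by
  have hdt : Continuous (fun p : ℝ × Rn n => dt g p.1 p.2) :=
    (hg.dt_contDiff (k := 0) (by norm_num)).continuous
  have hK : IsCompact ((Metric.closedBall s 1 : Set ℝ) ×ˢ (tsupport ψ)) :=
    (isCompact_closedBall s 1).prod hc
  obtain ⟨C, hC⟩ := hK.exists_bound_of_continuousOn hdt.continuousOn
  refine (hasDerivAt_integral_of_dominated_loc_of_deriv_le (bound := fun x => ‖ψ x‖ * C)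
    (F := fun s x => ψ x * g s x) (F' := fun s x => ψ x * dt g s x)
    (s := Metric.closedBall s 1) (Metric.closedBall_mem_nhds s one_pos) ?_ ?_ ?_ ?_ ?_ ?_).2
  · exact Eventually.of_forall fun σ => (hψ.mul (hg.slice σ).continuous).aestronglyMeasurable
  · exact (hψ.mul (hg.slice s).continuous).integrable_of_hasCompactSupport hc.mul_right
  · exact (hψ.mul (hdt.comp (Continuous.prodMk continuous_const continuous_id))).aestronglyMeasurable
  · refine Eventually.of_forall fun x σ hσ => ?_
    rw [norm_mul]
    by_cases hx : x ∈ tsupport ψ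
    · gcongr
      exact hC (σ, x) ⟨hσ, hx⟩
    · rw [image_eq_zero_of_notMem_tsupport hx]; simp
  · exact (hψ.norm.mul continuous_const).integrable_of_hasCompactSupport hc.norm.mul_right
  · exact Eventually.of_forall fun x σ _ => (hg.hasDerivAt σ x).const_mul _

lemma ibp {ψ g : Rn n → ℂ} (hψ : ContDiff ℝ 1 ψ) (hc : HasCompactSupport ψ) (hg : ContDiff ℝ 1 g)
    (j : Fin n) : ∫ x, ψ x * dj j g x = - ∫ x, dj j ψ x * g x := by
  have hdψ : Continuous (dj j ψ) := (dj_contDiff (k := 0) hψ (by norm_num)).continuous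
  have hdg : Continuous (dj j g) := (dj_contDiff (k := 0) hg (by norm_num)).continuous
  have hcd : HasCompactSupport (dj j ψ) := hc.fderiv_apply (𝕜 := ℝ) _
  refine integral_mul_fderiv_eq_neg_fderiv_mul_of_integrable (𝕜 := ℂ) ?_ ?_ ?_ ?_ ?_
  · exact (hdψ.mul hg.continuous).integrable_of_hasCompactSupport hcd.mul_right
  · exact (hψ.continuous.mul hdg).integrable_of_hasCompactSupport hc.mul_right
  · exact (hψ.continuous.mul hg.continuous).integrable_of_hasCompactSupport hc.mul_right
  · exact fun x _ => hψ.differentiable (by norm_num) x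
  · exact fun x _ => hg.differentiable (by norm_num) x

/-- the flux -/
def flux (p q : Rn n → ℂ) (j : Fin n) (x : Rn n) : ℂ :=
  dj j p x * conj (q x) - p x * conj (dj j q x)

lemma flux_contDiff {p q : Rn n → ℂ} (hp : ContDiff ℝ 2 p) (hq : ContDiff ℝ 2 q) (j : Fin n) :
    ContDiff ℝ 1 (flux p q j) := by
  have h1 : ContDiff ℝ 1 (dj j p) := dj_contDiff hp (by norm_num)
  have h2 : ContDiff ℝ 1 (dj j q) := dj_contDiff hq (by norm_num)
  exact (h1.mul (conj_contDiff (hq.of_le (by norm_num)))).sub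
    ((hp.of_le (by norm_num)).mul (conj_contDiff h2))

lemma dj_flux {p q : Rn n → ℂ} (hp : ContDiff ℝ 2 p) (hq : ContDiff ℝ 2 q) (j : Fin n) (x : Rn n) :
    dj j (flux p q j) x = dj j (dj j p) x * conj (q x) - p x * conj (dj j (dj j q) x) := by
  have h1 : Differentiable ℝ (dj j p) := (dj_contDiff (k := 1) hp (by norm_num)).differentiable (by norm_num)
  have h2 : Differentiable ℝ (dj j q) := (dj_contDiff (k := 1) hq (by norm_num)).differentiable (by norm_num)
  have h3 : Differentiable ℝ p := hp.differentiable (by norm_num)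
  have h4 : Differentiable ℝ q := hq.differentiable (by norm_num)
  have h5 : Differentiable ℝ (fun x => conj (q x)) := Complex.conjCLE.differentiable.comp h4
  have h6 : Differentiable ℝ (fun x => conj (dj j q x)) := Complex.conjCLE.differentiable.comp h2
  unfold flux
  rw [dj_sub (f := fun x => dj j p x * conj (q x)) (g := fun x => p x * conj (dj j q x))
    (h1.mul h5) (h3.mul h6), dj_mul h1 h5, dj_mul h3 h6, dj_conj h4, dj_conj h2]
  ring

lemma lemmaD {q₁ q₂ : ℝ → Rn n → ℂ} (h₁ : JC 2 q₁) (h₂ : JC 2 q₂) {ψ : Rn n → ℂ}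
    (hψ : ContDiff ℝ 1 ψ) (hc : HasCompactSupport ψ) (ε s : ℝ) :
    HasDerivAt (fun s => ∫ x, ψ x * (q₁ s x * conj (q₂ s x)))
      (-(Complex.I * ((ε / 2 : ℝ) : ℂ)) * (∑ j, ∫ x, dj j ψ x * flux (q₁ s) (q₂ s) j x)
        - Complex.I * ∫ x, ψ x * (FF ε q₁ s x * conj (q₂ s x) - q₁ s x * conj (FF ε q₂ s x))) s := by
  have h₁' : JC 1 q₁ := h₁.of_le (by norm_num)
  have h₂' : JC 1 q₂ := h₂.of_le (by norm_num)
  have hD := hasDerivAt_int (h₁'.mul h₂'.conj) hψ.continuous hc s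
  refine hD.congr_deriv ?_
  have hdt : ∀ x, dt (fun s x => q₁ s x * conj (q₂ s x)) s x
      = dt q₁ s x * conj (q₂ s x) + q₁ s x * conj (dt q₂ s x) := fun x => by
    have := (h₁'.hasDerivAt s x).mul ((h₂'.conj).hasDerivAt s x)
    rw [dt_conj h₂'] at this
    exact this.deriv
  have hc1 : ∀ q : ℝ → Rn n → ℂ, JC 2 q → Continuous (dt q s) := fun q h =>
    ((h.dt_contDiff (k := 0) (by norm_num)).slice s).continuous
  have hc2 : ∀ q : ℝ → Rn n → ℂ, JC 2 q → Continuous (lap (q s)) := fun q h => by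
    rw [lap_eq]
    exact continuous_finsetSum _ fun j _ => (dj_contDiff (k := 0) (dj_contDiff (k := 1) (h.slice s)
      (by norm_num)) (by norm_num)).continuous
  have hcF : ∀ q : ℝ → Rn n → ℂ, JC 2 q → Continuous (FF ε q s) := fun q h =>
    (continuous_const.mul (hc1 q h)).add (continuous_const.mul (hc2 q h))
  have hIF : Integrable fun x => ψ x * (FF ε q₁ s x * conj (q₂ s x) - q₁ s x * conj (FF ε q₂ s x)) :=
    (hψ.continuous.mul (((hcF _ h₁).mul (Complex.continuous_conj.comp (h₂.slice s).continuous)).sub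
      ((h₁.slice s).continuous.mul (Complex.continuous_conj.comp (hcF _ h₂))))).integrable_of_hasCompactSupport
      hc.mul_right
  have hIj : ∀ j, Integrable fun x => ψ x * dj j (flux (q₁ s) (q₂ s) j) x := fun j =>
    (hψ.continuous.mul (dj_contDiff (k := 0) (flux_contDiff (h₁.slice s) (h₂.slice s) j)
      (by norm_num)).continuous).integrable_of_hasCompactSupport hc.mul_right
  have hsum : ∑ j, ∫ x, dj j ψ x * flux (q₁ s) (q₂ s) j x
      = - ∫ x, ∑ j, ψ x * dj j (flux (q₁ s) (q₂ s) j) x := by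
    rw [integral_finsetSum _ fun j _ => hIj j, ← Finset.sum_neg_distrib]
    refine Finset.sum_congr rfl fun j _ => ?_
    rw [ibp hψ hc (flux_contDiff (h₁.slice s) (h₂.slice s) j) j, neg_neg]
  rw [hsum, neg_mul_neg, ← integral_const_mul, ← integral_const_mul, ← integral_sub
    ((integrable_finsetSum _ fun j _ => hIj j).const_mul _) (hIF.const_mul _)]
  refine integral_congr_ae (Eventually.of_forall fun x => ?_)
  simp only
  rw [hdt, ← Finset.mul_sum]
  simp_rw [dj_flux (h₁.slice s) (h₂.slice s)]
  rw [Finset.sum_sub_distrib, ← Finset.sum_mul, ← Finset.mul_sum, ← map_sum]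
  have e1 : ∑ j, dj j (dj j (q₁ s)) x = lap (q₁ s) x := rfl
  have e2 : ∑ j, dj j (dj j (q₂ s)) x = lap (q₂ s) x := rfl
  rw [e1, e2]
  unfold FF
  simp only [map_add, map_mul, Complex.conj_I, Complex.conj_ofReal]
  have hI : Complex.I * Complex.I = -1 := Complex.I_mul_I
  linear_combination ((ψ x * dt q₁ s x * conj (q₂ s x)) + ψ x * q₁ s x * conj (dt q₂ s x)) * hI

/-- smooth cutoff -/
def chi0 (n : ℕ) : ContDiffBump (0 : Rn n) := ⟨1, 2, one_pos, one_lt_two⟩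

/-- rescaled smooth cutoff -/
def chi (n : ℕ) (R : ℝ) (x : Rn n) : ℂ := ((chi0 n (R⁻¹ • x) : ℝ) : ℂ)

lemma chi_contDiff (R : ℝ) (k : ℕ∞) : ContDiff ℝ k (chi n R) :=
  Complex.ofRealCLM.contDiff.comp ((chi0 n).contDiff.comp (contDiff_id.const_smul R⁻¹))

lemma chi_norm_le (R : ℝ) (x : Rn n) : ‖chi n R x‖ ≤ 1 := by
  unfold chi
  rw [Complex.norm_real, Real.norm_eq_abs, abs_of_nonneg (chi0 n).nonneg]
  exact (chi0 n).le_one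

lemma chi_eq_one {R : ℝ} (hR : 0 < R) {x : Rn n} (hx : ‖x‖ ≤ R) : chi n R x = 1 := by
  unfold chi
  rw [(chi0 n).one_of_mem_closedBall]; · simp
  rw [mem_closedBall_zero_iff, norm_smul, Real.norm_eq_abs, abs_of_pos (inv_pos.2 hR)]
  change _ ≤ (1 : ℝ)
  rw [inv_mul_le_iff₀ hR]; linarith

lemma chi_eq_zero {R : ℝ} (hR : 0 < R) {x : Rn n} (hx : 2 * R ≤ ‖x‖) : chi n R x = 0 := by
  unfold chi
  rw [(chi0 n).zero_of_le_dist]; · simp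
  rw [dist_zero_right, norm_smul, Real.norm_eq_abs, abs_of_pos (inv_pos.2 hR)]
  change (2 : ℝ) ≤ _
  rw [le_inv_mul_iff₀ hR]; linarith

lemma chi_compact {R : ℝ} (hR : 0 < R) : HasCompactSupport (chi n R) := by
  refine HasCompactSupport.intro (isCompact_closedBall (0 : Rn n) (2 * R)) fun x hx => ?_
  rw [mem_closedBall_zero_iff, not_le] at hx
  exact chi_eq_zero hR hx.le

lemma exists_chi_deriv (n : ℕ) : ∃ C, 0 ≤ C ∧ ∀ R : ℝ, 0 < R → ∀ (x : Rn n) (j : Fin n),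
    ‖dj j (chi n R) x‖ ≤ C / R ∧ ‖x‖ * ‖dj j (chi n R) x‖ ≤ C := by
  have hs : ContDiff ℝ 1 (chi n 1) := chi_contDiff 1 1
  have hcont : Continuous (fderiv ℝ (chi n 1)) := hs.continuous_fderiv (by norm_num)
  obtain ⟨C, hC⟩ := ((chi_compact (n := n) one_pos).fderiv (𝕜 := ℝ)).exists_bound_of_continuous hcont
  have hC0 : 0 ≤ C := (norm_nonneg _).trans (hC 0)
  have hmain : ∀ R : ℝ, 0 < R → ∀ (x : Rn n) (j : Fin n), ‖dj j (chi n R) x‖ ≤ C / R := by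
    intro R hR x j
    have e : chi n R = fun x => chi n 1 (R⁻¹ • x) := by
      ext y; simp [chi]
    unfold dj
    have h1 : HasFDerivAt (fun x : Rn n => R⁻¹ • x) (R⁻¹ • ContinuousLinearMap.id ℝ (Rn n)) x :=
      (hasFDerivAt_id x).const_smul R⁻¹
    have h2 : HasFDerivAt (chi n R) ((fderiv ℝ (chi n 1) (R⁻¹ • x)).comp
        (R⁻¹ • ContinuousLinearMap.id ℝ (Rn n))) x := by
      rw [e]
      exact HasFDerivAt.comp x (hs.differentiable (by norm_num) (R⁻¹ • x)).hasFDerivAt h1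
    rw [h2.fderiv]
    simp only [ContinuousLinearMap.comp_apply, ContinuousLinearMap.smul_apply,
      ContinuousLinearMap.id_apply, map_smul, norm_smul, Real.norm_eq_abs, abs_of_pos (inv_pos.2 hR)]
    rw [div_eq_inv_mul]
    gcongr
    refine (ContinuousLinearMap.le_opNorm (fderiv ℝ (chi n 1) (R⁻¹ • x)) _).trans ?_
    rw [EuclideanSpace.norm_single]
    simpa using hC _
  refine ⟨2 * C, by positivity, fun R hR x j => ⟨(hmain R hR x j).trans (by gcongr; linarith), ?_⟩⟩
  by_cases hx : ‖x‖ ≤ 2 * R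
  · calc ‖x‖ * ‖dj j (chi n R) x‖ ≤ (2 * R) * (C / R) := by
          gcongr; exact hmain R hR x j
      _ = 2 * C := by field_simp
  · push Not at hx
    have h0 : dj j (chi n R) x = 0 := by
      have : chi n R =ᶠ[𝓝 x] fun _ => 0 := by
        filter_upwards [(continuous_norm.isOpen_preimage _ isOpen_Ioi).mem_nhds
          (show x ∈ norm ⁻¹' Set.Ioi (2 * R) from hx)] with y hy
        exact chi_eq_zero hR (le_of_lt hy)
      unfold dj
      rw [this.fderiv_eq]; simp
    rw [h0]; simp; exact hC0

end


/-- the L² pairing -/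
def pr {n : ℕ} (p q : Rn n → ℂ) : ℂ := ∫ x, p x * conj (q x)

section
variable {n : ℕ}

lemma flux_bound {p q : Rn n → ℂ} (hp : IsH1 p) (hq : IsH1 q) {ψ : Rn n → ℂ} {K : ℝ} (hK : 0 ≤ K)
    (hψ : ∀ x, ‖ψ x‖ ≤ K) (j : Fin n) :
    ‖∫ x, ψ x * flux p q j x‖ ≤ K * (2 * (H1n p * H1n q)) := by
  have h1 := l2_cs (hp.dmem j) hq.mem
  have h2 := l2_cs hp.mem (hq.dmem j)
  refine (norm_integral_le_of_norm_le ((h1.1.add h2.1).const_mul K)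
    (Eventually.of_forall fun x => ?_)).trans ?_
  · unfold flux
    rw [norm_mul]
    refine mul_le_mul (hψ x) ?_ (norm_nonneg _) hK
    refine (norm_sub_le _ _).trans ?_
    simp [norm_mul]
  · rw [integral_const_mul]
    refine mul_le_mul_of_nonneg_left ?_ hK
    simp only [Pi.add_apply]
    rw [integral_add h1.1 h2.1]
    have e1 : nrm (dj j p) * nrm q ≤ H1n p * H1n q :=
      mul_le_mul (nrm_dj_le_H1n _ _) (nrm_le_H1n _) (nrm_nonneg _) (H1n_nonneg _)
    have e2 : nrm p * nrm (dj j q) ≤ H1n p * H1n q :=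
      mul_le_mul (nrm_le_H1n _) (nrm_dj_le_H1n _ _) (nrm_nonneg _) (H1n_nonneg _)
    linarith [h1.2, h2.2]

lemma pr_integrable {p q : Rn n → ℂ} (hp : MemLp p 2 volume) (hq : MemLp q 2 volume) :
    Integrable (fun x => p x * conj (q x)) := by
  refine (l2_cs hp hq).1.mono' (hp.1.mul (Complex.continuous_conj.comp_aestronglyMeasurable hq.1))
    (Eventually.of_forall fun x => ?_)
  simp [norm_mul]

lemma pr_le {p q : Rn n → ℂ} (hp : MemLp p 2 volume) (hq : MemLp q 2 volume) :
    ‖pr p q‖ ≤ nrm p * nrm q := by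
  refine (norm_integral_le_of_norm_le (l2_cs hp hq).1 (Eventually.of_forall fun x => ?_)).trans
    (l2_cs hp hq).2
  simp [norm_mul]

lemma pr_self {p : Rn n → ℂ} (hp : MemLp p 2 volume) : pr p p = ((nrm p ^ 2 : ℝ) : ℂ) := by
  rw [nrm_sq hp, ← integral_complex_ofReal]
  unfold pr
  congr 1; ext x
  rw [Complex.mul_conj, Complex.normSq_eq_norm_sq]

lemma chi_tendsto (x : Rn n) : ∀ᶠ k : ℕ in atTop, chi n ((k : ℝ) + 1) x = 1 := by
  filter_upwards [eventually_ge_atTop ⌈‖x‖⌉₊] with k hk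
  refine chi_eq_one (by positivity) ?_
  have := Nat.ceil_le.1 hk
  linarith

lemma chi_pr_tendsto {g : Rn n → ℂ} (hg : Integrable g) :
    Tendsto (fun k : ℕ => ∫ x, chi n ((k : ℝ) + 1) x * g x) atTop (𝓝 (∫ x, g x)) := by
  refine tendsto_integral_of_dominated_convergence (fun x => ‖g x‖) (fun k => ?_) hg.norm
    (fun k => Eventually.of_forall fun x => ?_) (Eventually.of_forall fun x => ?_)
  · exact (chi_contDiff _ 0).continuous.aestronglyMeasurable.mul hg.1
  · rw [norm_mul]
    exact mul_le_of_le_one_left (norm_nonneg _) (chi_norm_le _ _)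
  · refine tendsto_const_nhds.congr' ?_
    filter_upwards [chi_tendsto x] with k hk
    rw [hk, one_mul]

/-- the pairing lemma -/
lemma pairing {q₁ q₂ : ℝ → Rn n → ℂ} (h₁ : JC 2 q₁) (h₂ : JC 2 q₂) {ε a b M B : ℝ} (hab : a ≤ b)
    (H₁ : ∀ s ∈ Set.Icc a b, IsH1 (q₁ s) ∧ H1n (q₁ s) ≤ M)
    (H₂ : ∀ s ∈ Set.Icc a b, IsH1 (q₂ s) ∧ H1n (q₂ s) ≤ M)
    {z z' : ℝ → ℂ} (hz : ∀ s ∈ Set.Icc a b, HasDerivAt z (z' s) s)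
    {κ : ℝ → ℝ} (hκ : Tendsto κ atTop (𝓝 0))
    (hB : ∀ s ∈ Set.Icc a b, ∀ R : ℝ, 1 ≤ R →
      ‖(∫ x, chi n R x * (FF ε q₁ s x * conj (q₂ s x) - q₁ s x * conj (FF ε q₂ s x))) - z' s‖
        ≤ B + κ R) :
    ‖pr (q₁ b) (q₂ b) - pr (q₁ a) (q₂ a) + Complex.I * (z b - z a)‖ ≤ B * (b - a) := by
  have ha : a ∈ Set.Icc a b := ⟨le_rfl, hab⟩
  have hb : b ∈ Set.Icc a b := ⟨hab, le_rfl⟩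
  have hM : 0 ≤ M := (H1n_nonneg _).trans (H₁ a ha).2
  obtain ⟨C, hC, hchi⟩ := exists_chi_deriv n
  set r : ℕ → ℝ := fun k => (k : ℝ) + 1 with hr
  have hr1 : ∀ k, 1 ≤ r k := fun k => by simp [hr]
  have hrt : Tendsto r atTop atTop := tendsto_natCast_atTop_atTop.atTop_add tendsto_const_nhds
  set D : ℝ := |ε / 2| * (n * (C * (2 * (M * M)))) with hD
  have hkey : ∀ k : ℕ, ‖(∫ x, chi n (r k) x * (q₁ b x * conj (q₂ b x)))
      - (∫ x, chi n (r k) x * (q₁ a x * conj (q₂ a x))) + Complex.I * (z b - z a)‖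
      ≤ (D / r k + (B + κ (r k))) * (b - a) := by
    intro k
    have hpos : 0 < r k := by linarith [hr1 k]
    have hder : ∀ s ∈ Set.Icc a b, HasDerivWithinAt
        (fun s => (∫ x, chi n (r k) x * (q₁ s x * conj (q₂ s x))) + Complex.I * z s)
        (-(Complex.I * ((ε / 2 : ℝ) : ℂ)) * (∑ j, ∫ x, dj j (chi n (r k)) x * flux (q₁ s) (q₂ s) j x)
        - Complex.I * (∫ x, chi n (r k) x * (FF ε q₁ s x * conj (q₂ s x) - q₁ s x * conj (FF ε q₂ s x)))
        + Complex.I * z' s) (Set.Icc a b) s := fun s hs =>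
      ((lemmaD h₁ h₂ (chi_contDiff _ 1) (chi_compact hpos) ε s).add
        ((hz s hs).const_mul Complex.I)).hasDerivWithinAt
    have hmv := norm_image_sub_le_of_norm_deriv_le_segment' hder (C := D / r k + (B + κ (r k)))
      (fun s hs' => by
        have hs : s ∈ Set.Icc a b := ⟨hs'.1, hs'.2.le⟩
        have h3 : ‖∑ j, ∫ x, dj j (chi n (r k)) x * flux (q₁ s) (q₂ s) j x‖
            ≤ n * (C / r k * (2 * (M * M))) := by
          refine (norm_sum_le _ _).trans ?_
          refine (Finset.sum_le_card_nsmul _ _ (C / r k * (2 * (M * M))) fun j _ => ?_).trans ?_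
          · refine (flux_bound (H₁ s hs).1 (H₂ s hs).1 (by positivity)
              (fun x => (hchi (r k) hpos x j).1) j).trans ?_
            have := (H₁ s hs).2
            have := (H₂ s hs).2
            have := H1n_nonneg (q₁ s)
            have := H1n_nonneg (q₂ s)
            gcongr
          · simp
        have e : ∀ (A S I₀ w : ℂ), -(Complex.I * A) * S - Complex.I * I₀ + Complex.I * w
            = -(Complex.I * A) * S - Complex.I * (I₀ - w) := fun _ _ _ _ => by ring
        rw [e]
        refine (norm_sub_le _ _).trans (add_le_add ?_ ?_)
        · rw [norm_mul, norm_neg, norm_mul, Complex.norm_I, one_mul, Complex.norm_real, Real.norm_eq_abs]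
          calc |ε / 2| * _ ≤ |ε / 2| * (n * (C / r k * (2 * (M * M)))) := by gcongr
            _ = D / r k := by rw [hD]; ring
        · rw [norm_mul, Complex.norm_I, one_mul]
          exact hB s hs (r k) (hr1 k)) b hb
    refine le_trans (le_of_eq ?_) hmv
    congr 1
    ring
  have hIntg : ∀ s ∈ Set.Icc a b, Tendsto (fun k : ℕ => ∫ x, chi n (r k) x * (q₁ s x * conj (q₂ s x)))
      atTop (𝓝 (pr (q₁ s) (q₂ s))) := fun s hs =>
    chi_pr_tendsto (pr_integrable (H₁ s hs).1.mem (H₂ s hs).1.mem)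
  have hl := (((hIntg b hb).sub (hIntg a ha)).add_const (Complex.I * (z b - z a))).norm
  have hR : Tendsto (fun k => (D / r k + (B + κ (r k))) * (b - a)) atTop (𝓝 ((0 + (B + 0)) * (b - a))) :=
    (((tendsto_const_nhds.div_atTop hrt)).add (tendsto_const_nhds.add (hκ.comp hrt))).mul_const _
  have := le_of_tendsto_of_tendsto' hl hR hkey
  simpa using this

/-- the energy estimate for squares -/
lemma mass_est {q F' : ℝ → Rn n → ℂ} {V : ℝ → Rn n → ℝ} (h : JC 2 q) {ε a b M A : ℝ} (hab : a ≤ b)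
    (H : ∀ s ∈ Set.Icc a b, IsH1 (q s) ∧ H1n (q s) ≤ M)
    (hF : ∀ s ∈ Set.Icc a b, ∀ x, FF ε q s x = (V s x : ℂ) * q s x + F' s x)
    (hF' : ∀ s ∈ Set.Icc a b, MemLp (F' s) 2 volume)
    (hA : ∀ s ∈ Set.Icc a b, nrm (F' s) * nrm (q s) ≤ A) :
    |nrm (q b) ^ 2 - nrm (q a) ^ 2| ≤ 2 * A * (b - a) := by
  have := pairing (z := fun _ => 0) (z' := fun _ => 0) (κ := fun _ => 0) (B := 2 * A) h h hab H H
    (fun s _ => hasDerivAt_const s _) tendsto_const_nhds (fun s hs R _ => by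
      rw [sub_zero, add_zero]
      have h1 := l2_cs (hF' s hs) (H s hs).1.mem
      refine (norm_integral_le_of_norm_le (h1.1.const_mul 2) (Eventually.of_forall fun x => ?_)).trans ?_
      · rw [hF s hs x, norm_mul]
        refine (mul_le_of_le_one_left (norm_nonneg _) (chi_norm_le _ _)).trans ?_
        have e : ((V s x : ℂ) * q s x + F' s x) * conj (q s x)
            - q s x * conj ((V s x : ℂ) * q s x + F' s x)
            = F' s x * conj (q s x) - q s x * conj (F' s x) := by
          simp only [map_add, map_mul, Complex.conj_ofReal]; ring
        rw [e]
        refine (norm_sub_le _ _).trans (le_of_eq ?_)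
        simp only [norm_mul, RCLike.norm_conj]; ring
      · rw [integral_const_mul]
        linarith [hA s hs, h1.2])
  rw [pr_self (H b ⟨hab, le_rfl⟩).1.mem, pr_self (H a ⟨le_rfl, hab⟩).1.mem] at this
  simp only [sub_zero, mul_zero, add_zero] at this
  rwa [← Complex.ofReal_sub, Complex.norm_real, Real.norm_eq_abs] at this

end

section
variable {n : ℕ}

lemma kernel2_meas (γ : ℝ) : Measurable fun p : Rn n × Rn n => ‖p.1 - p.2‖ ^ (-γ) :=
  ((measurable_fst.sub measurable_snd).norm).pow_const _

lemma hartree_meas (γ : ℝ) {p : Rn n → ℂ} (hp : Continuous p) :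
    StronglyMeasurable (hartree γ p) := by
  unfold hartree conv
  refine StronglyMeasurable.integral_prod_right (f := fun x y => ‖x - y‖ ^ (-γ) * Complex.normSq (p y)) ?_
  refine Measurable.stronglyMeasurable ?_
  exact (kernel2_meas γ).mul
    ((Complex.continuous_normSq.comp hp).measurable.comp measurable_snd)

lemma HardyC.hartree_abs_le {γ C : ℝ} (H : HardyC n γ C) {g : Rn n → ℂ} (hg : IsH1 g) {M : ℝ}
    (hM : H1n g ≤ M) (x : Rn n) : |hartree γ g x| ≤ C * M ^ 2 := by
  rw [abs_of_nonneg (hartree_nonneg γ g x)]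
  refine (H.hartree_le hg x).trans ?_
  have h0 := nrm_nonneg g
  have h1 := nrm_le_H1n g
  have := H.1
  have h2 : nrm g * H1n g ≤ M ^ 2 := by
    rw [sq]; exact mul_le_mul (h1.trans hM) hM (H1n_nonneg _) ((H1n_nonneg _).trans hM)
  gcongr

lemma normSq_int {g : Rn n → ℂ} (hg : MemLp g 2 volume) : Integrable fun x => Complex.normSq (g x) := by
  simp_rw [Complex.normSq_eq_norm_sq]; exact memLp_sq_integrable hg

/-- the potential energy pairing -/
def PP {n : ℕ} (γ : ℝ) (p q : Rn n → ℂ) : ℝ := ∫ x, hartree γ p x * Complex.normSq (q x)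

lemma HardyC.PP_int {γ C : ℝ} (H : HardyC n γ C) {p q : Rn n → ℂ} (hp : IsH1 p)
    (hq : MemLp q 2 volume) : Integrable fun x => hartree γ p x * Complex.normSq (q x) :=
  (normSq_int hq).bdd_mul (c := C * H1n p ^ 2) (hartree_meas γ hp.diff.continuous).aestronglyMeasurable
    (Eventually.of_forall fun x => H.hartree_abs_le hp le_rfl x)

lemma HardyC.PP_symm {γ C : ℝ} (H : HardyC n γ C) {p q : Rn n → ℂ} (hp : IsH1 p) (hq : IsH1 q) :
    PP γ p q = PP γ q p := by
  unfold PP hartree conv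
  simp_rw [← integral_mul_const]
  have hmeas : ∀ {p q : Rn n → ℂ}, IsH1 p → IsH1 q → AEStronglyMeasurable (fun z : Rn n × Rn n =>
      ‖z.1 - z.2‖ ^ (-γ) * Complex.normSq (p z.2) * Complex.normSq (q z.1)) (volume.prod volume) :=
    fun {p q} hp hq => by
      refine Measurable.aestronglyMeasurable ?_
      exact ((kernel2_meas γ).mul ((Complex.continuous_normSq.comp hp.diff.continuous).measurable.comp
        measurable_snd)).mul ((Complex.continuous_normSq.comp hq.diff.continuous).measurable.comp
        measurable_fst)
  have hIntg : Integrable (Function.uncurry fun x y : Rn n => ‖x - y‖ ^ (-γ) * Complex.normSq (p y)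
      * Complex.normSq (q x)) (volume.prod volume) := by
    refine (integrable_prod_iff (hmeas hp hq)).2 ⟨Eventually.of_forall fun x => ?_, ?_⟩
    · exact (H.hartree_int hp x).mul_const (Complex.normSq (q x))
    · have e : (fun x : Rn n => ∫ y, ‖‖x - y‖ ^ (-γ) * Complex.normSq (p y) * Complex.normSq (q x)‖)
          = fun x => hartree γ p x * Complex.normSq (q x) := by
        ext x
        unfold hartree conv
        rw [← integral_mul_const]
        congr 1; ext y
        rw [Real.norm_eq_abs, abs_of_nonneg]
        exact mul_nonneg (mul_nonneg (by positivity) (Complex.normSq_nonneg _)) (Complex.normSq_nonneg _)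
      simp only
      rw [e]
      exact H.PP_int hp hq.mem
  rw [integral_integral_swap hIntg]
  congr 1; ext x; congr 1; ext y
  rw [norm_sub_rev]; ring

lemma PP_nonneg (γ : ℝ) (p q : Rn n → ℂ) : 0 ≤ PP γ p q :=
  integral_nonneg fun x => mul_nonneg (hartree_nonneg _ _ _) (Complex.normSq_nonneg _)

/-- multiplication by |x| -/
def xw {n : ℕ} (h : Rn n → ℂ) (x : Rn n) : ℂ := ((‖x‖ : ℝ) : ℂ) * h x

lemma schwartz_xw (φ : SchwartzMap (Rn n) ℂ) : MemLp (xw ⇑φ) 2 volume := by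
  have h : ∀ j : Fin n, MemLp (fun x : Rn n => ‖((x j : ℝ) : ℂ) * φ x‖) 2 volume := fun j => by
    have hg : Function.HasTemperateGrowth (fun x : Rn n => ((x j : ℝ) : ℂ)) :=
      (Complex.ofRealCLM.comp (EuclideanSpace.proj (𝕜 := ℝ) j : Rn n →L[ℝ] ℝ)).hasTemperateGrowth
    have := (SchwartzMap.smulLeftCLM ℂ (fun x : Rn n => ((x j : ℝ) : ℂ)) φ).memLp 2 volume
    rw [show ⇑(SchwartzMap.smulLeftCLM ℂ (fun x : Rn n => ((x j : ℝ) : ℂ)) φ)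
      = fun x => ((x j : ℝ) : ℂ) * φ x from by
        ext x; rw [SchwartzMap.smulLeftCLM_apply_apply hg]; rfl] at this
    exact this.norm
  have hs : MemLp (fun x => ∑ j : Fin n, ‖((x j : ℝ) : ℂ) * φ x‖) 2 volume :=
    memLp_finsetSum _ fun j _ => h j
  refine hs.of_le ?_ (Eventually.of_forall fun x => ?_)
  · exact ((Complex.continuous_ofReal.comp continuous_norm).mul φ.continuous).aestronglyMeasurable
  · unfold xw
    rw [norm_mul, Complex.norm_real, norm_norm, Real.norm_eq_abs, abs_of_nonneg (Finset.sum_nonneg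
      fun _ _ => norm_nonneg _)]
    simp_rw [norm_mul, Complex.norm_real]
    rw [← Finset.sum_mul]
    gcongr
    have := EuclideanSpace.norm_eq x
    rw [this]
    refine Real.sqrt_le_iff.2 ⟨Finset.sum_nonneg fun _ _ => norm_nonneg _, ?_⟩
    exact Finset.sum_sq_le_sq_sum_of_nonneg fun _ _ => norm_nonneg _

lemma chi_tail {R : ℝ} (hR : 0 < R) (x : Rn n) : ‖1 - chi n R x‖ ≤ ‖x‖ / R := by
  by_cases h : ‖x‖ ≤ R
  · rw [chi_eq_one hR h]; simp; positivity
  · push Not at h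
    have h1 : ‖1 - chi n R x‖ ≤ 1 := by
      unfold chi
      rw [← Complex.ofReal_one, ← Complex.ofReal_sub, Complex.norm_real, Real.norm_eq_abs, abs_le]
      have h2 := (chi0 n).nonneg (x := R⁻¹ • x)
      have h3 := (chi0 n).le_one (x := R⁻¹ • x)
      constructor <;> linarith
    refine h1.trans ?_
    rw [le_div_iff₀ hR]; linarith

lemma chi_tail_int {R : ℝ} (hR : 0 < R) {p q g : Rn n → ℂ} {K : ℝ} (hK : 0 ≤ K) (hp : MemLp (xw p) 2 volume)
    (hq : MemLp q 2 volume) (hg : Integrable g)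
    (hle : ∀ x, ‖g x‖ ≤ K * (‖p x‖ * ‖q x‖)) :
    ‖(∫ x, chi n R x * g x) - ∫ x, g x‖ ≤ K * (nrm (xw p) * nrm q) / R := by
  have hc : Integrable fun x => chi n R x * g x :=
    hg.bdd_mul (c := 1) (chi_contDiff R 0).continuous.aestronglyMeasurable
      (Eventually.of_forall fun x => chi_norm_le _ _)
  rw [← integral_sub hc hg]
  have h1 := l2_cs hp hq
  refine (norm_integral_le_of_norm_le (h1.1.const_mul (K / R)) (Eventually.of_forall fun x => ?_)).trans ?_
  · have e : chi n R x * g x - g x = -((1 - chi n R x) * g x) := by ring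
    rw [e, norm_neg, norm_mul]
    calc ‖1 - chi n R x‖ * ‖g x‖ ≤ (‖x‖ / R) * (K * (‖p x‖ * ‖q x‖)) := by
          gcongr
          · exact chi_tail hR x
          · exact hle x
      _ = _ := by simp [xw]; ring
  · rw [integral_const_mul]
    calc K / R * _ ≤ K / R * (nrm (xw p) * nrm q) := by gcongr; exact h1.2
      _ = _ := by ring

end


/-- solutions of the Hartree equation with harmonic potential, after division by ε -/
structure Sol {n : ℕ} (γ ε : ℝ) (u : ℝ → Rn n → ℂ) : Prop where
  jc : JC 2 u
  sch : ∀ s, ∃ φ : SchwartzMap (Rn n) ℂ, u s = ⇑φ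
  eq : ∀ s x, FF ε u s x = ((‖x‖ ^ 2 / (2 * ε) + hartree γ (u s) x : ℝ) : ℂ) * u s x

/-- the energy-space norm -/
def Nn {n : ℕ} (p : Rn n → ℂ) : ℝ := H1n p + nrm (xw p)

section
variable {n : ℕ}

lemma Nn_nonneg (p : Rn n → ℂ) : 0 ≤ Nn p := add_nonneg (H1n_nonneg _) (nrm_nonneg _)
lemma H1n_le_Nn (p : Rn n → ℂ) : H1n p ≤ Nn p := le_add_of_nonneg_right (nrm_nonneg _)
lemma nrm_xw_le_Nn (p : Rn n → ℂ) : nrm (xw p) ≤ Nn p := le_add_of_nonneg_left (H1n_nonneg _)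
lemma nrm_le_Nn (p : Rn n → ℂ) : nrm p ≤ Nn p := (nrm_le_H1n p).trans (H1n_le_Nn p)

lemma Sol.h1 {γ ε : ℝ} {u : ℝ → Rn n → ℂ} (S : Sol γ ε u) (s : ℝ) : IsH1 (u s) := by
  obtain ⟨φ, h⟩ := S.sch s
  rw [h]; exact schwartz_H1 φ

lemma Sol.xm {γ ε : ℝ} {u : ℝ → Rn n → ℂ} (S : Sol γ ε u) (s : ℝ) : MemLp (xw (u s)) 2 volume := by
  obtain ⟨φ, h⟩ := S.sch s
  rw [h]; exact schwartz_xw φ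

/-- conservation of mass under a priori bounds -/
lemma Sol.mass {γ ε : ℝ} {u : ℝ → Rn n → ℂ} (S : Sol γ ε u) {a b M : ℝ} (hab : a ≤ b)
    (hM : ∀ s ∈ Set.Icc a b, Nn (u s) ≤ M) : nrm (u a) = nrm (u b) := by
  have h := mass_est (F' := fun _ _ => 0) (A := 0) S.jc hab
    (fun s hs => ⟨S.h1 s, (H1n_le_Nn _).trans (hM s hs)⟩)
    (fun s _ x => by rw [add_zero]; exact S.eq s x) (fun s _ => MemLp.zero')
    (fun s _ => by
      have : nrm (fun _ : Rn n => (0 : ℂ)) = 0 := by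
        have := nrm_const_mul (0 : ℂ) (fun _ : Rn n => (0 : ℂ))
        simpa using this
      rw [this, zero_mul])
  have h2 : nrm (u b) ^ 2 - nrm (u a) ^ 2 = 0 := abs_nonpos_iff.1 (by linarith)
  exact (pow_left_inj₀ (nrm_nonneg _) (nrm_nonneg _) two_ne_zero).1 (by linarith)

/-- one integration by parts with cutoff -/
lemma chi_lap_bound : ∃ C, 0 ≤ C ∧ ∀ (p : Rn n → ℂ) (φ : SchwartzMap (Rn n) ℂ), IsH1 p → ∀ R : ℝ, 1 ≤ R →
    ‖∫ x, chi n R x * (p x * conj (lap (⇑φ) x))‖ ≤ C * (H1n p * H1n (⇑φ)) := by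
  obtain ⟨C, hC, hchi⟩ := exists_chi_deriv n
  refine ⟨n * (1 + C), by positivity, fun p φ hp R hR => ?_⟩
  have hR0 : 0 < R := by linarith
  have key : ∀ j : Fin n, Integrable (fun x => chi n R x * (p x * conj (dj j (dj j (⇑φ)) x))) ∧
      ‖∫ x, chi n R x * (p x * conj (dj j (dj j (⇑φ)) x))‖ ≤ (1 + C) * (H1n p * H1n (⇑φ)) := fun j => by
    have hd2 : MemLp (dj j (dj j (⇑φ))) 2 volume := by
      rw [← sdj_coe, ← sdj_coe]; exact schwartz_memLp _
    have hd1 : MemLp (dj j (⇑φ)) 2 volume := by rw [← sdj_coe]; exact schwartz_memLp _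
    have hdd : Differentiable ℝ (dj j (⇑φ)) := by rw [← sdj_coe]; exact (sdj j φ).differentiable
    have hc1 : ContDiff ℝ 1 (chi n R) := chi_contDiff R 1
    constructor
    · refine (pr_integrable hp.mem hd2).bdd_mul (c := 1) (hc1.continuous.aestronglyMeasurable)
        (Eventually.of_forall fun x => chi_norm_le R x)
    · have hg : ContDiff ℝ 1 (fun x => conj (dj j (⇑φ) x)) := by
        rw [← sdj_coe]; exact conj_contDiff ((sdj j φ).smooth 1)
      have := ibp (ψ := fun x => chi n R x * p x) (hc1.mul hp.diff) ((chi_compact hR0).mul_right) hg j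
      rw [dj_conj hdd] at this
      have e : ∀ x, chi n R x * (p x * conj (dj j (dj j (⇑φ)) x))
        = chi n R x * p x * conj (dj j (dj j (⇑φ)) x) := fun x => by ring
      simp_rw [e]
      rw [this, norm_neg]
      rw [dj_mul (hc1.differentiable one_ne_zero) hp.differentiable]
      have h1 := l2_cs (hp.dmem j) hd1
      have h2 := l2_cs hp.mem hd1
      refine (norm_integral_le_of_norm_le (h1.1.add (h2.1.const_mul C))
        (Eventually.of_forall fun x => ?_)).trans ?_
      · simp only [Pi.add_apply]
        rw [norm_mul, RCLike.norm_conj]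
        have b1 : ‖chi n R x * dj j p x + p x * dj j (chi n R) x‖ ≤ ‖dj j p x‖ + C * ‖p x‖ := by
          refine (norm_add_le _ _).trans ?_
          rw [norm_mul, norm_mul]
          have := (hchi R hR0 x j).1
          have h3 : C / R ≤ C := div_le_self hC hR
          have := chi_norm_le R x
          nlinarith [norm_nonneg (p x), norm_nonneg (dj j p x)]
        calc _ ≤ (‖dj j p x‖ + C * ‖p x‖) * ‖dj j (⇑φ) x‖ := by gcongr
          _ = _ := by ring
      · simp only [Pi.add_apply]
        rw [integral_add h1.1 (h2.1.const_mul C), integral_const_mul]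
        have e1 : nrm (dj j p) * nrm (dj j (⇑φ)) ≤ H1n p * H1n (⇑φ) :=
          mul_le_mul (nrm_dj_le_H1n _ _) (nrm_dj_le_H1n _ _) (nrm_nonneg _) (H1n_nonneg _)
        have e2 : nrm p * nrm (dj j (⇑φ)) ≤ H1n p * H1n (⇑φ) :=
          mul_le_mul (nrm_le_H1n _) (nrm_dj_le_H1n _ _) (nrm_nonneg _) (H1n_nonneg _)
        nlinarith [h1.2, h2.2]
  have e : ∀ x, chi n R x * (p x * conj (lap (⇑φ) x))
      = ∑ j, chi n R x * (p x * conj (dj j (dj j (⇑φ)) x)) := fun x => by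
    rw [lap_eq, map_sum, Finset.mul_sum, Finset.mul_sum]
  simp_rw [e]
  rw [integral_finsetSum _ fun j _ => (key j).1]
  refine (norm_sum_le _ _).trans ((Finset.sum_le_sum fun j _ => (key j).2).trans (le_of_eq ?_))
  rw [Finset.sum_const, Finset.card_univ, Fintype.card_fin, nsmul_eq_mul, mul_assoc]

lemma lap_schwartz (φ : SchwartzMap (Rn n) ℂ) : MemLp (lap (⇑φ)) 2 volume ∧ Continuous (lap (⇑φ)) := by
  have : ∀ j : Fin n, dj j (dj j (⇑φ)) = ⇑(sdj j (sdj j φ)) := fun j => by rw [sdj_coe, sdj_coe]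
  rw [lap_eq]; simp_rw [this]
  exact ⟨memLp_finsetSum _ fun j _ => schwartz_memLp _,
    continuous_finsetSum _ fun j _ => (sdj j (sdj j φ)).continuous⟩

lemma FF_const (ε : ℝ) (φ : Rn n → ℂ) (s : ℝ) (x : Rn n) :
    FF ε (fun _ => φ) s x = ((ε / 2 : ℝ) : ℂ) * lap φ x := by
  simp [FF, dt]

lemma JC_const {k : WithTop ℕ∞} {φ : Rn n → ℂ} (h : ContDiff ℝ k φ) : JC k (fun _ => φ) :=
  h.comp contDiff_snd

lemma nrm_sub_sq {p q : Rn n → ℂ} (hp : MemLp p 2 volume) (hq : MemLp q 2 volume) :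
    nrm (fun x => p x - q x) ^ 2 = nrm p ^ 2 + nrm q ^ 2 - 2 * (pr p q).re := by
  rw [show nrm (fun x => p x - q x) ^ 2 = ∫ x, ‖p x - q x‖ ^ 2 from nrm_sq (hp.sub hq), nrm_sq hp, nrm_sq hq, pr,
    show (∫ x, p x * conj (q x)).re = ∫ x, (p x * conj (q x)).re from
      (integral_re (pr_integrable hp hq)).symm,
    ← integral_const_mul, ← integral_add (memLp_sq_integrable hp) (memLp_sq_integrable hq)]
  refine Eq.trans ?_ (integral_sub ((memLp_sq_integrable hp).add (memLp_sq_integrable hq))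
      ((pr_integrable hp hq).re.const_mul 2))
  congr 1; ext x
  simp only [Complex.sq_norm, Complex.normSq_apply, Complex.mul_re, Complex.conj_re, Complex.conj_im,
    Complex.sub_re, Complex.sub_im, Pi.add_apply, RCLike.re_eq_complex_re]
  ring

/-- Hölder continuity in time -/
lemma Sol.holder {γ ε C : ℝ} (hε : 0 < ε) (H : HardyC n γ C) {u : ℝ → Rn n → ℂ} (S : Sol γ ε u)
    {a b M : ℝ} (hM : ∀ s ∈ Set.Icc a b, Nn (u s) ≤ M) : ∃ K, 0 ≤ K ∧
    ∀ s₁ ∈ Set.Icc a b, ∀ s₂ ∈ Set.Icc a b, s₁ ≤ s₂ →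
      nrm (fun x => u s₂ x - u s₁ x) ≤ K * √(s₂ - s₁) := by
  obtain ⟨D, hD, hlap⟩ := chi_lap_bound (n := n)
  have hC := H.1
  set B : ℝ := 1 / (2 * ε) * M ^ 2 + C * M ^ 2 * M ^ 2 + ε / 2 * (D * M ^ 2) with hB
  have hB0 : 0 ≤ B := by positivity
  refine ⟨√(2 * B), Real.sqrt_nonneg _, fun s₁ h₁ s₂ h₂ h12 => ?_⟩
  obtain ⟨φ, hφ⟩ := S.sch s₁
  have hsub : ∀ s ∈ Set.Icc s₁ s₂, s ∈ Set.Icc a b := fun s hs => ⟨h₁.1.trans hs.1, hs.2.trans h₂.2⟩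
  have hMφ : Nn (⇑φ) ≤ M := hφ ▸ hM s₁ h₁
  have hM0 : 0 ≤ M := (Nn_nonneg _).trans hMφ
  have hφc : ContDiff ℝ 2 (⇑φ) := φ.smooth 2
  have := pairing (ε := ε) (z := fun _ => 0) (z' := fun _ => 0) (κ := fun _ => 0) (B := B) S.jc
    (JC_const hφc) h12
    (fun s hs => ⟨S.h1 s, (H1n_le_Nn _).trans (hM s (hsub s hs))⟩)
    (fun s hs => ⟨schwartz_H1 φ, (H1n_le_Nn _).trans hMφ⟩)
    (fun s _ => hasDerivAt_const s _) tendsto_const_nhds (fun s hs R hR => by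
      rw [sub_zero, add_zero]
      have hMs := hM s (hsub s hs)
      have x1 := l2_cs (S.xm s) (schwartz_xw φ)
      have x2 := l2_cs (S.h1 s).mem (schwartz_memLp φ)
      have hR0 : 0 < R := by linarith
      have hchic : Continuous (chi n R) := (chi_contDiff R 1).continuous
      have hWm : AEStronglyMeasurable (fun x => ((‖x‖ ^ 2 / (2 * ε) + hartree γ (u s) x : ℝ) : ℂ))
          volume := by
        refine Complex.continuous_ofReal.comp_aestronglyMeasurable ?_
        exact ((continuous_norm.pow 2).div_const _).aestronglyMeasurable.add
          (hartree_meas γ (S.h1 s).diff.continuous).aestronglyMeasurable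
      have bnd : ∀ x, ‖chi n R x * (((‖x‖ ^ 2 / (2 * ε) + hartree γ (u s) x : ℝ) : ℂ) * u s x * conj (φ x))‖
          ≤ 1 / (2 * ε) * (‖xw (u s) x‖ * ‖xw (⇑φ) x‖) + C * M ^ 2 * (‖u s x‖ * ‖φ x‖) := fun x => by
        rw [norm_mul]
        refine (mul_le_of_le_one_left (norm_nonneg _) (chi_norm_le _ _)).trans ?_
        rw [norm_mul, norm_mul, RCLike.norm_conj, Complex.norm_real, Real.norm_eq_abs]
        have hw := H.hartree_abs_le (S.h1 s) ((H1n_le_Nn _).trans hMs) x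
        have : |‖x‖ ^ 2 / (2 * ε) + hartree γ (u s) x| ≤ ‖x‖ ^ 2 / (2 * ε) + C * M ^ 2 := by
          refine (abs_add_le _ _).trans ?_
          rw [abs_of_nonneg (by positivity : 0 ≤ ‖x‖ ^ 2 / (2 * ε))]
          linarith
        calc _ ≤ (‖x‖ ^ 2 / (2 * ε) + C * M ^ 2) * ‖u s x‖ * ‖φ x‖ := by gcongr
          _ = _ := by simp only [xw, norm_mul, Complex.norm_real, norm_norm]; ring
      have hi1 := (x1.1.const_mul (1 / (2 * ε))).add (x2.1.const_mul (C * M ^ 2))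
      have i1 : Integrable (fun x => chi n R x *
          (((‖x‖ ^ 2 / (2 * ε) + hartree γ (u s) x : ℝ) : ℂ) * u s x * conj (φ x))) := by
        refine hi1.mono' ?_ (Eventually.of_forall bnd)
        exact hchic.aestronglyMeasurable.mul ((hWm.mul (S.h1 s).mem.1).mul
          (Complex.continuous_conj.comp_aestronglyMeasurable (schwartz_memLp φ).1))
      have i2 : Integrable (fun x => ((ε / 2 : ℝ) : ℂ) * (chi n R x * (u s x * conj (lap (⇑φ) x)))) := by
        refine Integrable.const_mul ?_ _
        exact (pr_integrable (S.h1 s).mem (lap_schwartz φ).1).bdd_mul (c := 1)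
          hchic.aestronglyMeasurable (Eventually.of_forall fun x => chi_norm_le R x)
      have e : ∀ x, chi n R x * (FF ε u s x * conj (φ x) - u s x * conj (FF ε (fun _ => ⇑φ) s x))
          = chi n R x * (((‖x‖ ^ 2 / (2 * ε) + hartree γ (u s) x : ℝ) : ℂ) * u s x * conj (φ x))
          - ((ε / 2 : ℝ) : ℂ) * (chi n R x * (u s x * conj (lap (⇑φ) x))) := fun x => by
        rw [FF_const, S.eq, map_mul, Complex.conj_ofReal]; ring
      simp_rw [e]
      rw [integral_sub i1 i2, integral_const_mul]
      refine (norm_sub_le _ _).trans ?_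
      have t1 : ‖∫ x, chi n R x * (((‖x‖ ^ 2 / (2 * ε) + hartree γ (u s) x : ℝ) : ℂ) * u s x * conj (φ x))‖
          ≤ 1 / (2 * ε) * M ^ 2 + C * M ^ 2 * M ^ 2 := by
        refine (norm_integral_le_of_norm_le hi1 (Eventually.of_forall bnd)).trans ?_
        simp only [Pi.add_apply]
        rw [integral_add (x1.1.const_mul _) (x2.1.const_mul _), integral_const_mul, integral_const_mul]
        have y1 : nrm (xw (u s)) * nrm (xw (⇑φ)) ≤ M ^ 2 := by
          rw [sq]; exact mul_le_mul ((nrm_xw_le_Nn _).trans hMs) ((nrm_xw_le_Nn _).trans hMφ)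
            (nrm_nonneg _) hM0
        have y2 : nrm (u s) * nrm (⇑φ) ≤ M ^ 2 := by
          rw [sq]; exact mul_le_mul ((nrm_le_Nn _).trans hMs) ((nrm_le_Nn _).trans hMφ)
            (nrm_nonneg _) hM0
        have := x1.2.trans y1
        have := x2.2.trans y2
        gcongr
      have t2 : ‖((ε / 2 : ℝ) : ℂ) * ∫ x, chi n R x * (u s x * conj (lap (⇑φ) x))‖
          ≤ ε / 2 * (D * M ^ 2) := by
        rw [norm_mul, Complex.norm_real, Real.norm_eq_abs, abs_of_pos (by positivity)]
        have y3 : H1n (u s) * H1n (⇑φ) ≤ M ^ 2 := by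
          rw [sq]; exact mul_le_mul ((H1n_le_Nn _).trans hMs) ((H1n_le_Nn _).trans hMφ)
            (H1n_nonneg _) hM0
        have := hlap (u s) φ (S.h1 s) R hR
        gcongr
        exact this.trans (by gcongr)
      linarith)
  simp only [sub_zero, mul_zero, add_zero] at this
  have hms := S.mass h12 (fun s hs => hM s (hsub s hs))
  rw [← hφ] at this
  have h3 := nrm_sub_sq (S.h1 s₂).mem (S.h1 s₁).mem
  rw [pr_self (S.h1 s₁).mem] at this
  have h4 := Complex.abs_re_le_norm (pr (u s₂) (u s₁) - ((nrm (u s₁) ^ 2 : ℝ) : ℂ))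
  rw [Complex.sub_re, Complex.ofReal_re] at h4
  have h5 := neg_le_of_abs_le (h4.trans this)
  rw [← Real.sqrt_mul (by positivity)]
  refine Real.le_sqrt_of_sq_le ?_
  rw [h3, ← hms]
  linarith

end


/-- `V φ - (ε/2) Δ φ` -/
def gop {n : ℕ} (γ ε : ℝ) (φ : Rn n → ℂ) (x : Rn n) : ℂ :=
  ((‖x‖ ^ 2 / (2 * ε) + hartree γ φ x : ℝ) : ℂ) * φ x - ((ε / 2 : ℝ) : ℂ) * lap φ x

/-- the quadratic part of the energy -/
def TT {n : ℕ} (ε : ℝ) (φ : Rn n → ℂ) : ℝ :=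
  ε / 2 * ∑ j, nrm (dj j φ) ^ 2 + 1 / (2 * ε) * nrm (xw φ) ^ 2

section
variable {n : ℕ}

lemma iadd {f g : Rn n → ℂ} (hf : Integrable f) (hg : Integrable g) : Integrable fun x => f x + g x :=
  hf.add hg

lemma isub {f g : Rn n → ℂ} (hf : Integrable f) (hg : Integrable g) : Integrable fun x => f x - g x :=
  hf.sub hg

lemma schwartz_sq (φ : SchwartzMap (Rn n) ℂ) : MemLp (fun x : Rn n => ((‖x‖ ^ 2 : ℝ) : ℂ) * φ x) 2 volume := by
  have hg : Function.HasTemperateGrowth (fun x : Rn n => ((‖x‖ ^ 2 : ℝ) : ℂ)) :=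
    Function.HasTemperateGrowth.comp Function.Complex.hasTemperateGrowth_ofReal (Function.hasTemperateGrowth_norm_sq _)
  have := (SchwartzMap.smulLeftCLM ℂ (fun x : Rn n => ((‖x‖ ^ 2 : ℝ) : ℂ)) φ).memLp 2 volume
  rwa [show ⇑(SchwartzMap.smulLeftCLM ℂ (fun x : Rn n => ((‖x‖ ^ 2 : ℝ) : ℂ)) φ)
      = fun x => ((‖x‖ ^ 2 : ℝ) : ℂ) * φ x from by
        ext x; rw [SchwartzMap.smulLeftCLM_apply_apply hg]; rfl] at this

lemma HardyC.hartree_mul_mem {γ C : ℝ} (H : HardyC n γ C) {p q : Rn n → ℂ} (hp : IsH1 p)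
    (hq : MemLp q 2 volume) : MemLp (fun x => ((hartree γ p x : ℝ) : ℂ) * q x) 2 volume := by
  have hC := H.1
  refine (nrm_bdd_mul (C := C * H1n p ^ 2) (by positivity) hq ?_ fun x => ?_).1
  · exact (Complex.continuous_ofReal.comp_aestronglyMeasurable
      (hartree_meas γ hp.diff.continuous).aestronglyMeasurable).mul hq.1
  · rw [Complex.norm_real, Real.norm_eq_abs]
    exact H.hartree_abs_le hp le_rfl x

lemma HardyC.gop_mem {γ ε C : ℝ} (H : HardyC n γ C) (φ : SchwartzMap (Rn n) ℂ) :
    MemLp (gop γ ε (⇑φ)) 2 volume := by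
  have h1 := (schwartz_sq φ).const_mul ((1 / (2 * ε) : ℝ) : ℂ)
  have h2 := H.hartree_mul_mem (schwartz_H1 φ) (schwartz_memLp φ)
  have h3 := (lap_schwartz φ).1.const_mul ((ε / 2 : ℝ) : ℂ)
  refine ((h1.add h2).sub h3).ae_eq (Eventually.of_forall fun x => ?_)
  simp only [Pi.add_apply, Pi.sub_apply, gop]
  push_cast; ring

lemma pr_dj_dj (φ : SchwartzMap (Rn n) ℂ) (j : Fin n) :
    Integrable (fun x => φ x * conj (dj j (dj j (⇑φ)) x)) ∧
    ∫ x, φ x * conj (dj j (dj j (⇑φ)) x) = ((-nrm (dj j (⇑φ)) ^ 2 : ℝ) : ℂ) := by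
  have hd2 : MemLp (dj j (dj j (⇑φ))) 2 volume := by
    rw [← sdj_coe, ← sdj_coe]; exact schwartz_memLp _
  have hd1 : MemLp (dj j (⇑φ)) 2 volume := by rw [← sdj_coe]; exact schwartz_memLp _
  have hdd : Differentiable ℝ (dj j (⇑φ)) := by rw [← sdj_coe]; exact (sdj j φ).differentiable
  have hc : Differentiable ℝ (fun x => conj (dj j (⇑φ) x)) := by
    rw [← sdj_coe]; exact (conj_contDiff ((sdj j φ).smooth 1)).differentiable one_ne_zero
  refine ⟨pr_integrable (schwartz_memLp φ) hd2, ?_⟩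
  have h := integral_mul_fderiv_eq_neg_fderiv_mul_of_integrable (μ := (volume : Measure (Rn n)))
    (f := ⇑φ) (g := fun x => conj (dj j (⇑φ) x)) (v := EuclideanSpace.single j 1)
    (pr_integrable hd1 hd1) (by
      have := pr_integrable (schwartz_memLp φ) hd2
      have e := dj_conj (j := j) hdd
      refine this.congr (Eventually.of_forall fun x => ?_)
      simp only
      rw [← congrFun e x]; rfl) (pr_integrable (schwartz_memLp φ) hd1)
    (fun x _ => φ.differentiableAt) (fun x _ => hc x)
  have e : ∀ x, conj (dj j (dj j (⇑φ)) x) = fderiv ℝ (fun x => conj (dj j (⇑φ) x)) x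
      (EuclideanSpace.single j 1) := fun x => (congrFun (dj_conj (j := j) hdd) x).symm
  simp_rw [e]
  rw [h]
  have := pr_self hd1
  push_cast
  push_cast at this
  rw [← this]
  rfl

lemma HardyC.pr_gop {γ ε C : ℝ} (H : HardyC n γ C) (φ : SchwartzMap (Rn n) ℂ) :
    pr (⇑φ) (gop γ ε (⇑φ)) = ((TT ε (⇑φ) + PP γ (⇑φ) (⇑φ) : ℝ) : ℂ) := by
  have i1 : Integrable (fun x => ((1 / (2 * ε) * ‖xw (⇑φ) x‖ ^ 2 : ℝ) : ℂ)) :=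
    ((memLp_sq_integrable (schwartz_xw φ)).const_mul _).ofReal
  have i2 : Integrable (fun x => ((hartree γ (⇑φ) x * Complex.normSq (φ x) : ℝ) : ℂ)) :=
    (H.PP_int (schwartz_H1 φ) (schwartz_memLp φ)).ofReal
  have i3 : Integrable (fun x => ∑ j, φ x * conj (dj j (dj j (⇑φ)) x)) :=
    integrable_finsetSum _ fun j _ => (pr_dj_dj φ j).1
  have e : ∀ x, φ x * conj (gop γ ε (⇑φ) x) = (((1 / (2 * ε) * ‖xw (⇑φ) x‖ ^ 2 : ℝ) : ℂ)
      + ((hartree γ (⇑φ) x * Complex.normSq (φ x) : ℝ) : ℂ))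
      - ((ε / 2 : ℝ) : ℂ) * ∑ j, φ x * conj (dj j (dj j (⇑φ)) x) := fun x => by
    rw [gop, map_sub, map_mul, map_mul, Complex.conj_ofReal, Complex.conj_ofReal, lap_eq, map_sum,
      ← Finset.mul_sum]
    have h1 : φ x * conj (φ x) = ((Complex.normSq (φ x) : ℝ) : ℂ) := Complex.mul_conj _
    have h2 : ‖xw (⇑φ) x‖ ^ 2 = ‖x‖ ^ 2 * Complex.normSq (φ x) := by
      rw [xw, norm_mul, mul_pow, Complex.norm_real, norm_norm, Complex.sq_norm]
    rw [h2]
    push_cast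
    rw [← h1]; ring
  unfold pr
  simp_rw [e]
  rw [integral_sub (iadd i1 i2) (i3.const_mul _), integral_add i1 i2, integral_const_mul,
    integral_finsetSum _ fun j _ => (pr_dj_dj φ j).1]
  simp_rw [(pr_dj_dj φ _).2]
  rw [integral_complex_ofReal, integral_complex_ofReal, integral_const_mul, ← nrm_sq (schwartz_xw φ)]
  unfold TT PP
  push_cast
  rw [Finset.sum_neg_distrib]
  ring

/-- difference of Hartree potentials along the solution -/
lemma Sol.pot_diff {γ ε C : ℝ} (H : HardyC n γ C) {u : ℝ → Rn n → ℂ} (S : Sol γ ε u) {s r M : ℝ}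
    (h1 : Nn (u s) ≤ M) (h2 : Nn (u r) ≤ M) (x : Rn n) :
    |hartree γ (u s) x - hartree γ (u r) x| ≤ C * (2 * M) * nrm (fun y => u s y - u r y) := by
  have hC := H.1
  have h := H.hartree_sub_le (S.h1 s) (S.h1 r) x
  have h3 := (H1n_le_Nn _).trans h1
  have h4 := (H1n_le_Nn _).trans h2
  calc _ ≤ _ := h
    _ ≤ C * (nrm (fun y => u s y - u r y) * (M + M)) := by
      have := nrm_nonneg (fun y => u s y - u r y)
      gcongr
    _ = _ := by ring

/-- difference of potential energies -/
lemma Sol.PP_diff {γ ε C : ℝ} (H : HardyC n γ C) {u : ℝ → Rn n → ℂ} (S : Sol γ ε u) {s r M : ℝ}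
    (h1 : Nn (u s) ≤ M) (h2 : Nn (u r) ≤ M) :
    |PP γ (u s) (u s) - PP γ (u r) (u r)| ≤ 4 * C * M ^ 3 * nrm (fun y => u s y - u r y) := by
  have hM0 : 0 ≤ M := (Nn_nonneg _).trans h1
  have hC := H.1
  have key : ∀ v, Nn (u v) ≤ M → |PP γ (u s) (u v) - PP γ (u r) (u v)| ≤
      2 * C * M ^ 3 * nrm (fun y => u s y - u r y) := fun v hv => by
    unfold PP
    rw [← integral_sub (H.PP_int (S.h1 s) (S.h1 v).mem) (H.PP_int (S.h1 r) (S.h1 v).mem), ← Real.norm_eq_abs]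
    refine (norm_integral_le_of_norm_le ((normSq_int (S.h1 v).mem).const_mul
      (C * (2 * M) * nrm (fun y => u s y - u r y))) (Eventually.of_forall fun x => ?_)).trans ?_
    · rw [← sub_mul, norm_mul, Real.norm_eq_abs, Real.norm_eq_abs, abs_of_nonneg (Complex.normSq_nonneg _)]
      exact mul_le_mul_of_nonneg_right (S.pot_diff H h1 h2 x) (Complex.normSq_nonneg _)
    · rw [integral_const_mul]
      have e : ∫ x, Complex.normSq (u v x) = nrm (u v) ^ 2 := by
        rw [nrm_sq (S.h1 v).mem]; simp_rw [Complex.sq_norm]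
      rw [e]
      have : nrm (u v) ^ 2 ≤ M ^ 2 := by
        have := (nrm_le_Nn _).trans hv
        gcongr
        exact nrm_nonneg _
      have h0 := nrm_nonneg (fun y => u s y - u r y)
      calc _ ≤ C * (2 * M) * nrm (fun y => u s y - u r y) * M ^ 2 := by gcongr
        _ = _ := by ring
  have a1 := key s h1
  have a2 := key r h2
  rw [H.PP_symm (S.h1 r) (S.h1 s)] at a1
  have : PP γ (u s) (u s) - PP γ (u r) (u r) = (PP γ (u s) (u s) - PP γ (u s) (u r))
    + (PP γ (u s) (u r) - PP γ (u r) (u r)) := by ring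
  rw [this]
  refine (abs_add_le _ _).trans ?_
  linarith

/-- first order expansion in time at a fixed time -/
lemma Sol.expand {γ ε C : ℝ} (hε : 0 < ε) (H : HardyC n γ C) {u : ℝ → Rn n → ℂ} (S : Sol γ ε u)
    {a b M : ℝ} (hM : ∀ s ∈ Set.Icc a b, Nn (u s) ≤ M) {s₀ : ℝ} (hs₀ : s₀ ∈ Set.Icc a b) :
    ∃ K, 0 ≤ K ∧ ∀ c d, a ≤ c → c ≤ s₀ → s₀ ≤ d → d ≤ b →
      ‖pr (u d) (u s₀) - pr (u c) (u s₀)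
        + Complex.I * (((TT ε (u s₀) + PP γ (u s₀) (u s₀)) * (d - c) : ℝ) : ℂ)‖ ≤ K * √(d - c) * (d - c) := by
  obtain ⟨L, hL, hol⟩ := S.holder hε H hM
  obtain ⟨φ, hφ⟩ := S.sch s₀
  have hC := H.1
  have hgm := H.gop_mem (ε := ε) φ
  have hMφ : Nn (⇑φ) ≤ M := hφ ▸ hM s₀ hs₀
  have hM0 : 0 ≤ M := (Nn_nonneg _).trans hMφ
  set g := gop γ ε (⇑φ) with hg
  refine ⟨L * (nrm g + C * (2 * M) * M ^ 2), by have := nrm_nonneg g; positivity,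
    fun c d hac hcs hsd hdb => ?_⟩
  set TP := TT ε (u s₀) + PP γ (u s₀) (u s₀) with hTP
  have hφc : ContDiff ℝ 2 (⇑φ) := φ.smooth 2
  have hsub : ∀ s ∈ Set.Icc c d, s ∈ Set.Icc a b := fun s hs => ⟨hac.trans hs.1, hs.2.trans hdb⟩
  have := pairing (ε := ε) (z := fun s => ((TP * s : ℝ) : ℂ)) (z' := fun _ => (TP : ℂ))
    (κ := fun R => 1 * (nrm (xw (⇑φ)) * nrm g) / R)
    (B := L * (nrm g + C * (2 * M) * M ^ 2) * √(d - c)) S.jc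
    (JC_const hφc) (hcs.trans hsd)
    (fun s hs => ⟨S.h1 s, (H1n_le_Nn _).trans (hM s (hsub s hs))⟩)
    (fun s hs => ⟨schwartz_H1 φ, (H1n_le_Nn _).trans hMφ⟩)
    (fun s _ => by
      have := ((hasDerivAt_id s).const_mul TP).ofReal_comp
      simpa using this) (tendsto_const_nhds.div_atTop tendsto_id) (fun s hs R hR => by
      have hMs := hM s (hsub s hs)
      have hR0 : 0 < R := by linarith
      have hδ : nrm (fun x => u s x - φ x) ≤ L * √(d - c) := by
        rw [← hφ]
        rcases le_total s₀ s with h | h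
        · refine (hol s₀ hs₀ s (hsub s hs) h).trans ?_
          gcongr
          · exact hs.2
        · have h1 := hol s (hsub s hs) s₀ hs₀ h
          have e : nrm (fun x => u s x - u s₀ x) = nrm (fun x => u s₀ x - u s x) := by
            have := nrm_const_mul (-1) (fun x => u s₀ x - u s x)
            simpa using this
          rw [e]
          refine h1.trans ?_
          gcongr
          · exact hs.1
      have hδm : MemLp (fun x => u s x - φ x) 2 volume := (S.h1 s).mem.sub (schwartz_memLp φ)
      have hchic : Continuous (chi n R) := (chi_contDiff R 1).continuous
      have chiI : ∀ {f : Rn n → ℂ}, Integrable f → Integrable (fun x => chi n R x * f x) := fun hf =>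
        hf.bdd_mul (c := 1) hchic.aestronglyMeasurable (Eventually.of_forall fun x => chi_norm_le R x)
      have hwm : MemLp (fun x => ((hartree γ (u s) x - hartree γ (⇑φ) x : ℝ) : ℂ) * u s x) 2 volume := by
        refine ((H.hartree_mul_mem (S.h1 s) (S.h1 s).mem).sub
          (H.hartree_mul_mem (schwartz_H1 φ) (S.h1 s).mem)).ae_eq (Eventually.of_forall fun x => ?_)
        simp only [Pi.sub_apply]; push_cast; ring
      have i1 := chiI (pr_integrable hδm hgm)
      have i2 := chiI (pr_integrable (schwartz_memLp φ) hgm)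
      have i3 := chiI (pr_integrable hwm (schwartz_memLp φ))
      have e : ∀ x, chi n R x * (FF ε u s x * conj (φ x) - u s x * conj (FF ε (fun _ => ⇑φ) s x))
          = chi n R x * ((u s x - φ x) * conj (g x)) + chi n R x * (φ x * conj (g x))
          + chi n R x * (((hartree γ (u s) x - hartree γ (⇑φ) x : ℝ) : ℂ) * u s x * conj (φ x)) := fun x => by
        rw [FF_const, S.eq, hg, gop, map_sub, map_mul, map_mul, Complex.conj_ofReal, Complex.conj_ofReal]
        push_cast; ring
      simp_rw [e]
      rw [integral_add (iadd i1 i2) i3, integral_add i1 i2]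
      have hT : (TP : ℂ) = ∫ x, φ x * conj (g x) := by
        rw [hTP, hφ]; exact (H.pr_gop φ).symm
      rw [hT]
      have t2 := chi_tail_int hR0 zero_le_one (schwartz_xw φ) hgm
        (pr_integrable (schwartz_memLp φ) hgm) (fun x => by simp)
      have t1 : ‖∫ x, chi n R x * ((u s x - φ x) * conj (g x))‖ ≤ L * √(d - c) * nrm g := by
        refine (norm_integral_le_of_norm_le (l2_cs hδm hgm).1 (Eventually.of_forall fun x => ?_)).trans
          ((l2_cs hδm hgm).2.trans (mul_le_mul_of_nonneg_right hδ (nrm_nonneg _)))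
        rw [norm_mul]
        refine (mul_le_of_le_one_left (norm_nonneg _) (chi_norm_le _ _)).trans ?_
        simp
      have t3 : ‖∫ x, chi n R x * (((hartree γ (u s) x - hartree γ (⇑φ) x : ℝ) : ℂ) * u s x * conj (φ x))‖
          ≤ C * (2 * M) * (L * √(d - c)) * M ^ 2 := by
        have h4 := l2_cs (S.h1 s).mem (schwartz_memLp φ)
        refine (norm_integral_le_of_norm_le (h4.1.const_mul (C * (2 * M) * (L * √(d - c))))
          (Eventually.of_forall fun x => ?_)).trans ?_
        · rw [norm_mul]
          refine (mul_le_of_le_one_left (norm_nonneg _) (chi_norm_le _ _)).trans ?_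
          rw [norm_mul, norm_mul, Complex.norm_real, RCLike.norm_conj, Real.norm_eq_abs, mul_assoc]
          have h5 := S.pot_diff H hMs (hM s₀ hs₀) x
          rw [hφ] at h5
          gcongr
          exact h5.trans (by gcongr)
        · rw [integral_const_mul]
          have y2 : nrm (u s) * nrm (⇑φ) ≤ M ^ 2 := by
            rw [sq]; exact mul_le_mul ((nrm_le_Nn _).trans hMs) ((nrm_le_Nn _).trans hMφ)
              (nrm_nonneg _) hM0
          have := h4.2.trans y2
          gcongr
      set X1 := ∫ x, chi n R x * ((u s x - φ x) * conj (g x))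
      set X2 := ∫ x, chi n R x * (φ x * conj (g x))
      set X3 := ∫ x, chi n R x * (((hartree γ (u s) x - hartree γ (⇑φ) x : ℝ) : ℂ) * u s x * conj (φ x))
      set X4 := ∫ x, φ x * conj (g x)
      have e2 : X1 + X2 + X3 - X4 = X1 + X3 + (X2 - X4) := by ring
      rw [e2]
      refine (norm_add_le _ _).trans ((add_le_add_left (norm_add_le _ _) _).trans ?_)
      have e3 : L * (nrm g + C * (2 * M) * M ^ 2) * √(d - c) = L * √(d - c) * nrm g
        + C * (2 * M) * (L * √(d - c)) * M ^ 2 := by ring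
      rw [e3]
      linarith)
  rw [← hφ] at this
  have e4 : (((TP * d : ℝ) : ℂ) - ((TP * c : ℝ) : ℂ)) = ((TP * (d - c) : ℝ) : ℂ) := by push_cast; ring
  rw [e4] at this
  exact this

end

section
variable {n : ℕ}

lemma JC.add {k : WithTop ℕ∞} {q r : ℝ → Rn n → ℂ} (hq : JC k q) (hr : JC k r) :
    JC k (fun s x => q s x + r s x) := ContDiff.add hq hr

lemma JC.sub {k : WithTop ℕ∞} {q r : ℝ → Rn n → ℂ} (hq : JC k q) (hr : JC k r) :
    JC k (fun s x => q s x - r s x) := ContDiff.sub hq hr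

lemma JC.const_mul {k : WithTop ℕ∞} {q : ℝ → Rn n → ℂ} (c : ℂ) (hq : JC k q) :
    JC k (fun s x => c * q s x) := contDiff_const.mul hq

lemma JC.shift {k : WithTop ℕ∞} {q : ℝ → Rn n → ℂ} (hq : JC k q) (h : ℝ) :
    JC k (fun s x => q (s + h) x) :=
  ContDiff.comp hq (f := fun p : ℝ × Rn n => (p.1 + h, p.2))
    ((contDiff_fst.add contDiff_const).prodMk contDiff_snd)

lemma JC.translate {k : WithTop ℕ∞} {q : ℝ → Rn n → ℂ} (hq : JC k q) (h : Rn n) :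
    JC k (fun s x => q s (x + h)) :=
  ContDiff.comp hq (f := fun p : ℝ × Rn n => (p.1, p.2 + h))
    (contDiff_fst.prodMk (contDiff_snd.add contDiff_const))

lemma lap_add {f g : Rn n → ℂ} (hf : ContDiff ℝ 2 f) (hg : ContDiff ℝ 2 g) (x : Rn n) :
    lap (fun x => f x + g x) x = lap f x + lap g x := by
  rw [lap_eq, lap_eq, lap_eq, ← Finset.sum_add_distrib]
  refine Finset.sum_congr rfl fun j _ => ?_
  have d1 : ∀ {f : Rn n → ℂ}, ContDiff ℝ 2 f → Differentiable ℝ (dj j f) := fun hf =>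
    (dj_contDiff (k := 1) hf (by norm_num)).differentiable one_ne_zero
  rw [dj_add (hf.differentiable two_ne_zero) (hg.differentiable two_ne_zero), dj_add (d1 hf) (d1 hg)]

lemma lap_const_mul {f : Rn n → ℂ} (c : ℂ) (hf : ContDiff ℝ 2 f) (x : Rn n) :
    lap (fun x => c * f x) x = c * lap f x := by
  rw [lap_eq, lap_eq, Finset.mul_sum]
  refine Finset.sum_congr rfl fun j _ => ?_
  have d1 : ∀ {f : Rn n → ℂ}, ContDiff ℝ 2 f → Differentiable ℝ (dj j f) := fun hf =>
    (dj_contDiff (k := 1) hf (by norm_num)).differentiable one_ne_zero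
  rw [dj_const_mul c (hf.differentiable two_ne_zero), dj_const_mul c (d1 hf)]

lemma FF_add {q r : ℝ → Rn n → ℂ} (hq : JC 2 q) (hr : JC 2 r) (ε s : ℝ) (x : Rn n) :
    FF ε (fun s x => q s x + r s x) s x = FF ε q s x + FF ε r s x := by
  have h1 := (JC.hasDerivAt (ContDiff.of_le hq (by norm_num)) s x).add
    (JC.hasDerivAt (ContDiff.of_le hr (by norm_num)) s x)
  unfold FF
  rw [lap_add (hq.slice s) (hr.slice s)]
  have : dt (fun s x => q s x + r s x) s x = dt q s x + dt r s x := h1.deriv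
  rw [this]; ring

lemma FF_const_mul {q : ℝ → Rn n → ℂ} (c : ℂ) (hq : JC 2 q) (ε s : ℝ) (x : Rn n) :
    FF ε (fun s x => c * q s x) s x = c * FF ε q s x := by
  have h1 := (JC.hasDerivAt (ContDiff.of_le hq (by norm_num)) s x).const_mul c
  unfold FF
  rw [lap_const_mul c (hq.slice s)]
  have : dt (fun s x => c * q s x) s x = c * dt q s x := h1.deriv
  rw [this]; ring

lemma FF_sub {q r : ℝ → Rn n → ℂ} (hq : JC 2 q) (hr : JC 2 r) (ε s : ℝ) (x : Rn n) :
    FF ε (fun s x => q s x - r s x) s x = FF ε q s x - FF ε r s x := by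
  have e : (fun s x => q s x - r s x) = fun s x => q s x + (-1) * r s x := by ext; ring
  rw [e, FF_add hq (hr.const_mul _), FF_const_mul _ hr]; ring

lemma FF_shift (q : ℝ → Rn n → ℂ) (ε h s : ℝ) (x : Rn n) :
    FF ε (fun s x => q (s + h) x) s x = FF ε q (s + h) x := by
  unfold FF dt
  rw [deriv_comp_add_const (fun σ => q σ x) h s]

lemma FF_translate (q : ℝ → Rn n → ℂ) (h : Rn n) (ε s : ℝ) (x : Rn n) :
    FF ε (fun s x => q s (x + h)) s x = FF ε q s (x + h) := by
  unfold FF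
  have : lap (fun x => q s (x + h)) x = lap (q s) (x + h) := by
    rw [lap_eq, lap_eq]
    refine Finset.sum_congr rfl fun j _ => ?_
    rw [dj_translate, dj_translate]
  rw [this]; rfl

lemma pr_conj_symm (p q : Rn n → ℂ) : pr p q = conj (pr q p) := by
  unfold pr
  rw [← integral_conj]
  congr 1; ext x
  simp [mul_comm]

/-- the integral identity behind energy conservation -/
lemma Sol.twist {γ ε C : ℝ} (hε : 0 < ε) (H : HardyC n γ C) {u : ℝ → Rn n → ℂ} (S : Sol γ ε u)
    {a b M : ℝ} (hM : ∀ s ∈ Set.Icc a b, Nn (u s) ≤ M) {A : ℝ → ℝ}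
    (hA : ∀ s ∈ Set.Icc a b, HasDerivAt A (PP γ (u s) (u s)) s) :
    ∃ K, 0 ≤ K ∧ ∀ h, 0 < h → a + h ≤ b →
      |2 * (pr (u b) (u (b - h))).im - 2 * (pr (u (a + h)) (u a)).im
        + ((A b - A (b - h)) - (A (a + h) - A a))| ≤ K * √h * h := by
  obtain ⟨L, hL, hol⟩ := S.holder hε H hM
  have hC := H.1
  have hab0 : a ≤ b ∨ b < a := le_or_gt a b
  rcases hab0 with hab | hab
  swap
  · exact ⟨0, le_rfl, fun h h0 h1 => by linarith⟩
  have hM0 : 0 ≤ M := (Nn_nonneg _).trans (hM a ⟨le_rfl, hab⟩)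
  refine ⟨C * (2 * M) * L ^ 3 * (b - a), by have := sub_nonneg.2 hab; positivity, fun h h0 hb => ?_⟩
  set q : ℝ → Rn n → ℂ := fun s x => u (s + h) x + Complex.I * u s x with hq
  have hjc : JC 2 q := (S.jc.shift h).add (S.jc.const_mul _)
  have mem1 : ∀ s ∈ Set.Icc a (b - h), s ∈ Set.Icc a b := fun s hs => ⟨hs.1, by linarith [hs.2]⟩
  have mem2 : ∀ s ∈ Set.Icc a (b - h), s + h ∈ Set.Icc a b := fun s hs =>
    ⟨by linarith [hs.1], by linarith [hs.2]⟩
  have hH1 : ∀ s, IsH1 (q s) := fun s => (S.h1 (s + h)).add ((S.h1 s).const_mul _)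
  have hH : ∀ s ∈ Set.Icc a (b - h), IsH1 (q s) ∧ H1n (q s) ≤ 2 * M := fun s hs => by
    refine ⟨hH1 s, (H1n_add_le (S.h1 (s + h)) ((S.h1 s).const_mul _)).trans ?_⟩
    rw [H1n_const_mul _ (S.h1 s), Complex.norm_I]
    linarith [(H1n_le_Nn _).trans (hM s (mem1 s hs)), (H1n_le_Nn _).trans (hM _ (mem2 s hs))]
  have key := pairing (ε := ε) (z := fun s => Complex.I * ((A s - A (s + h) : ℝ) : ℂ))
    (z' := fun s => Complex.I * ((PP γ (u s) (u s) - PP γ (u (s + h)) (u (s + h)) : ℝ) : ℂ))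
    (κ := fun R => (4 * C * M ^ 4) / R) (B := C * (2 * M) * L ^ 3 * (√h * h)) hjc hjc
    (by linarith : a ≤ b - h) hH hH
    (fun s hs => by
      have h1 := hA s (mem1 s hs)
      have h2 := (hA _ (mem2 s hs)).comp_add_const s h
      exact ((h1.sub h2).ofReal_comp).const_mul _)
    (tendsto_const_nhds.div_atTop tendsto_id)
    (fun s hs R hR => by
      have hR0 : 0 < R := by linarith
      have hM1 := hM s (mem1 s hs)
      have hM2 := hM _ (mem2 s hs)
      set u1 := u s with hu1
      set u2 := u (s + h) with hu2
      have H1 : IsH1 u1 := S.h1 s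
      have H2 : IsH1 u2 := S.h1 (s + h)
      have hδm : MemLp (fun x => u2 x - u1 x) 2 volume := H2.mem.sub H1.mem
      have hδ : nrm (fun x => u2 x - u1 x) ≤ L * √h := by
        have := hol s (mem1 s hs) _ (mem2 s hs) (by linarith)
        simpa using this
      set w : Rn n → ℝ := fun x => hartree γ u1 x - hartree γ u2 x with hw
      have hwb : ∀ x, |w x| ≤ C * (2 * M) * nrm (fun x => u2 x - u1 x) := fun x => by
        rw [hw, abs_sub_comm]; exact S.pot_diff H hM2 hM1 x
      have hwb2 : ∀ x, |w x| ≤ 2 * C * M ^ 2 := fun x => by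
        have b1 := H.hartree_abs_le H1 ((H1n_le_Nn _).trans hM1) x
        have b2 := H.hartree_abs_le H2 ((H1n_le_Nn _).trans hM2) x
        have := abs_sub (hartree γ u1 x) (hartree γ u2 x)
        simp only [hw]; linarith
      have hwm : AEStronglyMeasurable w volume :=
        (hartree_meas γ H1.diff.continuous).aestronglyMeasurable.sub
          (hartree_meas γ H2.diff.continuous).aestronglyMeasurable
      have hchic : Continuous (chi n R) := (chi_contDiff R 1).continuous
      have chiI : ∀ {f : Rn n → ℂ}, Integrable f → Integrable (fun x => chi n R x * f x) := fun hf =>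
        hf.bdd_mul (c := 1) hchic.aestronglyMeasurable (Eventually.of_forall fun x => chi_norm_le R x)
      have wI : ∀ {p : Rn n → ℂ}, MemLp p 2 volume →
          Integrable (fun x => Complex.I * ((w x * Complex.normSq (p x) : ℝ) : ℂ)) := fun hp =>
        (Integrable.ofReal ((normSq_int hp).bdd_mul (c := 2 * C * M ^ 2) hwm
          (Eventually.of_forall hwb2))).const_mul _
      have wn : ∀ {p : Rn n → ℂ} (x : Rn n), ‖Complex.I * ((w x * Complex.normSq (p x) : ℝ) : ℂ)‖
          = |w x| * (‖p x‖ * ‖p x‖) := fun x => by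
        rw [norm_mul, Complex.norm_I, one_mul, Complex.norm_real, norm_mul, Real.norm_eq_abs,
          Real.norm_of_nonneg (Complex.normSq_nonneg _), Complex.normSq_eq_norm_sq, sq]
      have tail : ∀ {p : Rn n → ℂ}, MemLp p 2 volume → MemLp (xw p) 2 volume → Nn p ≤ M →
          ‖(∫ x, chi n R x * (Complex.I * ((w x * Complex.normSq (p x) : ℝ) : ℂ)))
            - ∫ x, (Complex.I * ((w x * Complex.normSq (p x) : ℝ) : ℂ))‖ ≤ 2 * C * M ^ 4 / R := fun {p} hp hxp hN => by
        refine (chi_tail_int (K := 2 * C * M ^ 2) hR0 (by positivity) hxp hp (wI hp)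
          (fun x => by rw [wn]; gcongr; exact hwb2 x)).trans ?_
        have y : nrm (xw p) * nrm p ≤ M ^ 2 := by
          rw [sq]; exact mul_le_mul ((nrm_xw_le_Nn _).trans hN) ((nrm_le_Nn _).trans hN)
              (nrm_nonneg _) hM0
        calc _ ≤ 2 * C * M ^ 2 * (M ^ 2) / R := by gcongr
          _ = _ := by ring
      have t1 := tail H1.mem (S.xm s) hM1
      have t2 := tail H2.mem (S.xm (s + h)) hM2
      have t3 : ‖∫ x, chi n R x * (Complex.I * ((w x * Complex.normSq (u2 x - u1 x) : ℝ) : ℂ))‖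
          ≤ C * (2 * M) * L ^ 3 * (√h * h) := by
        have hd := l2_cs hδm hδm
        refine (norm_integral_le_of_norm_le (hd.1.const_mul (C * (2 * M) * nrm (fun x => u2 x - u1 x)))
          (Eventually.of_forall fun x => ?_)).trans ?_
        · rw [norm_mul]
          refine (mul_le_of_le_one_left (norm_nonneg _) (chi_norm_le _ _)).trans ?_
          rw [wn (p := fun x => u2 x - u1 x)]
          gcongr
          exact hwb x
        · rw [integral_const_mul]
          have hN0 := nrm_nonneg (fun x => u2 x - u1 x)
          calc _ ≤ C * (2 * M) * (L * √h) * ((L * √h) * (L * √h)) := by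
                gcongr
                exact hd.2.trans (by gcongr)
            _ = C * (2 * M) * L ^ 3 * (√h * (√h * √h)) := by ring
            _ = _ := by rw [Real.mul_self_sqrt h0.le]
      have e : ∀ x, chi n R x * (FF ε q s x * conj (q s x) - q s x * conj (FF ε q s x))
          = chi n R x * (Complex.I * ((w x * Complex.normSq (u1 x) : ℝ) : ℂ))
          + chi n R x * (Complex.I * ((w x * Complex.normSq (u2 x) : ℝ) : ℂ))
          - chi n R x * (Complex.I * ((w x * Complex.normSq (u2 x - u1 x) : ℝ) : ℂ)) := fun x => by
        rw [← mul_add, ← mul_sub]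
        congr 1
        rw [hq, FF_add (S.jc.shift h) (S.jc.const_mul _), FF_const_mul _ S.jc, FF_shift, S.eq, S.eq,
          ← hu1, ← hu2]
        simp only [map_add, map_mul, Complex.conj_ofReal, Complex.conj_I, hw]
        have hm : ∀ z : ℂ, ((Complex.normSq z : ℝ) : ℂ) = z * conj z := fun z => (Complex.mul_conj z).symm
        push_cast
        rw [hm, hm, hm, map_sub]
        linear_combination ((↑(hartree γ u1 x) - ↑(hartree γ u2 x) : ℂ)) * 0 * Complex.I_sq
      simp_rw [e]
      have hz : Complex.I * ((PP γ u1 u1 - PP γ u2 u2 : ℝ) : ℂ)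
          = (∫ x, Complex.I * ((w x * Complex.normSq (u1 x) : ℝ) : ℂ))
            + ∫ x, Complex.I * ((w x * Complex.normSq (u2 x) : ℝ) : ℂ) := by
        rw [integral_const_mul, integral_const_mul, ← mul_add, integral_complex_ofReal,
          integral_complex_ofReal, ← Complex.ofReal_add]
        congr 2
        have c1 : ∫ x, w x * Complex.normSq (u1 x) = PP γ u1 u1 - PP γ u2 u1 := by
          unfold PP
          rw [← integral_sub (H.PP_int H1 H1.mem) (H.PP_int H2 H1.mem)]
          simp_rw [hw, sub_mul]
        have c2 : ∫ x, w x * Complex.normSq (u2 x) = PP γ u1 u2 - PP γ u2 u2 := by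
          unfold PP
          rw [← integral_sub (H.PP_int H1 H2.mem) (H.PP_int H2 H2.mem)]
          simp_rw [hw, sub_mul]
        rw [c1, c2, H.PP_symm H2 H1]; ring
      rw [hz, integral_sub (iadd (chiI (wI H1.mem)) (chiI (wI H2.mem))) (chiI (wI hδm)),
        integral_add (chiI (wI H1.mem)) (chiI (wI H2.mem))]
      set X1 := ∫ x, chi n R x * (Complex.I * ((w x * Complex.normSq (u1 x) : ℝ) : ℂ))
      set X2 := ∫ x, chi n R x * (Complex.I * ((w x * Complex.normSq (u2 x) : ℝ) : ℂ))
      set X3 := ∫ x, chi n R x * (Complex.I * ((w x * Complex.normSq (u2 x - u1 x) : ℝ) : ℂ))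
      set Y1 := ∫ x, Complex.I * ((w x * Complex.normSq (u1 x) : ℝ) : ℂ)
      set Y2 := ∫ x, Complex.I * ((w x * Complex.normSq (u2 x) : ℝ) : ℂ)
      have e2 : X1 + X2 - X3 - (Y1 + Y2) = (X1 - Y1) + (X2 - Y2) - X3 := by ring
      rw [e2]
      refine (norm_sub_le _ _).trans ((add_le_add_left (norm_add_le _ _) _).trans ?_)
      have e3 : 4 * C * M ^ 4 / R = 2 * C * M ^ 4 / R + 2 * C * M ^ 4 / R := by ring
      rw [e3]
      linarith)
  have nq : ∀ s, s ∈ Set.Icc a (b - h) → nrm (q s) ^ 2 = nrm (u (s + h)) ^ 2 + nrm (u s) ^ 2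
      + 2 * (pr (u (s + h)) (u s)).im := fun s hs => by
    have h1 := nrm_sub_sq (S.h1 (s + h)).mem ((S.h1 s).const_mul (-Complex.I)).mem
    have h2 := nrm_const_mul (-Complex.I) (u s)
    rw [norm_neg, Complex.norm_I, one_mul] at h2
    rw [h2] at h1
    have h3 : pr (u (s + h)) (fun x => -Complex.I * u s x) = Complex.I * pr (u (s + h)) (u s) := by
      unfold pr
      rw [← integral_const_mul]
      congr 1; ext x
      simp only [map_mul, map_neg, Complex.conj_I]; ring
    rw [h3, Complex.I_mul_re] at h1
    have h4 : (fun x => u (s + h) x - -Complex.I * u s x) = q s := by ext x; simp only [hq]; ring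
    rw [h4] at h1
    linarith
  rw [pr_self (hH1 _).mem, pr_self (hH1 _).mem, nq _ ⟨by linarith, le_rfl⟩,
    nq _ ⟨le_rfl, by linarith⟩] at key
  have ebh : b - h + h = b := by ring
  rw [ebh] at key
  have m1 := S.mass (a := a) (b := b) hab hM
  have m2 := S.mass (a := a) (b := a + h) (by linarith) (fun s hs => hM s ⟨hs.1, hs.2.trans hb⟩)
  have m3 := S.mass (a := a) (b := b - h) (by linarith) (fun s hs => hM s (mem1 s hs))
  rw [← m1, ← m2, ← m3] at key
  have efin : (((nrm (u a) ^ 2 + nrm (u a) ^ 2 + 2 * (pr (u b) (u (b - h))).im : ℝ) : ℂ)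
      - ((nrm (u a) ^ 2 + nrm (u a) ^ 2 + 2 * (pr (u (a + h)) (u a)).im : ℝ) : ℂ)
      + Complex.I * (Complex.I * ((A (b - h) - A b : ℝ) : ℂ) - Complex.I * ((A a - A (a + h) : ℝ) : ℂ)))
      = ((2 * (pr (u b) (u (b - h))).im - 2 * (pr (u (a + h)) (u a)).im
        + ((A b - A (b - h)) - (A (a + h) - A a)) : ℝ) : ℂ) := by
    push_cast
    linear_combination ((A (b - h) - A b : ℂ) - (A a - A (a + h) : ℂ)) * Complex.I_sq
  rw [efin, Complex.norm_real, Real.norm_eq_abs] at key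
  refine key.trans ?_
  have : 0 ≤ C * (2 * M) * L ^ 3 * (√h * h) := by positivity
  calc _ ≤ C * (2 * M) * L ^ 3 * (√h * h) * (b - a) := by gcongr; linarith
    _ = _ := by ring

end


/-- total energy -/
def EE {n : ℕ} (γ ε : ℝ) (p : Rn n → ℂ) : ℝ := nrm p ^ 2 + (2 * TT ε p + PP γ p p)

section
variable {n : ℕ}

lemma Sol.energy {γ ε C : ℝ} (hε : 0 < ε) (H : HardyC n γ C) {u : ℝ → Rn n → ℂ} (S : Sol γ ε u)
    {a b M : ℝ} (hab : a < b) (hM : ∀ s ∈ Set.Icc a b, Nn (u s) ≤ M) :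
    EE γ ε (u a) = EE γ ε (u b) := by
  have hC := H.1
  have ha : a ∈ Set.Icc a b := ⟨le_rfl, hab.le⟩
  have hb : b ∈ Set.Icc a b := ⟨hab.le, le_rfl⟩
  have hM0 : 0 ≤ M := (Nn_nonneg _).trans (hM a ha)
  obtain ⟨L, hL, hol⟩ := S.holder hε H hM
  set P : ℝ → ℝ := fun s => PP γ (u s) (u s) with hP
  have hP1 : ∀ s₁ ∈ Set.Icc a b, ∀ s₂ ∈ Set.Icc a b, s₁ ≤ s₂ →
      |P s₂ - P s₁| ≤ 4 * C * M ^ 3 * L * √(s₂ - s₁) := fun s₁ h1 s₂ h2 h12 => by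
    refine (S.PP_diff H (hM _ h2) (hM _ h1)).trans ?_
    have := hol s₁ h1 s₂ h2 h12
    calc _ ≤ 4 * C * M ^ 3 * (L * √(s₂ - s₁)) := by gcongr
      _ = _ := by ring
  set D := 4 * C * M ^ 3 * L with hD
  have hD0 : 0 ≤ D := by positivity
  have hPabs : ∀ s₁ ∈ Set.Icc a b, ∀ s₂ ∈ Set.Icc a b, |P s₂ - P s₁| ≤ D * √|s₂ - s₁| :=
    fun s₁ h1 s₂ h2 => by
      rcases le_total s₁ s₂ with h | h
      · rw [abs_of_nonneg (sub_nonneg.2 h)]; exact hP1 s₁ h1 s₂ h2 h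
      · rw [abs_sub_comm, abs_sub_comm s₂ s₁, abs_of_nonneg (sub_nonneg.2 h)]; exact hP1 s₂ h2 s₁ h1 h
  have hPc : ContinuousOn P (Set.Icc a b) := fun s₀ hs₀ => by
    refine tendsto_iff_norm_sub_tendsto_zero.2 ?_
    have hb0 : Tendsto (fun s => D * √|s - s₀|) (𝓝[Set.Icc a b] s₀) (𝓝 0) := by
      have : ContinuousAt (fun s : ℝ => D * √|s - s₀|) s₀ := by fun_prop
      have := this.tendsto
      simp only [sub_self, abs_zero, Real.sqrt_zero, mul_zero] at this
      exact this.mono_left nhdsWithin_le_nhds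
    refine squeeze_zero' (Eventually.of_forall fun s => norm_nonneg _) ?_ hb0
    filter_upwards [self_mem_nhdsWithin] with s hs
    exact hPabs s₀ hs₀ s hs
  set Pe : ℝ → ℝ := Set.IccExtend hab.le (Set.restrict (Set.Icc a b) P) with hPe
  have hPec : Continuous Pe := (continuousOn_iff_continuous_restrict.1 hPc).Icc_extend'
  have hPeq : ∀ s ∈ Set.Icc a b, Pe s = P s := fun s hs => by
    rw [hPe, Set.IccExtend_of_mem hab.le _ hs]; rfl
  set A : ℝ → ℝ := fun s => ∫ r in a..s, Pe r with hA
  have hAd : ∀ s ∈ Set.Icc a b, HasDerivAt A (PP γ (u s) (u s)) s := fun s hs => by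
    have := (hPec.integral_hasStrictDerivAt a s).hasDerivAt
    rwa [hPeq s hs] at this
  have hAint : ∀ c d, a ≤ c → c ≤ d → d ≤ b → ∀ s₀ ∈ Set.Icc c d,
      |A d - A c - P s₀ * (d - c)| ≤ D * √(d - c) * (d - c) := fun c d hac hcd hdb s₀ hs₀ => by
    have e1 : A d - A c = ∫ r in c..d, Pe r := by
      simp only [hA]
      rw [intervalIntegral.integral_interval_sub_left (hPec.intervalIntegrable _ _)
        (hPec.intervalIntegrable _ _)]
    have e2 : P s₀ * (d - c) = ∫ r in c..d, P s₀ := by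
      rw [intervalIntegral.integral_const, smul_eq_mul, mul_comm]
    rw [e1, e2, ← intervalIntegral.integral_sub (hPec.intervalIntegrable _ _) (by simp)]
    have := intervalIntegral.norm_integral_le_of_norm_le_const (a := c) (b := d) (C := D * √(d - c))
      (f := fun r => Pe r - P s₀) (fun r hr => by
        rw [Set.uIoc_of_le hcd] at hr
        have hr' : r ∈ Set.Icc a b := ⟨hac.trans hr.1.le, hr.2.trans hdb⟩
        rw [hPeq r hr']
        refine (hPabs s₀ ⟨hac.trans hs₀.1, hs₀.2.trans hdb⟩ r hr').trans ?_
        gcongr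
        rw [abs_le]; constructor <;> linarith [hr.1, hr.2, hs₀.1, hs₀.2])
    rwa [abs_of_nonneg (sub_nonneg.2 hcd)] at this
  obtain ⟨K1, hK1, tw⟩ := S.twist hε H hM hAd
  obtain ⟨K2, hK2, exa⟩ := S.expand hε H hM ha
  obtain ⟨K3, hK3, exb⟩ := S.expand hε H hM hb
  set Q := (2 * TT ε (u a) + P a) - (2 * TT ε (u b) + P b) with hQ
  have main : ∀ h, 0 < h → h ≤ b - a → |Q| ≤ (K1 + 2 * K2 + 2 * K3 + 2 * D) * √h := fun h h0 h1 => by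
    have t1 := tw h h0 (by linarith)
    have t2 := exa a (a + h) le_rfl le_rfl (by linarith) (by linarith)
    have t3 := exb (b - h) b (by linarith) (by linarith) le_rfl le_rfl
    have t4 := hAint a (a + h) le_rfl (by linarith) (by linarith) a ⟨le_rfl, by linarith⟩
    have t5 := hAint (b - h) b (by linarith) (by linarith) le_rfl b ⟨by linarith, le_rfl⟩
    have ea : a + h - a = h := by ring
    have eb : b - (b - h) = h := by ring
    rw [ea] at t2 t4
    rw [eb] at t3 t5
    have s2 := (Complex.abs_im_le_norm _).trans t2
    have s3 := (Complex.abs_im_le_norm _).trans t3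
    rw [pr_self (S.h1 a).mem] at s2
    rw [pr_self (S.h1 b).mem, pr_conj_symm (u (b - h)) (u b)] at s3
    simp only [Complex.add_im, Complex.sub_im, Complex.I_mul_im, Complex.ofReal_re, Complex.ofReal_im,
      Complex.conj_im] at s2 s3
    rw [abs_le] at t1 s2 s3 t4 t5
    have : |Q * h| ≤ (K1 + 2 * K2 + 2 * K3 + 2 * D) * √h * h := by
      have hPa : PP γ (u a) (u a) = P a := rfl
      have hPb : PP γ (u b) (u b) = P b := rfl
      rw [hPa] at s2
      rw [hPb] at s3
      rw [abs_le]
      constructor <;> nlinarith [t1.1, t1.2, s2.1, s2.2, s3.1, s3.2, t4.1, t4.2, t5.1, t5.2]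
    rw [abs_mul, abs_of_pos h0] at this
    exact le_of_mul_le_mul_right this h0
  have lim : Tendsto (fun h : ℝ => (K1 + 2 * K2 + 2 * K3 + 2 * D) * √h) (𝓝[>] 0) (𝓝 0) := by
    have : Continuous (fun h : ℝ => (K1 + 2 * K2 + 2 * K3 + 2 * D) * √h) := by fun_prop
    have := this.tendsto 0
    simp only [Real.sqrt_zero, mul_zero] at this
    exact this.mono_left nhdsWithin_le_nhds
  have hQ0 : |Q| ≤ 0 := by
    refine ge_of_tendsto lim ?_
    filter_upwards [Ioc_mem_nhdsGT (sub_pos.2 hab)] with h hh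
    exact main h hh.1 hh.2
  have := abs_nonpos_iff.1 hQ0
  have m := S.mass hab.le hM
  unfold EE
  rw [m]
  simp only [hQ, hP] at this
  linarith

/-- energy controls the norm -/
lemma exists_Nn_le_EE {ε : ℝ} (n : ℕ) (hε : 0 < ε) : ∃ K, 0 ≤ K ∧ ∀ (γ : ℝ) (p : Rn n → ℂ), Nn p ≤ K * √(EE γ ε p) := by
  refine ⟨1 + n * √(1 / ε) + √ε, by positivity, fun γ p => ?_⟩
  have hP := PP_nonneg γ p p
  have hs : ∀ j : Fin n, nrm (dj j p) ^ 2 ≤ ∑ j, nrm (dj j p) ^ 2 := fun j =>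
    Finset.single_le_sum (f := fun j => nrm (dj j p) ^ 2) (fun i _ => sq_nonneg _) (Finset.mem_univ j)
  have hsum0 : 0 ≤ ∑ j, nrm (dj j p) ^ 2 := Finset.sum_nonneg fun i _ => sq_nonneg _
  have hE : EE γ ε p = nrm p ^ 2 + ε * ∑ j, nrm (dj j p) ^ 2 + 1 / ε * nrm (xw p) ^ 2 + PP γ p p := by
    unfold EE TT; field_simp; ring
  have h1ε : 0 < 1 / ε := by positivity
  have a1 : nrm p ≤ √(EE γ ε p) := Real.le_sqrt_of_sq_le (by rw [hE]; nlinarith [mul_nonneg hε.le hsum0, mul_nonneg h1ε.le (sq_nonneg (nrm (xw p)))])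
  have a2 : ∀ j, nrm (dj j p) ≤ √(1 / ε) * √(EE γ ε p) := fun j => by
    rw [← Real.sqrt_mul h1ε.le]
    refine Real.le_sqrt_of_sq_le ?_
    have : ε * nrm (dj j p) ^ 2 ≤ EE γ ε p := by
      rw [hE]; nlinarith [mul_le_mul_of_nonneg_left (hs j) hε.le, mul_nonneg h1ε.le (sq_nonneg (nrm (xw p))), sq_nonneg (nrm p)]
    rw [one_div, inv_mul_eq_div, le_div_iff₀ hε]; linarith
  have a3 : nrm (xw p) ≤ √ε * √(EE γ ε p) := by
    rw [← Real.sqrt_mul hε.le]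
    refine Real.le_sqrt_of_sq_le ?_
    have : 1 / ε * nrm (xw p) ^ 2 ≤ EE γ ε p := by
      rw [hE]; nlinarith [mul_nonneg hε.le hsum0, sq_nonneg (nrm p)]
    rw [one_div, inv_mul_eq_div, div_le_iff₀ hε] at this; linarith
  have a4 : ∑ j, nrm (dj j p) ≤ n * (√(1 / ε) * √(EE γ ε p)) := by
    refine (Finset.sum_le_sum fun j _ => a2 j).trans (le_of_eq ?_)
    rw [Finset.sum_const, Finset.card_univ, Fintype.card_fin, nsmul_eq_mul]
  unfold Nn H1n
  nlinarith

/-- the norm controls the energy -/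
lemma HardyC.EE_le {γ ε C M : ℝ} (hε : 0 < ε) (H : HardyC n γ C) {p : Rn n → ℂ} (hp : IsH1 p) (hM : Nn p ≤ M) :
    EE γ ε p ≤ M ^ 2 + (ε * (n * M ^ 2) + 1 / ε * M ^ 2) + C * M ^ 2 * M ^ 2 := by
  have hC := H.1
  have hM0 := (Nn_nonneg p).trans hM
  have b1 : nrm p ^ 2 ≤ M ^ 2 := pow_le_pow_left₀ (nrm_nonneg _) ((nrm_le_Nn _).trans hM) 2
  have b2 : nrm (xw p) ^ 2 ≤ M ^ 2 := pow_le_pow_left₀ (nrm_nonneg _) ((nrm_xw_le_Nn _).trans hM) 2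
  have b3 : ∑ j, nrm (dj j p) ^ 2 ≤ n * M ^ 2 := by
    refine (Finset.sum_le_sum fun j _ => pow_le_pow_left₀ (nrm_nonneg _)
      ((nrm_dj_le_H1n p j).trans ((H1n_le_Nn _).trans hM)) 2).trans (le_of_eq ?_)
    rw [Finset.sum_const, Finset.card_univ, Fintype.card_fin, nsmul_eq_mul]
  have b4 : PP γ p p ≤ C * M ^ 2 * M ^ 2 := by
    calc PP γ p p ≤ ∫ x, C * M ^ 2 * Complex.normSq (p x) := by
          refine integral_mono (H.PP_int hp hp.mem) ((normSq_int hp.mem).const_mul _) fun x => ?_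
          exact mul_le_mul_of_nonneg_right ((le_abs_self _).trans
            (H.hartree_abs_le hp ((H1n_le_Nn _).trans hM) x)) (Complex.normSq_nonneg _)
      _ = C * M ^ 2 * nrm p ^ 2 := by
          rw [integral_const_mul, nrm_sq hp.mem]; simp_rw [Complex.sq_norm]
      _ ≤ _ := by gcongr
  have e : EE γ ε p = nrm p ^ 2 + (ε * ∑ j, nrm (dj j p) ^ 2 + 1 / ε * nrm (xw p) ^ 2) + PP γ p p := by
    unfold EE TT; field_simp; ring
  rw [e]
  gcongr

end

section
variable {n : ℕ}

lemma bdd_of_locBdd {N : ℝ → ℝ} {a b : ℝ}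
    (h : ∀ s ∈ Set.Icc a b, ∃ M, ∀ᶠ t in 𝓝 s, N t ≤ M) : ∃ M, ∀ s ∈ Set.Icc a b, N s ≤ M := by
  refine IsCompact.induction_on (p := fun A => ∃ M, ∀ s ∈ A, N s ≤ M) isCompact_Icc
    ⟨0, by simp⟩ ?_ ?_ ?_
  · rintro A B hAB ⟨M, hM⟩
    exact ⟨M, fun s hs => hM s (hAB hs)⟩
  · rintro A B ⟨M, hM⟩ ⟨M', hM'⟩
    refine ⟨max M M', ?_⟩
    rintro s (hs | hs)
    · exact (hM s hs).trans (le_max_left _ _)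
    · exact (hM' s hs).trans (le_max_right _ _)
  · intro x hx
    obtain ⟨M, hM⟩ := h x hx
    exact ⟨{t | N t ≤ M}, mem_nhdsWithin_of_mem_nhds hM, M, fun s hs => hs⟩

lemma baire_bdd {N E Φ Ψ : ℝ → ℝ} (hcl : ∀ M, IsClosed {s | N s ≤ M})
    (hΦ : ∀ s A, E s ≤ A → N s ≤ Φ A) (hΨ : ∀ s M, N s ≤ M → E s ≤ Ψ M)
    (hE : ∀ a b M, a < b → (∀ s ∈ Set.Icc a b, N s ≤ M) → E a = E b) (a b : ℝ) :
    ∃ M, ∀ s ∈ Set.Icc a b, N s ≤ M := by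
  have hR : ∀ a s m, a < s → N a ≤ m → (∀ t ∈ Set.Ioc a s, ∃ M, ∀ᶠ r in 𝓝 t, N r ≤ M) →
      N s ≤ Φ (Ψ m) := by
    intro a s m has ha hl
    have h1 : ∀ t ∈ Set.Ioc a s, E t = E s := by
      intro t ht
      rcases ht.2.eq_or_lt with h | h
      · rw [h]
      · obtain ⟨M, hM⟩ := bdd_of_locBdd (N := N) (a := t) (b := s)
          (fun r hr => hl r ⟨lt_of_lt_of_le ht.1 hr.1, hr.2⟩)
        exact hE t s M h hM
    have h2 : E a = E s := by
      refine hE a s (max m (Φ (E s))) has (fun t ht => ?_)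
      rcases ht.1.eq_or_lt with h | h
      · rw [← h]; exact ha.trans (le_max_left _ _)
      · exact (hΦ t _ (h1 t ⟨h, ht.2⟩).le).trans (le_max_right _ _)
    exact hΦ s _ (h2 ▸ hΨ a m ha)
  have hL : ∀ a s m, s < a → N a ≤ m → (∀ t ∈ Set.Ico s a, ∃ M, ∀ᶠ r in 𝓝 t, N r ≤ M) →
      N s ≤ Φ (Ψ m) := by
    intro a s m has ha hl
    have h1 : ∀ t ∈ Set.Ico s a, E t = E s := by
      intro t ht
      rcases ht.1.eq_or_lt with h | h
      · rw [h]
      · obtain ⟨M, hM⟩ := bdd_of_locBdd (N := N) (a := s) (b := t)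
          (fun r hr => hl r ⟨hr.1, lt_of_le_of_lt hr.2 ht.2⟩)
        exact (hE s t M h hM).symm
    have h2 : E s = E a := by
      refine hE s a (max m (Φ (E s))) has (fun t ht => ?_)
      rcases ht.2.eq_or_lt with h | h
      · rw [h]; exact ha.trans (le_max_left _ _)
      · exact (hΦ t _ (h1 t ⟨ht.1, h⟩).le).trans (le_max_right _ _)
    exact hΦ s _ (h2 ▸ hΨ a m ha)
  set K : Set ℝ := {s | ¬ ∃ M, ∀ᶠ t in 𝓝 s, N t ≤ M} with hK
  have hKc : IsClosed K := by
    rw [← isOpen_compl_iff, isOpen_iff_mem_nhds]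
    intro s hs
    simp only [hK, Set.mem_compl_iff, Set.mem_setOf_eq, not_not] at hs
    obtain ⟨M, hM⟩ := hs
    filter_upwards [eventually_eventually_nhds.mpr hM] with t ht
    simp only [hK, Set.mem_compl_iff, Set.mem_setOf_eq, not_not]
    exact ⟨M, ht⟩
  have hKe : K = ∅ := by
    by_contra hne
    obtain ⟨k₁, hk₁⟩ := Set.nonempty_iff_ne_empty.mpr hne
    haveI : Nonempty K := ⟨⟨k₁, hk₁⟩⟩
    haveI : CompleteSpace K := hKc.completeSpace_coe
    obtain ⟨m, hm⟩ := nonempty_interior_of_iUnion_of_closed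
      (f := fun m : ℕ => {k : K | N k.1 ≤ (m : ℝ)})
      (fun m => (hcl m).preimage continuous_subtype_val)
      (by
        ext k
        simp only [Set.mem_iUnion, Set.mem_setOf_eq, Set.mem_univ, iff_true]
        exact exists_nat_ge (N k.1))
    obtain ⟨k₀, hk₀⟩ := hm
    rw [mem_interior_iff_mem_nhds, Metric.mem_nhds_iff] at hk₀
    obtain ⟨δ, hδ, hball⟩ := hk₀
    have hb : ∀ t ∈ K, |t - k₀.1| < δ → N t ≤ m := by
      intro t ht htd
      exact hball (show (⟨t, ht⟩ : K) ∈ Metric.ball k₀ δ by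
        rw [Metric.mem_ball, Subtype.dist_eq, Real.dist_eq]; exact htd)
    apply k₀.2
    refine ⟨max m (Φ (Ψ m)), ?_⟩
    filter_upwards [Metric.ball_mem_nhds k₀.1 hδ] with s hs
    rw [Metric.mem_ball, Real.dist_eq] at hs
    by_cases hsK : s ∈ K
    · exact (hb s hsK hs).trans (le_max_left _ _)
    refine le_trans ?_ (le_max_right _ _)
    rw [abs_lt] at hs
    rcases lt_trichotomy s k₀.1 with h | h | h
    · set A := K ∩ Set.Icc s k₀.1
      have hA : IsCompact A := isCompact_Icc.inter_left hKc
      have hAn : A.Nonempty := ⟨k₀.1, k₀.2, h.le, le_rfl⟩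
      obtain ⟨hc1, hc2⟩ := hA.sInf_mem hAn
      set c := sInf A
      have hsc : s < c := lt_of_le_of_ne hc2.1 (fun h => hsK (h ▸ hc1))
      refine hL c s m hsc (hb c hc1 ?_) ?_
      · rw [abs_lt]; constructor <;> linarith [hc2.2]
      · intro t ht
        by_contra hcon
        have : c ≤ t := csInf_le hA.bddBelow ⟨hcon, ht.1, ht.2.le.trans hc2.2⟩
        linarith [ht.2]
    · exact absurd (h ▸ k₀.2) hsK
    · set A := K ∩ Set.Icc k₀.1 s
      have hA : IsCompact A := isCompact_Icc.inter_left hKc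
      have hAn : A.Nonempty := ⟨k₀.1, k₀.2, le_rfl, h.le⟩
      obtain ⟨hc1, hc2⟩ := hA.sSup_mem hAn
      set c := sSup A
      have hsc : c < s := lt_of_le_of_ne hc2.2 (fun h => hsK (h ▸ hc1))
      refine hR c s m hsc (hb c hc1 ?_) ?_
      · rw [abs_lt]; constructor <;> linarith [hc2.1]
      · intro t ht
        by_contra hcon
        have : t ≤ c := le_csSup hA.bddAbove ⟨hcon, hc2.1.trans ht.1.le, ht.2⟩
        linarith [ht.1]
  refine bdd_of_locBdd (fun s _ => ?_)
  by_contra hcon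
  have : s ∈ K := hcon
  rw [hKe] at this
  exact this

lemma nrm_lsc {q : ℝ → Rn n → ℂ} (hm : ∀ s, MemLp (q s) 2 volume)
    (hc : ∀ x, Continuous fun s => q s x) : LowerSemicontinuous fun s => nrm (q s) := by
  rw [lowerSemicontinuous_iff_isClosed_preimage]
  intro M
  apply IsSeqClosed.isClosed
  intro s s₀ hs hlim
  exact (memLp_nrm_of_tendsto (F := fun k => q (s k)) (fun k => hm _) hs (hm s₀).1
    (Eventually.of_forall fun x => ((hc x).tendsto s₀).comp hlim)).2

lemma Sol.locbdd {γ ε C : ℝ} (hε : 0 < ε) (H : HardyC n γ C) {u : ℝ → Rn n → ℂ} (S : Sol γ ε u)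
    (a b : ℝ) : ∃ M, 0 ≤ M ∧ ∀ s ∈ Set.Icc a b, Nn (u s) ≤ M := by
  obtain ⟨K, hK0, hK⟩ := exists_Nn_le_EE n hε
  have hlsc : LowerSemicontinuous fun s => Nn (u s) := by
    unfold Nn H1n
    refine LowerSemicontinuous.add (LowerSemicontinuous.add (nrm_lsc (fun s => (S.h1 s).mem)
      (fun x => ?_)) (lowerSemicontinuous_sum fun j _ => nrm_lsc (fun s => (S.h1 s).dmem j)
      (fun x => ?_))) (nrm_lsc S.xm (fun x => ?_))
    · exact (S.jc.tslice x).continuous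
    · have := (S.jc.dj_contDiff (k := 1) j (by norm_num))
      exact (this.tslice x).continuous
    · exact continuous_const.mul (S.jc.tslice x).continuous
  obtain ⟨M, hM⟩ := baire_bdd (N := fun s => Nn (u s)) (E := fun s => EE γ ε (u s))
    (Φ := fun A => K * √A)
    (Ψ := fun M => M ^ 2 + (ε * (n * M ^ 2) + 1 / ε * M ^ 2) + C * M ^ 2 * M ^ 2)
    (fun M => lowerSemicontinuous_iff_isClosed_preimage.mp hlsc M)
    (fun s A h => (hK γ (u s)).trans (mul_le_mul_of_nonneg_left (Real.sqrt_le_sqrt h) hK0))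
    (fun s M h => H.EE_le hε (S.h1 s) h)
    (fun a b M hab h => S.energy hε H hab h) a b
  exact ⟨max M 0, le_max_right _ _, fun s hs => (hM s hs).trans (le_max_left _ _)⟩
end

section
variable {n : ℕ}

/-- the quadratic oscillation -/
def chirp (σ : ℝ) (y : Rn n) : ℂ := Complex.exp (Complex.I * ((σ * ‖y‖ ^ 2 : ℝ) : ℂ))

/-- the lens transform at fixed time -/
def Lens (m c σ : ℝ) (φ : Rn n → ℂ) (y : Rn n) : ℂ := (m : ℂ) * φ (c • y) * chirp σ y

lemma norm_chirp (σ : ℝ) (y : Rn n) : ‖chirp σ y‖ = 1 := by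
  unfold chirp; rw [mul_comm]; exact Complex.norm_exp_ofReal_mul_I _

lemma chirp_contDiff {k : WithTop ℕ∞} {σ : ℝ → ℝ} (hσ : ContDiff ℝ k σ) :
    JC k (fun s => chirp (n := n) (σ s)) := by
  unfold JC chirp
  refine ContDiff.cexp (contDiff_const.mul (Complex.ofRealCLM.contDiff.comp ?_))
  exact (hσ.comp contDiff_fst).mul ((contDiff_norm_sq ℝ).comp contDiff_snd)

lemma chirp_diff (σ : ℝ) : Differentiable ℝ (chirp (n := n) σ) :=
  ((chirp_contDiff (n := n) (k := 1) (contDiff_const (c := σ))).slice 0).differentiable (by norm_num)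

lemma dj_chirp (j : Fin n) (σ : ℝ) :
    dj j (chirp (n := n) σ) = fun y => Complex.I * ((2 * σ * y j : ℝ) : ℂ) * chirp σ y := by
  ext y
  have h1 : HasFDerivAt (fun y : Rn n => σ * ‖y‖ ^ 2) (σ • (2 • innerSL ℝ y)) y :=
    (hasStrictFDerivAt_norm_sq y).hasFDerivAt.const_mul σ
  have h2 := (Complex.ofRealCLM.hasFDerivAt.comp y h1).const_mul Complex.I
  have h3 := h2.cexp
  unfold dj
  have h4 : fderiv ℝ (chirp σ) y = _ := h3.fderiv
  rw [h4]
  simp [chirp, EuclideanSpace.inner_single_right]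
  ring

lemma dj_scale (j : Fin n) (c : ℝ) {φ : Rn n → ℂ} (h : Differentiable ℝ φ) :
    dj j (fun y => φ (c • y)) = fun y => (c : ℂ) * dj j φ (c • y) := by
  ext y
  have h1 : HasFDerivAt (fun y : Rn n => c • y) (c • ContinuousLinearMap.id ℝ (Rn n)) y :=
    (hasFDerivAt_id y).const_smul c
  have h2 := HasFDerivAt.comp y (h (c • y)).hasFDerivAt h1
  unfold dj
  have h4 : fderiv ℝ (fun y => φ (c • y)) y = _ := h2.fderiv
  rw [h4]
  simp

lemma scale_contDiff {k : WithTop ℕ∞} {φ : Rn n → ℂ} (c : ℝ) (h : ContDiff ℝ k φ) :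
    ContDiff ℝ k (fun y => φ (c • y)) := h.comp (contDiff_id.const_smul c)

lemma Lens_contDiff {k : WithTop ℕ∞} {φ : Rn n → ℂ} (m c σ : ℝ) (h : ContDiff ℝ k φ) :
    ContDiff ℝ k (Lens m c σ φ) :=
  (contDiff_const.mul (scale_contDiff c h)).mul
    ((chirp_contDiff (n := n) (k := k) (contDiff_const (c := σ))).slice 0)

lemma dj_Lens (j : Fin n) (m c σ : ℝ) {φ : Rn n → ℂ} (h : Differentiable ℝ φ) :
    dj j (Lens m c σ φ) = fun y => (c : ℂ) * Lens m c σ (dj j φ) y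
      + Complex.I * ((2 * σ : ℝ) : ℂ) * (((y j : ℝ) : ℂ) * Lens m c σ φ y) := by
  have hs : Differentiable ℝ (fun y => φ (c • y)) :=
    h.comp (differentiable_id.const_smul c)
  have h1 : Lens m c σ φ = fun y => (fun y => (m : ℂ) * φ (c • y)) y * chirp σ y := rfl
  rw [h1, dj_mul (hs.const_mul _) (chirp_diff σ), dj_const_mul _ hs, dj_scale j c h, dj_chirp]
  ext y
  simp only [Lens]
  push_cast
  ring

lemma coord_diff (j : Fin n) : Differentiable ℝ (fun y : Rn n => ((y j : ℝ) : ℂ)) :=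
  (Complex.ofRealCLM.comp (EuclideanSpace.proj (𝕜 := ℝ) j)).differentiable

lemma dj_coord (j k : Fin n) :
    dj j (fun y : Rn n => ((y k : ℝ) : ℂ)) = fun _ => if j = k then 1 else 0 := by
  ext y
  unfold dj
  have h4 : fderiv ℝ (fun y : Rn n => ((y k : ℝ) : ℂ)) y = _ :=
    (Complex.ofRealCLM.comp (EuclideanSpace.proj (𝕜 := ℝ) k)).fderiv
  rw [h4]
  by_cases h : j = k
  · simp [h]
  · simp [h, Ne.symm h]

lemma dj_dj_Lens (j : Fin n) (m c σ : ℝ) {φ : Rn n → ℂ} (h : ContDiff ℝ 2 φ) (y : Rn n) :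
    dj j (dj j (Lens m c σ φ)) y = (c : ℂ) ^ 2 * Lens m c σ (dj j (dj j φ)) y
      + 4 * Complex.I * σ * c * (((y j : ℝ) : ℂ) * Lens m c σ (dj j φ) y)
      + 2 * Complex.I * σ * Lens m c σ φ y - 4 * (σ : ℂ) ^ 2 * ((y j : ℝ) : ℂ) ^ 2 * Lens m c σ φ y := by
  have hd : Differentiable ℝ φ := h.differentiable (by norm_num)
  have hdj : ContDiff ℝ 1 (dj j φ) := dj_contDiff h (by norm_num)
  have hdd : Differentiable ℝ (dj j φ) := hdj.differentiable (by norm_num)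
  have e1 : Differentiable ℝ (Lens m c σ (dj j φ)) := (Lens_contDiff m c σ hdj).differentiable (by norm_num)
  have e2 : Differentiable ℝ (Lens m c σ φ) := (Lens_contDiff m c σ h).differentiable (by norm_num)
  have e3 : Differentiable ℝ (fun y : Rn n => ((y j : ℝ) : ℂ) * Lens m c σ φ y) := (coord_diff j).mul e2
  rw [dj_Lens j m c σ hd, dj_add (e1.const_mul _) (e3.const_mul _), dj_const_mul _ e1,
    dj_const_mul _ e3, dj_mul (coord_diff j) e2, dj_Lens j m c σ hd, dj_Lens j m c σ hdd, dj_coord]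
  simp only [if_true]
  push_cast
  linear_combination (4 * (σ:ℂ)^2 * ((y j : ℝ) : ℂ) ^ 2 * Lens m c σ φ y) * Complex.I_sq

lemma sum_coord_sq (y : Rn n) : ∑ j, ((y j : ℝ) : ℂ) ^ 2 = ((‖y‖ ^ 2 : ℝ) : ℂ) := by
  rw [EuclideanSpace.real_norm_sq_eq]; push_cast; rfl

lemma Lens_sum (m c σ : ℝ) (φ : Fin n → Rn n → ℂ) (y : Rn n) :
    ∑ j, Lens m c σ (φ j) y = Lens m c σ (fun x => ∑ j, φ j x) y := by
  simp only [Lens, Finset.mul_sum, Finset.sum_mul]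

lemma lap_Lens (m c σ : ℝ) {φ : Rn n → ℂ} (h : ContDiff ℝ 2 φ) (y : Rn n) :
    lap (Lens m c σ φ) y = (c : ℂ) ^ 2 * Lens m c σ (lap φ) y
      + 4 * Complex.I * σ * c * (∑ j, ((y j : ℝ) : ℂ) * Lens m c σ (dj j φ) y)
      + 2 * Complex.I * σ * n * Lens m c σ φ y
      - 4 * (σ : ℂ) ^ 2 * ((‖y‖ ^ 2 : ℝ) : ℂ) * Lens m c σ φ y := by
  rw [lap_eq, lap_eq, ← Lens_sum, ← sum_coord_sq]
  simp only [dj_dj_Lens _ m c σ h, Finset.sum_add_distrib, Finset.sum_sub_distrib, ← Finset.mul_sum,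
    ← Finset.sum_mul, Finset.sum_const, Finset.card_univ, Fintype.card_fin, nsmul_eq_mul]
  ring

/-- L² scaling -/
lemma nrm_Lens {m c : ℝ} (hc : 0 < c) (hm0 : 0 ≤ m) (hm : m ^ 2 = c ^ n) (σ : ℝ) {φ : Rn n → ℂ}
    (h : MemLp φ 2 volume) (hφ : Continuous φ) :
    MemLp (Lens m c σ φ) 2 volume ∧ nrm (Lens m c σ φ) = nrm φ := by
  have hcont : Continuous (Lens m c σ φ) := (Lens_contDiff (k := 0) m c σ (contDiff_zero.mpr hφ)).continuous
  have hn : ∀ y, ‖Lens m c σ φ y‖ ^ 2 = c ^ n * (fun x => ‖φ x‖ ^ 2) (c • y) := by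
    intro y
    simp only [Lens, norm_mul, norm_chirp, Complex.norm_real, Real.norm_of_nonneg hm0, mul_one, mul_pow,
      hm]
  have hM : MemLp (Lens m c σ φ) 2 volume := by
    rw [memLp_two_iff_integrable_sq_norm hcont.aestronglyMeasurable]
    simp only [hn]
    exact ((memLp_sq_integrable h).comp_smul hc.ne').const_mul _
  refine ⟨hM, ?_⟩
  rw [nrm_eq_sqrt hM, nrm_eq_sqrt h]
  congr 1
  simp only [hn]
  have hI := Measure.integral_comp_smul_of_nonneg volume (fun x => ‖φ x‖ ^ 2) c (hR := hc.le)
  simp only [finrank_euclideanSpace, Fintype.card_fin, smul_eq_mul] at hI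
  rw [integral_const_mul, hI]
  have := (pow_pos hc n).ne'
  field_simp

/-- Hartree scaling -/
lemma hartree_Lens {m c : ℝ} (hc : 0 < c) (hm0 : 0 ≤ m) (hm : m ^ 2 = c ^ n) (γ σ : ℝ) (φ : Rn n → ℂ)
    (y : Rn n) : hartree γ (Lens m c σ φ) y = c ^ γ * hartree γ φ (c • y) := by
  have h2 : ∀ z : Rn n, ‖y - z‖ ^ (-γ) * Complex.normSq (Lens m c σ φ z)
      = (c ^ n * c ^ γ) * (fun w => ‖c • y - w‖ ^ (-γ) * Complex.normSq (φ w)) (c • z) := by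
    intro z
    simp only [← smul_sub, norm_smul, Real.norm_of_nonneg hc.le]
    rw [Real.mul_rpow hc.le (norm_nonneg _), Real.rpow_neg hc.le, Complex.normSq_eq_norm_sq,
      Complex.normSq_eq_norm_sq]
    simp only [Lens, norm_mul, norm_chirp, Complex.norm_real, Real.norm_of_nonneg hm0, mul_one, mul_pow,
      hm]
    have : c ^ γ ≠ 0 := (Real.rpow_pos_of_pos hc γ).ne'
    field_simp
  unfold hartree conv
  simp only [h2]
  have hI := Measure.integral_comp_smul_of_nonneg volume (fun w => ‖c • y - w‖ ^ (-γ) * Complex.normSq (φ w)) c (hR := hc.le)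
  simp only [finrank_euclideanSpace, Fintype.card_fin, smul_eq_mul] at hI
  rw [integral_const_mul, hI]
  have := (pow_pos hc n).ne'
  field_simp

lemma xw_Lens {m c : ℝ} (hc : 0 < c) (σ : ℝ) (φ : Rn n → ℂ) :
    xw (Lens m c σ φ) = fun y => ((c⁻¹ : ℝ) : ℂ) * Lens m c σ (xw φ) y := by
  ext y
  simp only [xw, Lens, norm_smul, Real.norm_of_nonneg hc.le]
  have : (c : ℂ) ≠ 0 := by exact_mod_cast hc.ne'
  push_cast
  field_simp
end


/-- cosine in the new time -/
def cc (s : ℝ) : ℝ := (√(1 + s ^ 2))⁻¹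

/-- amplitude in the new time -/
def mm (n : ℕ) (s : ℝ) : ℝ := cc s ^ ((n : ℝ) / 2)

/-- phase coefficient -/
def ss (ε s : ℝ) : ℝ := s * cc s ^ 2 / (2 * ε)

/-- coupling in the new time -/
def bet (γ s : ℝ) : ℝ := cc s ^ (2 - γ)

/-- the lens transform -/
def lensv {n : ℕ} (ε : ℝ) (u : ℝ → Rn n → ℂ) (s : ℝ) : Rn n → ℂ :=
  Lens (mm n s) (cc s) (ss ε s) (u (Real.arctan s))

section
variable {n : ℕ}

lemma one_add_sq_pos (s : ℝ) : 0 < 1 + s ^ 2 := by positivity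
lemma cc_pos (s : ℝ) : 0 < cc s := inv_pos.mpr (Real.sqrt_pos.mpr (one_add_sq_pos s))
lemma cc_sq (s : ℝ) : cc s ^ 2 * (1 + s ^ 2) = 1 := by
  unfold cc
  rw [inv_pow, Real.sq_sqrt (one_add_sq_pos s).le]
  exact inv_mul_cancel₀ (one_add_sq_pos s).ne'
lemma cc_le_one (s : ℝ) : cc s ≤ 1 := by
  have := cc_sq s
  nlinarith [cc_pos s, sq_nonneg (cc s * s)]
lemma cc_contDiff (k : WithTop ℕ∞) : ContDiff ℝ k cc := by
  unfold cc
  refine ContDiff.inv (ContDiff.sqrt (by fun_prop) (fun s => (one_add_sq_pos s).ne')) (fun s => ?_)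
  exact (Real.sqrt_pos.mpr (one_add_sq_pos s)).ne'
lemma cc_hasDerivAt (s : ℝ) : HasDerivAt cc (-s * cc s ^ 3) s := by
  have h1 : HasDerivAt (fun s : ℝ => 1 + s ^ 2) (2 * s) s := by
    simpa using ((hasDerivAt_id s).pow 2).const_add 1
  have h2 := (h1.sqrt (one_add_sq_pos s).ne').inv (Real.sqrt_pos.mpr (one_add_sq_pos s)).ne'
  refine h2.congr_deriv ?_
  unfold cc
  have := (Real.sqrt_pos.mpr (one_add_sq_pos s)).ne'
  field_simp
lemma rpow_cc_contDiff (k : WithTop ℕ∞) (p : ℝ) : ContDiff ℝ k (fun s => cc s ^ p) :=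
  (cc_contDiff k).rpow_const_of_ne (fun s => (cc_pos s).ne')
lemma bet_nonneg (γ s : ℝ) : 0 ≤ bet γ s := Real.rpow_nonneg (cc_pos s).le _
lemma bet_le_one {γ : ℝ} (hγ : γ < 1) (s : ℝ) : bet γ s ≤ 1 :=
  Real.rpow_le_one (cc_pos s).le (cc_le_one s) (by linarith)
lemma bet_eq (γ s : ℝ) : bet γ s * cc s ^ γ = cc s ^ 2 := by
  unfold bet
  rw [← Real.rpow_add (cc_pos s), show (2 - γ + γ : ℝ) = ((2 : ℕ) : ℝ) by norm_num, Real.rpow_natCast]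
lemma mm_nonneg (s : ℝ) : 0 ≤ mm n s := Real.rpow_nonneg (cc_pos s).le _
lemma mm_sq (s : ℝ) : mm n s ^ 2 = cc s ^ n := by
  unfold mm
  rw [← Real.rpow_natCast, ← Real.rpow_mul (cc_pos s).le, ← Real.rpow_natCast]
  congr 1; push_cast; ring
lemma mm_hasDerivAt (s : ℝ) : HasDerivAt (mm n) (-(n / 2) * s * cc s ^ 2 * mm n s) s := by
  have h := (cc_hasDerivAt s).rpow_const (p := (n : ℝ) / 2) (Or.inl (cc_pos s).ne')
  refine h.congr_deriv ?_
  unfold mm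
  rw [Real.rpow_sub_one (cc_pos s).ne']
  have := (cc_pos s).ne'
  field_simp
lemma ss_contDiff (k : WithTop ℕ∞) (ε : ℝ) : ContDiff ℝ k (ss ε) := by
  unfold ss
  exact (contDiff_id.mul ((cc_contDiff k).pow 2)).div_const _
lemma ss_hasDerivAt (ε s : ℝ) :
    HasDerivAt (ss ε) ((cc s ^ 2 - 2 * s ^ 2 * cc s ^ 4) / (2 * ε)) s := by
  have h := (((hasDerivAt_id s).mul ((cc_hasDerivAt s).pow 2)).div_const (2 * ε))
  refine h.congr_deriv ?_
  simp
  ring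
lemma cos_arctan_cc (s : ℝ) : Real.cos (Real.arctan s) = cc s := by
  rw [Real.cos_arctan, cc, one_div]

lemma sum_coord_single (y : Rn n) : ∑ j, y j • (EuclideanSpace.single j (1 : ℝ) : Rn n) = y := by
  have := (EuclideanSpace.basisFun (Fin n) ℝ).sum_repr y
  simpa using this

lemma dt_lensv {ε : ℝ} {u : ℝ → Rn n → ℂ} (hu : JC 1 u) (s : ℝ) (y : Rn n) :
    dt (lensv ε u) s y = ((-(n / 2) * s * cc s ^ 2 : ℝ) : ℂ) * lensv ε u s y
      + ((cc s ^ 2 : ℝ) : ℂ) * Lens (mm n s) (cc s) (ss ε s) (dt u (Real.arctan s)) y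
      + ((-s * cc s ^ 3 : ℝ) : ℂ) * (∑ j, ((y j : ℝ) : ℂ) *
          Lens (mm n s) (cc s) (ss ε s) (dj j (u (Real.arctan s))) y)
      + Complex.I * (((cc s ^ 2 - 2 * s ^ 2 * cc s ^ 4) / (2 * ε) * ‖y‖ ^ 2 : ℝ) : ℂ)
          * lensv ε u s y := by
  have hT : HasDerivAt Real.arctan (cc s ^ 2) s := by
    have := Real.hasDerivAt_arctan s
    refine this.congr_deriv ?_
    have h := cc_sq s
    have h2 := (one_add_sq_pos s).ne'
    field_simp
    linarith
  have hP : HasDerivAt (fun s => (Real.arctan s, cc s • y)) (cc s ^ 2, (-s * cc s ^ 3) • y) s :=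
    hT.prodMk ((cc_hasDerivAt s).smul_const y)
  have hU := ((ContDiff.differentiable hu (by norm_num)) (Real.arctan s, cc s • y)).hasFDerivAt.comp_hasDerivAt s hP
  have hm := (mm_hasDerivAt (n := n) s).ofReal_comp
  have hs : HasDerivAt (fun s => ss ε s * ‖y‖ ^ 2) _ s := (ss_hasDerivAt ε s).mul_const (‖y‖ ^ 2)
  have hE := (hs.ofReal_comp.const_mul Complex.I).cexp
  have h := (hm.mul hU).mul hE
  have hval : (fderiv ℝ (fun p : ℝ × Rn n => u p.1 p.2) (Real.arctan s, cc s • y))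
      (cc s ^ 2, (-s * cc s ^ 3) • y) = ((cc s ^ 2 : ℝ) : ℂ) * dt u (Real.arctan s) (cc s • y)
        + ((-s * cc s ^ 3 : ℝ) : ℂ) * ∑ j, ((y j : ℝ) : ℂ) * dj j (u (Real.arctan s)) (cc s • y) := by
    rw [dt_eq hu]
    simp only [dj_slice_eq hu]
    have : ((cc s ^ 2, (-s * cc s ^ 3) • y) : ℝ × Rn n) = (cc s ^ 2) • ((1 : ℝ), (0 : Rn n))
        + (-s * cc s ^ 3) • ∑ j, y j • ((0 : ℝ), (EuclideanSpace.single j (1 : ℝ) : Rn n)) := by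
      ext1
      · simp [Prod.fst_sum]
      · simp only [Prod.smul_mk, Prod.snd_add, Prod.smul_snd, Prod.snd_sum]
        simp only [smul_zero, zero_add]
        rw [sum_coord_single]
    rw [this, map_add, map_smul, map_smul, map_sum]
    simp only [map_smul, Complex.real_smul]
  have h' : dt (lensv ε u) s y = _ := HasDerivAt.deriv h
  rw [h', hval]
  have hS : ∑ j, ((y j : ℝ) : ℂ) * Lens (mm n s) (cc s) (ss ε s) (dj j (u (Real.arctan s))) y
      = (mm n s : ℂ) * (∑ j, ((y j : ℝ) : ℂ) * dj j (u (Real.arctan s)) (cc s • y)) * chirp (ss ε s) y := by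
    rw [Finset.mul_sum, Finset.sum_mul]
    refine Finset.sum_congr rfl fun j _ => ?_
    simp only [Lens]; ring
  rw [hS]
  simp only [lensv, Lens, chirp, Function.comp, Pi.mul_apply]
  push_cast
  ring

/-- the transformed equation -/
structure VSol {n : ℕ} (γ ε : ℝ) (v : ℝ → Rn n → ℂ) : Prop where
  jc : JC 2 v
  h1 : ∀ s, IsH1 (v s)
  xm : ∀ s, MemLp (xw (v s)) 2 volume
  eq : ∀ s x, FF ε v s x = ((bet γ s * hartree γ (v s) x : ℝ) : ℂ) * v s x
  bdd : ∀ a b, ∃ M, 0 ≤ M ∧ ∀ s ∈ Set.Icc a b, Nn (v s) ≤ M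

lemma lensv_eq {γ ε : ℝ} (hε : 0 < ε) {u : ℝ → Rn n → ℂ} (S : Sol γ ε u) (s : ℝ) (y : Rn n) :
    FF ε (lensv ε u) s y = ((bet γ s * hartree γ (lensv ε u s) y : ℝ) : ℂ) * lensv ε u s y := by
  have hj1 : JC 1 u := S.jc.of_le (by norm_num)
  have he := S.eq (Real.arctan s) (cc s • y)
  have hh : hartree γ (lensv ε u s) y = cc s ^ γ * hartree γ (u (Real.arctan s)) (cc s • y) :=
    hartree_Lens (cc_pos s) (mm_nonneg s) (mm_sq s) γ _ _ y
  rw [hh, ← mul_assoc, bet_eq]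
  unfold FF at he ⊢
  rw [dt_lensv hj1]
  have hl : lap (lensv ε u s) y = _ := lap_Lens (mm n s) (cc s) (ss ε s) (S.jc.slice (Real.arctan s)) y
  rw [hl]
  set X := ∑ j, ((y j : ℝ) : ℂ) * Lens (mm n s) (cc s) (ss ε s) (dj j (u (Real.arctan s))) y
  have e1 : Lens (mm n s) (cc s) (ss ε s) (dt u (Real.arctan s)) y
      = (mm n s : ℂ) * dt u (Real.arctan s) (cc s • y) * chirp (ss ε s) y := rfl
  have e2 : Lens (mm n s) (cc s) (ss ε s) (lap (u (Real.arctan s))) y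
      = (mm n s : ℂ) * lap (u (Real.arctan s)) (cc s • y) * chirp (ss ε s) y := rfl
  have e3 : lensv ε u s y
      = (mm n s : ℂ) * u (Real.arctan s) (cc s • y) * chirp (ss ε s) y := rfl
  have e4 : Lens (mm n s) (cc s) (ss ε s) (u (Real.arctan s)) y
      = (mm n s : ℂ) * u (Real.arctan s) (cc s • y) * chirp (ss ε s) y := rfl
  rw [e1, e2, e3, e4]
  set A := u (Real.arctan s) (cc s • y)
  set B := dt u (Real.arctan s) (cc s • y)
  set D := lap (u (Real.arctan s)) (cc s • y)
  set W := hartree γ (u (Real.arctan s)) (cc s • y)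
  set E := chirp (ss ε s) y
  have hnorm : ‖cc s • y‖ ^ 2 = cc s ^ 2 * ‖y‖ ^ 2 := by
    rw [norm_smul, Real.norm_of_nonneg (cc_pos s).le]; ring
  rw [hnorm] at he
  have hcs : (cc s : ℂ) ^ 2 * (1 + (s : ℂ) ^ 2) = 1 := by exact_mod_cast cc_sq s
  have hεc : (ε : ℂ) ≠ 0 := by exact_mod_cast hε.ne'
  unfold ss
  push_cast at he ⊢
  have hI := Complex.I_sq
  have key : (cc s : ℂ) ^ 2 * s ^ 2 = 1 - (cc s : ℂ) ^ 2 := by linear_combination hcs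
  generalize (cc s : ℂ) = c at *
  generalize (s : ℂ) = σ at *
  generalize (mm n s : ℂ) = m at *
  generalize ((‖y‖ : ℝ) : ℂ) = Y at *
  field_simp at he ⊢
  linear_combination (4 * c ^ 2 * m * E) * he + (m * E * A * Y ^ 2 * (4 * c ^ 2 - 8 * c ^ 4 * σ ^ 2)) * hI
    + (4 * c ^ 2 * m * E * A * Y ^ 2) * key

lemma abs_coord_Lens_le (j : Fin n) (φ : Rn n → ℂ) (y : Rn n) :
    ‖((y j : ℝ) : ℂ) * φ y‖ ≤ ‖xw φ y‖ := by
  simp only [xw, norm_mul, Complex.norm_real, norm_norm]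
  exact mul_le_mul_of_nonneg_right (coord_le_norm y j) (norm_nonneg _)

lemma coord_mul_mem (j : Fin n) {φ : Rn n → ℂ} (hc : Continuous φ) (h : MemLp (xw φ) 2 volume) :
    MemLp (fun y => ((y j : ℝ) : ℂ) * φ y) 2 volume ∧
      nrm (fun y => ((y j : ℝ) : ℂ) * φ y) ≤ nrm (xw φ) :=
  nrm_mono h ((coord_diff j).continuous.mul hc).aestronglyMeasurable (abs_coord_Lens_le j φ)

lemma lensv_vsol {γ ε C : ℝ} (hε : 0 < ε) (H : HardyC n γ C) {u : ℝ → Rn n → ℂ} (S : Sol γ ε u) :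
    VSol γ ε (lensv ε u) := by
  have hx : ∀ s, MemLp (xw (lensv ε u s)) 2 volume ∧
      nrm (xw (lensv ε u s)) = (cc s)⁻¹ * nrm (xw (u (Real.arctan s))) := by
    intro s
    have hcx : Continuous (xw (u (Real.arctan s))) :=
      (Complex.continuous_ofReal.comp continuous_norm).mul (S.jc.slice _).continuous
    have h := nrm_Lens (cc_pos s) (mm_nonneg (n := n) s) (mm_sq s) (ss ε s) (S.xm (Real.arctan s)) hcx
    unfold lensv
    rw [xw_Lens (cc_pos s), nrm_const_mul, h.2, Complex.norm_real,
      Real.norm_of_nonneg (inv_nonneg.mpr (cc_pos s).le)]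
    exact ⟨h.1.const_mul _, rfl⟩
  have hm : ∀ s, MemLp (lensv ε u s) 2 volume ∧ nrm (lensv ε u s) = nrm (u (Real.arctan s)) := fun s =>
    nrm_Lens (cc_pos s) (mm_nonneg (n := n) s) (mm_sq s) (ss ε s) (S.h1 _).mem (S.jc.slice _).continuous
  have hjc : JC 2 (lensv ε u) := by
    have h1 : ContDiff ℝ 2 (fun p : ℝ × Rn n => ((mm n p.1 : ℝ) : ℂ)) :=
      Complex.ofRealCLM.contDiff.comp ((rpow_cc_contDiff 2 _).comp contDiff_fst)
    have h2 : ContDiff ℝ 2 (fun p : ℝ × Rn n => u (Real.arctan p.1) (cc p.1 • p.2)) := by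
      refine ContDiff.comp (g := fun p : ℝ × Rn n => u p.1 p.2) S.jc (ContDiff.prodMk ?_ ?_)
      · exact Real.contDiff_arctan.comp contDiff_fst
      · exact ((cc_contDiff 2).comp contDiff_fst).smul contDiff_snd
    exact (h1.mul h2).mul (chirp_contDiff (ss_contDiff 2 ε))
  have hd : ∀ s j, MemLp (dj j (lensv ε u s)) 2 volume ∧ nrm (dj j (lensv ε u s))
      ≤ cc s * nrm (dj j (u (Real.arctan s))) + |2 * ss ε s| * nrm (xw (lensv ε u s)) := by
    intro s j
    have hdc : Continuous (dj j (u (Real.arctan s))) :=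
      (dj_contDiff (k := 1) (S.jc.slice _) (by norm_num)).continuous
    have h := nrm_Lens (cc_pos s) (mm_nonneg (n := n) s) (mm_sq s) (ss ε s) ((S.h1 (Real.arctan s)).dmem j) hdc
    have h2 := coord_mul_mem j (hjc.slice s).continuous (hx s).1
    have e : dj j (lensv ε u s) = _ := dj_Lens j (mm n s) (cc s) (ss ε s)
      ((S.jc.slice (Real.arctan s)).differentiable (by norm_num))
    rw [e]
    refine ⟨(h.1.const_mul _).add (h2.1.const_mul _), ?_⟩
    refine (nrm_add_le (h.1.const_mul _)).trans (add_le_add ?_ ?_)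
    · rw [nrm_const_mul, h.2, Complex.norm_real, Real.norm_of_nonneg (cc_pos s).le]
    · have := nrm_const_mul (n := n) (Complex.I * ((2 * ss ε s : ℝ) : ℂ))
        (fun y => ((y j : ℝ) : ℂ) * lensv ε u s y)
      refine this.le.trans ?_
      rw [norm_mul, Complex.norm_I, one_mul, Complex.norm_real, Real.norm_eq_abs]
      exact mul_le_mul_of_nonneg_left h2.2 (abs_nonneg _)
  refine ⟨hjc, fun s => ⟨(hjc.slice s).of_le (by norm_num), (hm s).1, fun j => (hd s j).1⟩,
    fun s => (hx s).1, lensv_eq hε S, ?_⟩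
  intro a b
  obtain ⟨M, hM0, hM⟩ := S.locbdd hε H (Real.arctan a) (Real.arctan b)
  have hcont : ContinuousOn (fun s => (M + ∑ _j : Fin n, (cc s * M + |2 * ss ε s| * ((cc s)⁻¹ * M)))
      + (cc s)⁻¹ * M) (Set.Icc a b) := by
    have h1 : Continuous cc := (cc_contDiff 0).continuous
    have h2 : Continuous (ss ε) := (ss_contDiff 0 ε).continuous
    have h3 : Continuous fun s => (cc s)⁻¹ := h1.inv₀ (fun s => (cc_pos s).ne')
    apply Continuous.continuousOn
    fun_prop
  obtain ⟨K, hK⟩ := (isCompact_Icc.bddAbove_image hcont)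
  refine ⟨max K 0, le_max_right _ _, fun s hs => le_trans ?_ (le_max_left _ _)⟩
  have hK' := hK (Set.mem_image_of_mem _ hs)
  refine le_trans ?_ hK'
  have hMs := hM (Real.arctan s) ⟨Real.arctan_mono hs.1, Real.arctan_mono hs.2⟩
  have hxs : nrm (xw (lensv ε u s)) ≤ (cc s)⁻¹ * M := by
    rw [(hx s).2]
    exact mul_le_mul_of_nonneg_left ((nrm_xw_le_Nn _).trans hMs) (inv_nonneg.mpr (cc_pos s).le)
  unfold Nn H1n
  refine add_le_add (add_le_add ?_ (Finset.sum_le_sum fun j _ => (hd s j).2.trans (add_le_add ?_ ?_))) hxs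
  · rw [(hm s).2]; exact (nrm_le_Nn _).trans hMs
  · exact mul_le_mul_of_nonneg_left ((nrm_dj_le_H1n _ j).trans ((H1n_le_Nn _).trans hMs)) (cc_pos s).le
  · exact mul_le_mul_of_nonneg_left hxs (abs_nonneg _)

lemma sol_of_isSolutionH {γ ε : ℝ} (hε : 0 < ε) {f : Rn n → ℂ} {u : ℝ → Rn n → ℂ}
    (S : IsSolutionH n 1 γ ε f u) : Sol γ ε u := by
  refine ⟨S.smooth.of_le (WithTop.coe_le_coe.mpr (le_top : (2 : ℕ∞) ≤ ⊤)), S.schwartz, fun s x => ?_⟩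
  have h := S.eq s x
  unfold FF dt
  rw [Real.rpow_one] at h
  have hεc : (ε : ℂ) ≠ 0 := by exact_mod_cast hε.ne'
  push_cast at h ⊢
  have : (ε : ℂ) * (Complex.I * deriv (fun σ => u σ x) s + (ε : ℂ) / 2 * lap (u s) x)
      = (ε : ℂ) * (((‖x‖ : ℂ) ^ 2 / (2 * ε) + hartree γ (u s) x) * u s x) := by
    field_simp
    field_simp at h
    linear_combination h
  exact mul_left_cancel₀ hεc this
end

section
variable {n : ℕ}

lemma chi_isH1 {R : ℝ} (hR : 0 < R) : IsH1 (chi n R) := by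
  have hc : ContDiff ℝ 2 (chi n R) := chi_contDiff R 2
  refine ⟨hc.of_le (by norm_num), hc.continuous.memLp_of_hasCompactSupport (chi_compact hR), fun j => ?_⟩
  refine (dj_contDiff (k := 1) hc (by norm_num)).continuous.memLp_of_hasCompactSupport ?_
  exact (chi_compact hR).fderiv_apply (𝕜 := ℝ) _

/-- local part of the kernel -/
lemma HardyC.ker_int {γ C : ℝ} (H : HardyC n γ C) :
    Integrable (fun y : Rn n => ‖y‖ ^ (-γ) * (‖chi n 1 y‖ * ‖chi n 1 y‖)) := by
  have := (H.2 (chi n 1) (chi n 1) (chi_isH1 one_pos).mem (chi_isH1 one_pos) 0).1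
  simpa using this

lemma ker_le {γ : ℝ} (hγ0 : 0 < γ) (y : Rn n) :
    ‖y‖ ^ (-γ) ≤ ‖y‖ ^ (-γ) * (‖chi n 1 y‖ * ‖chi n 1 y‖) + 1 := by
  rcases le_total ‖y‖ 1 with h | h
  · rw [chi_eq_one one_pos h]; simp
  · have h1 : ‖y‖ ^ (-γ) ≤ 1 := Real.rpow_le_one_of_one_le_of_nonpos h (by linarith)
    have : 0 ≤ ‖y‖ ^ (-γ) * (‖chi n 1 y‖ * ‖chi n 1 y‖) := by positivity
    linarith

/-- Japanese bracket decay -/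
def jap (y : Rn n) : ℝ := (1 + ‖y‖) ^ (-((n : ℝ) + 1))

lemma jap_int : Integrable (jap (n := n)) := by
  refine integrable_one_add_norm ?_
  simp

lemma jap_le_one (y : Rn n) : jap y ≤ 1 :=
  Real.rpow_le_one_of_one_le_of_nonpos (by linarith [norm_nonneg y])
    (by have : (0:ℝ) ≤ n := n.cast_nonneg
        linarith)

lemma jap_nonneg (y : Rn n) : 0 ≤ jap y := by unfold jap; positivity

variable {E : Type} [NormedAddCommGroup E] [NormedSpace ℝ E]

lemma schwartz_jap (φ : SchwartzMap (Rn n) E) : ∃ A, 0 ≤ A ∧ ∀ y, ‖φ y‖ ≤ A * jap y := by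
  refine ⟨2 ^ (n + 1) * (Finset.Iic (n + 1, 0)).sup (fun m => SchwartzMap.seminorm ℝ m.1 m.2) φ,
    by positivity, fun y => ?_⟩
  have h := SchwartzMap.one_add_le_sup_seminorm_apply (𝕜 := ℝ) (m := (n + 1, 0)) le_rfl le_rfl φ y
  simp only [norm_iteratedFDeriv_zero] at h
  have hp : (0:ℝ) < (1 + ‖y‖) ^ (n + 1) := by positivity
  have hj : jap y = ((1 + ‖y‖) ^ (n + 1))⁻¹ := by
    unfold jap
    rw [Real.rpow_neg (by positivity), ← Real.rpow_natCast]; push_cast; rfl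
  rw [hj, ← div_eq_mul_inv, le_div_iff₀ hp]
  linarith

lemma jap_shift {x x₀ z : Rn n} (h : ‖x - x₀‖ ≤ 1) :
    jap (x - z) ≤ 2 ^ ((n : ℝ) + 1) * jap (x₀ - z) := by
  unfold jap
  have h1 : ‖x₀ - z‖ ≤ ‖x - z‖ + 1 := by
    have : x₀ - z = (x - z) - (x - x₀) := by abel
    rw [this]; exact (norm_sub_le _ _).trans (by linarith)
  have h2 : (1 + ‖x₀ - z‖) / 2 ≤ 1 + ‖x - z‖ := by linarith [norm_nonneg (x - z)]
  have hn : -((n:ℝ) + 1) ≤ 0 := by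
    have : (0:ℝ) ≤ n := n.cast_nonneg
    linarith
  calc (1 + ‖x - z‖) ^ (-((n:ℝ) + 1)) ≤ ((1 + ‖x₀ - z‖) / 2) ^ (-((n:ℝ) + 1)) :=
        Real.rpow_le_rpow_of_nonpos (by positivity) h2 hn
    _ = _ := by
        rw [Real.div_rpow (by positivity) (by norm_num), Real.rpow_neg (by norm_num : (0:ℝ) ≤ 2)]
        field_simp

/-- vector-valued convolution with the kernel -/
def convE (γ : ℝ) (φ : Rn n → E) (x : Rn n) : E := ∫ z : Rn n, ‖z‖ ^ (-γ) • φ (x - z)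

/-- the integrable dominating function -/
def kdom (γ : ℝ) (x z : Rn n) : ℝ := ‖z‖ ^ (-γ) * (‖chi n 1 z‖ * ‖chi n 1 z‖) + jap (x - z)

lemma HardyC.kdom_int {γ C : ℝ} (H : HardyC n γ C) (x : Rn n) : Integrable (kdom γ x) :=
  H.ker_int.add (jap_int.comp_sub_left x)

lemma ker_jap_le {γ : ℝ} (hγ0 : 0 < γ) (x z : Rn n) : ‖z‖ ^ (-γ) * jap (x - z) ≤ kdom γ x z := by
  have h1 := mul_le_mul_of_nonneg_right (ker_le hγ0 z) (jap_nonneg (x - z))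
  have h2 : ‖z‖ ^ (-γ) * (‖chi n 1 z‖ * ‖chi n 1 z‖) * jap (x - z) ≤
      ‖z‖ ^ (-γ) * (‖chi n 1 z‖ * ‖chi n 1 z‖) :=
    mul_le_of_le_one_right (by positivity) (jap_le_one _)
  unfold kdom; nlinarith

lemma convE_meas (γ : ℝ) (φ : SchwartzMap (Rn n) E) (x : Rn n) :
    AEStronglyMeasurable (fun z : Rn n => ‖z‖ ^ (-γ) • φ (x - z)) volume := by
  have h := kernel_meas (n := n) γ 0
  simp only [zero_sub, norm_neg] at h
  exact h.aestronglyMeasurable.smul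
    (φ.continuous.comp (continuous_const.sub continuous_id)).aestronglyMeasurable

lemma ker_smul_le {γ : ℝ} (hγ0 : 0 < γ) {φ : Rn n → E} {A : ℝ} (hA : 0 ≤ A)
    (h : ∀ y, ‖φ y‖ ≤ A * jap y) (x z : Rn n) : ‖‖z‖ ^ (-γ) • φ (x - z)‖ ≤ A * kdom γ x z := by
  rw [norm_smul, Real.norm_eq_abs, abs_of_nonneg (by positivity)]
  calc _ ≤ ‖z‖ ^ (-γ) * (A * jap (x - z)) := by gcongr; exact h _
    _ = A * (‖z‖ ^ (-γ) * jap (x - z)) := by ring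
    _ ≤ _ := by gcongr; exact ker_jap_le hγ0 x z

lemma HardyC.convE_int {γ C : ℝ} (H : HardyC n γ C) (hγ0 : 0 < γ) (φ : SchwartzMap (Rn n) E)
    (x : Rn n) : Integrable (fun z : Rn n => ‖z‖ ^ (-γ) • φ (x - z)) := by
  obtain ⟨A, hA, h⟩ := schwartz_jap φ
  exact ((H.kdom_int x).const_mul A).mono' (convE_meas γ φ x)
    (Eventually.of_forall fun z => ker_smul_le hγ0 hA h x z)

lemma HardyC.convE_bdd {γ C : ℝ} (H : HardyC n γ C) (hγ0 : 0 < γ) (φ : SchwartzMap (Rn n) E) :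
    ∃ B, ∀ x, ‖convE γ φ x‖ ≤ B := by
  obtain ⟨A, hA, h⟩ := schwartz_jap φ
  refine ⟨A * ((∫ z : Rn n, ‖z‖ ^ (-γ) * (‖chi n 1 z‖ * ‖chi n 1 z‖)) + ∫ z : Rn n, jap z), fun x => ?_⟩
  calc _ ≤ ∫ z : Rn n, A * kdom γ x z :=
        norm_integral_le_of_norm_le ((H.kdom_int x).const_mul A)
          (Eventually.of_forall fun z => ker_smul_le hγ0 hA h x z)
    _ = _ := by
        rw [integral_const_mul]; congr 1
        unfold kdom
        rw [integral_add H.ker_int (jap_int.comp_sub_left x)]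
        congr 1
        exact integral_sub_left_eq_self (jap (n := n)) volume x

lemma HardyC.convE_hasFDerivAt {γ C : ℝ} (H : HardyC n γ C) (hγ0 : 0 < γ) (φ : SchwartzMap (Rn n) E)
    (x : Rn n) : HasFDerivAt (convE γ φ) (convE γ (SchwartzMap.fderivCLM ℝ (Rn n) E φ) x) x := by
  obtain ⟨A, hA, h⟩ := schwartz_jap (SchwartzMap.fderivCLM ℝ (Rn n) E φ)
  refine hasFDerivAt_integral_of_dominated_of_fderiv_le (Metric.closedBall_mem_nhds x one_pos)
    (Eventually.of_forall fun y => convE_meas γ φ y) (H.convE_int hγ0 φ x)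
    (convE_meas γ _ x) (F' := fun y z => ‖z‖ ^ (-γ) • SchwartzMap.fderivCLM ℝ (Rn n) E φ (y - z))
    (bound := fun z => A * (2 ^ ((n : ℝ) + 1) * kdom γ x z))
    (Eventually.of_forall fun z y hy => ?_) (((H.kdom_int x).const_mul _).const_mul A)
    (Eventually.of_forall fun z y hy => ?_)
  · rw [mem_closedBall_iff_norm] at hy
    rw [norm_smul, Real.norm_eq_abs, abs_of_nonneg (by positivity)]
    calc _ ≤ ‖z‖ ^ (-γ) * (A * (2 ^ ((n : ℝ) + 1) * jap (x - z))) := by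
          gcongr; exact (h _).trans (by gcongr; exact jap_shift hy)
      _ = A * (2 ^ ((n : ℝ) + 1) * (‖z‖ ^ (-γ) * jap (x - z))) := by ring
      _ ≤ _ := by gcongr; exact ker_jap_le hγ0 x z
  · have h1 : HasFDerivAt (fun y => φ (y - z)) (fderiv ℝ φ (y - z)) y := by
      have := ((φ.differentiable (y - z)).hasFDerivAt).comp y ((hasFDerivAt_id y).sub_const z)
      simpa [Function.comp_def] using this
    exact h1.const_smul (‖z‖ ^ (-γ))

lemma HardyC.convE_contDiff {γ C : ℝ} (H : HardyC n γ C) (hγ0 : 0 < γ) (k : ℕ) :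
    ∀ {E : Type} [NormedAddCommGroup E] [NormedSpace ℝ E] (φ : SchwartzMap (Rn n) E),
    ContDiff ℝ k (convE γ φ) := by
  induction k with
  | zero =>
    intro E _ _ φ
    refine contDiff_zero.2 (continuous_iff_continuousAt.2 fun x => (H.convE_hasFDerivAt hγ0 φ x).continuousAt)
  | succ k ih =>
    intro E _ _ φ
    have : ((k + 1 : ℕ) : WithTop ℕ∞) = (k : WithTop ℕ∞) + 1 := by norm_cast
    rw [this, contDiff_succ_iff_hasFDerivAt]
    exact ⟨_, ih (SchwartzMap.fderivCLM ℝ (Rn n) E φ), fun x => H.convE_hasFDerivAt hγ0 φ x⟩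

lemma HardyC.convE_iter {γ C : ℝ} (H : HardyC n γ C) (hγ0 : 0 < γ) (k : ℕ) :
    ∀ {E : Type} [NormedAddCommGroup E] [NormedSpace ℝ E] (φ : SchwartzMap (Rn n) E),
    ∃ B, ∀ x, ‖iteratedFDeriv ℝ k (convE γ φ) x‖ ≤ B := by
  induction k with
  | zero =>
    intro E _ _ φ
    simpa using H.convE_bdd hγ0 φ
  | succ k ih =>
    intro E _ _ φ
    obtain ⟨B, hB⟩ := ih (SchwartzMap.fderivCLM ℝ (Rn n) E φ)
    refine ⟨B, fun x => ?_⟩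
    rw [← norm_iteratedFDeriv_fderiv]
    have : fderiv ℝ (convE γ φ) = convE γ (SchwartzMap.fderivCLM ℝ (Rn n) E φ) :=
      funext fun x => (H.convE_hasFDerivAt hγ0 φ x).fderiv
    rw [this]; exact hB x

lemma HardyC.convE_temperate {γ C : ℝ} (H : HardyC n γ C) (hγ0 : 0 < γ) (φ : SchwartzMap (Rn n) E) :
    (convE γ φ).HasTemperateGrowth := by
  refine ⟨contDiff_infty.2 fun k => H.convE_contDiff hγ0 k φ, fun k => ?_⟩
  obtain ⟨B, hB⟩ := H.convE_iter hγ0 k φ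
  exact ⟨0, B, fun x => by simpa using hB x⟩

/-- |f|² as a complex Schwartz function -/
def nsq (f : SchwartzMap (Rn n) ℂ) : SchwartzMap (Rn n) ℂ :=
  SchwartzMap.smulLeftCLM ℂ (⇑f) (SchwartzMap.postcompCLM (𝕜 := ℝ) Complex.conjCLE.toContinuousLinearMap f)

lemma nsq_apply (f : SchwartzMap (Rn n) ℂ) (x : Rn n) : nsq f x = ((Complex.normSq (f x) : ℝ) : ℂ) := by
  unfold nsq
  rw [SchwartzMap.smulLeftCLM_apply_apply f.hasTemperateGrowth]
  rw [SchwartzMap.postcompCLM_apply]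
  simp [Complex.mul_conj]

lemma hartree_convE (γ : ℝ) (f : SchwartzMap (Rn n) ℂ) (x : Rn n) :
    ((hartree γ f x : ℝ) : ℂ) = convE γ (nsq f) x := by
  unfold hartree conv convE
  rw [← integral_complex_ofReal]
  rw [← integral_sub_left_eq_self (fun y => ((‖x - y‖ ^ (-γ) * Complex.normSq (f y) : ℝ) : ℂ)) volume x]
  congr 1; funext z
  rw [nsq_apply]; simp

/-- the complex-valued Hartree potential of `f` -/
lemma HardyC.WC_temperate {γ C : ℝ} (H : HardyC n γ C) (hγ0 : 0 < γ) (f : SchwartzMap (Rn n) ℂ) :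
    (fun x => ((hartree γ f x : ℝ) : ℂ)).HasTemperateGrowth := by
  have : (fun x => ((hartree γ f x : ℝ) : ℂ)) = convE γ (nsq f) := funext (hartree_convE γ f)
  rw [this]; exact H.convE_temperate hγ0 _
end


/-- the class of profile-like functions -/
inductive PC {n : ℕ} (θ : ℝ → ℝ) (w : Rn n → ℝ) : (ℝ → Rn n → ℂ) → Prop
  | base (m : ℕ) (φ : SchwartzMap (Rn n) ℂ) :
      PC θ w (fun s x => (θ s : ℂ) ^ m * φ x * Complex.exp (Complex.I * ((θ s : ℂ) * (w x : ℂ))))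
  | add {p q : ℝ → Rn n → ℂ} : PC θ w p → PC θ w q → PC θ w (fun s x => p s x + q s x)

section
variable {n : ℕ}

lemma PC.jc {θ : ℝ → ℝ} {w : Rn n → ℝ} (hθ : ContDiff ℝ 2 θ)
    (hw : (fun x => (w x : ℂ)).HasTemperateGrowth) {q : ℝ → Rn n → ℂ} (h : PC θ w q) : JC 2 q := by
  induction h with
  | base m φ =>
    have h2 : (2 : WithTop ℕ∞) ≤ ((⊤ : ℕ∞) : WithTop ℕ∞) := WithTop.coe_le_coe.mpr (le_top : (2 : ℕ∞) ≤ ⊤)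
    have e1 : ContDiff ℝ 2 (fun p : ℝ × Rn n => (θ p.1 : ℂ)) :=
      Complex.ofRealCLM.contDiff.comp (hθ.comp contDiff_fst)
    have e2 : ContDiff ℝ 2 (fun p : ℝ × Rn n => (w p.2 : ℂ)) := (hw.1.of_le h2).comp contDiff_snd
    have e3 : ContDiff ℝ 2 (fun p : ℝ × Rn n => φ p.2) := ((φ.smooth ⊤).of_le h2).comp contDiff_snd
    exact ((e1.pow m).mul e3).mul (contDiff_const.mul (e1.mul e2)).cexp
  | add _ _ hp hq => exact hp.add hq

lemma PC.dj {θ : ℝ → ℝ} {w : Rn n → ℝ} (hθ : ContDiff ℝ 2 θ)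
    (hw : (fun x => (w x : ℂ)).HasTemperateGrowth) {q : ℝ → Rn n → ℂ} (h : PC θ w q) (j : Fin n) :
    PC θ w (fun s => dj j (q s)) := by
  induction h with
  | base m φ =>
    have hwd : Differentiable ℝ (fun x => (w x : ℂ)) := hw.1.differentiable (by simp)
    have hwj : (_root_.dj j (fun x => (w x : ℂ))).HasTemperateGrowth := by
      have h1 : (fderiv ℝ (fun x => (w x : ℂ))).HasTemperateGrowth := by
        refine ⟨hw.1.fderiv_right (by simp), fun k => ?_⟩
        obtain ⟨l, B, hB⟩ := hw.2 (k + 1)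
        exact ⟨l, B, fun x => by rw [norm_iteratedFDeriv_fderiv]; exact hB x⟩
      exact (ContinuousLinearMap.hasTemperateGrowth
        (ContinuousLinearMap.apply ℝ ℂ (EuclideanSpace.single j (1:ℝ) : Rn n))).comp h1
    have key : (fun s => _root_.dj j (fun x => (θ s : ℂ) ^ m * φ x * Complex.exp (Complex.I * ((θ s : ℂ) * (w x : ℂ)))))
        = fun s x => ((θ s : ℂ) ^ m * (sdj j φ) x * Complex.exp (Complex.I * ((θ s : ℂ) * (w x : ℂ))))
          + ((θ s : ℂ) ^ (m + 1) * (SchwartzMap.smulLeftCLM ℂ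
              (fun x => Complex.I * _root_.dj j (fun x => (w x : ℂ)) x) φ) x
              * Complex.exp (Complex.I * ((θ s : ℂ) * (w x : ℂ)))) := by
      funext s x
      have hg : (fun x => Complex.I * _root_.dj j (fun x => (w x : ℂ)) x).HasTemperateGrowth :=
        (Function.HasTemperateGrowth.const Complex.I).mul hwj
      rw [SchwartzMap.smulLeftCLM_apply_apply hg, sdj_coe]
      have d1 : HasFDerivAt (fun x => (w x : ℂ)) (fderiv ℝ (fun x => (w x : ℂ)) x) x := (hwd x).hasFDerivAt
      have d2 : HasFDerivAt (⇑φ) (fderiv ℝ (⇑φ) x) x := (φ.differentiable x).hasFDerivAt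
      have d3 := (d2.const_mul ((θ s : ℂ) ^ m)).mul ((d1.const_mul (θ s : ℂ)).const_mul Complex.I).cexp
      have d4 : _root_.dj j (fun x => (θ s : ℂ) ^ m * φ x * Complex.exp (Complex.I * ((θ s : ℂ) * (w x : ℂ)))) x = _ :=
        congrArg (fun L => L (EuclideanSpace.single j (1:ℝ) : Rn n)) d3.fderiv
      rw [d4]
      simp only [_root_.dj, smul_eq_mul, ContinuousLinearMap.add_apply, ContinuousLinearMap.smul_apply]
      ring
    rw [key]
    exact PC.add (PC.base m _) (PC.base (m + 1) _)
  | @add p q hp' hq' hp hq =>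
    have : (fun s => _root_.dj j (fun x => p s x + q s x)) =
        fun s x => _root_.dj j (p s) x + _root_.dj j (q s) x := by
      funext s
      exact dj_add (((hp'.jc hθ hw).slice s).differentiable (by norm_num))
        (((hq'.jc hθ hw).slice s).differentiable (by norm_num))
    rw [this]; exact PC.add hp hq

lemma PC.sum {θ : ℝ → ℝ} {w : Rn n → ℝ} {ι : Type} (t : Finset ι) {q : ι → ℝ → Rn n → ℂ}
    (h : ∀ i ∈ t, PC θ w (q i)) : PC θ w (fun s x => ∑ i ∈ t, q i s x) := by
  classical
  induction t using Finset.induction_on with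
  | empty => simpa using PC.base (θ := θ) (w := w) 0 0
  | insert i t hi ih =>
    have : (fun s x => ∑ k ∈ insert i t, q k s x) = fun s x => q i s x + ∑ k ∈ t, q k s x := by
      funext s x; rw [Finset.sum_insert hi]
    rw [this]
    exact PC.add (h i (Finset.mem_insert_self _ _)) (ih fun k hk => h k (Finset.mem_insert_of_mem hk))

lemma PC.lap {θ : ℝ → ℝ} {w : Rn n → ℝ} (hθ : ContDiff ℝ 2 θ)
    (hw : (fun x => (w x : ℂ)).HasTemperateGrowth) {q : ℝ → Rn n → ℂ} (h : PC θ w q) :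
    PC θ w (fun s => lap (q s)) := by
  simp only [lap_eq]
  exact PC.sum Finset.univ fun j _ => (h.dj hθ hw j).dj hθ hw j

lemma PC.bdd0 {θ : ℝ → ℝ} {w : Rn n → ℝ} (hθ : ContDiff ℝ 2 θ)
    (hw : (fun x => (w x : ℂ)).HasTemperateGrowth) {q : ℝ → Rn n → ℂ} (h : PC θ w q) {Θ S : ℝ}
    (hΘ : ∀ s ∈ Set.Icc 0 S, |θ s| ≤ Θ) : ∃ B, 0 ≤ B ∧ ∀ s ∈ Set.Icc 0 S,
      MemLp (q s) 2 volume ∧ nrm (q s) ≤ B ∧ MemLp (xw (q s)) 2 volume ∧ nrm (xw (q s)) ≤ B := by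
  induction h with
  | base m φ =>
    refine ⟨|Θ| ^ m * (nrm ⇑φ + nrm (xw ⇑φ)), by have := nrm_nonneg (⇑φ); have := nrm_nonneg (xw ⇑φ); positivity,
      fun s hs => ?_⟩
    have hc : Continuous (fun x => (θ s : ℂ) ^ m * φ x * Complex.exp (Complex.I * ((θ s : ℂ) * (w x : ℂ)))) :=
      (((PC.base (θ := θ) (w := w) m φ).jc hθ hw).slice s).continuous
    have hn : ∀ x, ‖(θ s : ℂ) ^ m * φ x * Complex.exp (Complex.I * ((θ s : ℂ) * (w x : ℂ)))‖ ≤ |Θ| ^ m * ‖φ x‖ := by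
      intro x
      have : ‖Complex.exp (Complex.I * ((θ s : ℂ) * (w x : ℂ)))‖ = 1 := by
        rw [← Complex.ofReal_mul, mul_comm]; exact Complex.norm_exp_ofReal_mul_I _
      rw [norm_mul, this, mul_one, norm_mul, norm_pow, Complex.norm_real, Real.norm_eq_abs]
      exact mul_le_mul_of_nonneg_right (pow_le_pow_left₀ (abs_nonneg _) ((hΘ s hs).trans (le_abs_self _)) m) (norm_nonneg _)
    have hK : (0:ℝ) ≤ |Θ| ^ m := by positivity
    have cn : ‖((|Θ| ^ m : ℝ) : ℂ)‖ = |Θ| ^ m := by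
      rw [Complex.norm_real, Real.norm_eq_abs, abs_of_nonneg hK]
    have a1 := nrm_mono (f := fun x => (θ s : ℂ) ^ m * φ x * Complex.exp (Complex.I * ((θ s : ℂ) * (w x : ℂ))))
      (g := fun x => ((|Θ| ^ m : ℝ) : ℂ) * φ x) ((schwartz_memLp φ).const_mul _) hc.aestronglyMeasurable
      (fun x => by rw [norm_mul (((|Θ| ^ m : ℝ) : ℂ)), cn]; exact hn x)
    have a2 := nrm_mono (f := xw (fun x => (θ s : ℂ) ^ m * φ x * Complex.exp (Complex.I * ((θ s : ℂ) * (w x : ℂ)))))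
      (g := fun x => ((|Θ| ^ m : ℝ) : ℂ) * xw φ x) ((schwartz_xw φ).const_mul _)
      ((Complex.continuous_ofReal.comp continuous_norm).mul hc).aestronglyMeasurable
      (fun x => by
        rw [norm_mul (((|Θ| ^ m : ℝ) : ℂ)), cn]; unfold xw
        rw [norm_mul (((‖x‖:ℝ):ℂ)), norm_mul (((‖x‖:ℝ):ℂ))]
        calc _ ≤ ‖((‖x‖:ℝ):ℂ)‖ * (|Θ| ^ m * ‖φ x‖) := mul_le_mul_of_nonneg_left (hn x) (norm_nonneg _)
          _ = _ := by ring)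
    rw [nrm_const_mul, cn] at a1 a2
    have := nrm_nonneg (⇑φ); have := nrm_nonneg (xw ⇑φ)
    exact ⟨a1.1, a1.2.trans (by gcongr; linarith), a2.1, a2.2.trans (by gcongr; linarith)⟩
  | @add p q hp' hq' hp hq =>
    obtain ⟨B1, h1, H1⟩ := hp
    obtain ⟨B2, h2, H2⟩ := hq
    refine ⟨B1 + B2, by positivity, fun s hs => ?_⟩
    obtain ⟨a1, a2, a3, a4⟩ := H1 s hs
    obtain ⟨b1, b2, b3, b4⟩ := H2 s hs
    have e : xw (fun x => p s x + q s x) = fun x => xw (p s) x + xw (q s) x := by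
      funext x; unfold xw; ring
    rw [e]
    exact ⟨a1.add b1, (nrm_add_le a1).trans (by linarith), a3.add b3, (nrm_add_le a3).trans (by linarith)⟩

lemma PC.bdd {θ : ℝ → ℝ} {w : Rn n → ℝ} (hθ : ContDiff ℝ 2 θ)
    (hw : (fun x => (w x : ℂ)).HasTemperateGrowth) {q : ℝ → Rn n → ℂ} (h : PC θ w q) (S : ℝ) :
    ∃ B, 0 ≤ B ∧ ∀ s ∈ Set.Icc 0 S, IsH1 (q s) ∧ H1n (q s) ≤ B ∧ MemLp (xw (q s)) 2 volume ∧
      nrm (xw (q s)) ≤ B := by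
  obtain ⟨Θ, hΘ⟩ := isCompact_Icc.exists_bound_of_continuousOn (s := Set.Icc 0 S) hθ.continuous.continuousOn
  simp only [Real.norm_eq_abs] at hΘ
  obtain ⟨B, hB, HB⟩ := h.bdd0 hθ hw hΘ
  choose D hD HD using fun j => (h.dj hθ hw j).bdd0 hθ hw hΘ
  refine ⟨B + ∑ j, D j, add_nonneg hB (Finset.sum_nonneg fun j _ => hD j), fun s hs => ?_⟩
  have hD' : 0 ≤ ∑ j, D j := Finset.sum_nonneg fun j _ => hD j
  refine ⟨⟨((h.jc hθ hw).slice s).of_le (by norm_num), (HB s hs).1, fun j => (HD j s hs).1⟩, ?_, (HB s hs).2.2.1,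
    (HB s hs).2.2.2.trans (by linarith)⟩
  exact add_le_add (HB s hs).2.1 (Finset.sum_le_sum fun j _ => (HD j s hs).2.1)

/-- the integrated coupling -/
def tht (γ s : ℝ) : ℝ := -∫ σ in (0:ℝ)..s, bet γ σ

lemma tht_hasDerivAt (γ s : ℝ) : HasDerivAt (tht γ) (-bet γ s) s :=
  (((rpow_cc_contDiff 0 (2 - γ)).continuous.integral_hasStrictDerivAt 0 s).hasDerivAt).neg

lemma tht_contDiff (γ : ℝ) : ContDiff ℝ 2 (tht γ) := by
  have : (2 : WithTop ℕ∞) = 1 + 1 := by norm_num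
  rw [this, contDiff_succ_iff_deriv]
  refine ⟨fun s => (tht_hasDerivAt γ s).differentiableAt, by simp, ?_⟩
  have : deriv (tht γ) = fun s => -bet γ s := funext fun s => (tht_hasDerivAt γ s).deriv
  rw [this]; exact (rpow_cc_contDiff 1 (2 - γ)).neg

/-- the profile -/
def prof (γ : ℝ) (f : Rn n → ℂ) (s : ℝ) (x : Rn n) : ℂ :=
  f x * Complex.exp (Complex.I * ((tht γ s * hartree γ f x : ℝ) : ℂ))

lemma prof_norm (γ : ℝ) (f : Rn n → ℂ) (s : ℝ) (x : Rn n) : ‖prof γ f s x‖ = ‖f x‖ := by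
  unfold prof
  rw [norm_mul, mul_comm Complex.I, Complex.norm_exp_ofReal_mul_I, mul_one]

lemma hartree_prof (γ : ℝ) (f : Rn n → ℂ) (s : ℝ) : hartree γ (prof γ f s) = hartree γ f := by
  funext x; unfold hartree
  congr 1; funext y; rw [Complex.normSq_eq_norm_sq, prof_norm, Complex.normSq_eq_norm_sq]

lemma prof_zero (γ : ℝ) (f : Rn n → ℂ) : prof γ f 0 = f := by
  funext x; simp [prof, tht]

/-- what is needed about the profile on `[0,S]` -/
structure Prof {n : ℕ} (γ S A : ℝ) (a : ℝ → Rn n → ℂ) : Prop where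
  A0 : 0 ≤ A
  jc : JC 2 a
  h1 : ∀ s ∈ Set.Icc 0 S, IsH1 (a s) ∧ H1n (a s) ≤ A
  xm : ∀ s ∈ Set.Icc 0 S, MemLp (xw (a s)) 2 volume ∧ nrm (xw (a s)) ≤ A
  l1 : ∀ s ∈ Set.Icc 0 S, IsH1 (lap (a s)) ∧ H1n (lap (a s)) ≤ A
  lx : ∀ s ∈ Set.Icc 0 S, MemLp (xw (lap (a s))) 2 volume ∧ nrm (xw (lap (a s))) ≤ A
  eq : ∀ ε s x, FF ε a s x = ((bet γ s * hartree γ (a s) x : ℝ) : ℂ) * a s x + ((ε / 2 : ℝ) : ℂ) * lap (a s) x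

lemma HardyC.exists_prof {γ C : ℝ} (H : HardyC n γ C) (hγ0 : 0 < γ) (f : SchwartzMap (Rn n) ℂ) (S : ℝ) :
    ∃ A, Prof γ S A (prof γ ⇑f) := by
  have hθ := tht_contDiff γ
  have hw := H.WC_temperate hγ0 f
  have h : PC (tht γ) (hartree γ f) (prof γ ⇑f) := by
    have := PC.base (θ := tht γ) (w := hartree γ f) 0 f
    have e : prof γ (⇑f) = fun s x => ((tht γ s : ℝ) : ℂ) ^ 0 * f x *
        Complex.exp (Complex.I * (((tht γ s : ℝ) : ℂ) * ((hartree γ f x : ℝ) : ℂ))) := by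
      funext s x; simp [prof]
    rw [e]; exact this
  obtain ⟨A, hA, HA⟩ := h.bdd hθ hw S
  obtain ⟨B, hB, HB⟩ := (h.lap hθ hw).bdd hθ hw S
  refine ⟨A + B, by positivity, h.jc hθ hw, fun s hs => ⟨(HA s hs).1, ?_⟩, fun s hs => ⟨(HA s hs).2.2.1, ?_⟩,
    fun s hs => ⟨(HB s hs).1, ?_⟩, fun s hs => ⟨(HB s hs).2.2.1, ?_⟩, fun ε s x => ?_⟩
  · linarith [(HA s hs).2.1]
  · linarith [(HA s hs).2.2.2]
  · linarith [(HB s hs).2.1]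
  · linarith [(HB s hs).2.2.2]
  · unfold FF
    congr 1
    have d : HasDerivAt (fun σ => prof γ (⇑f) σ x)
        (f x * (Complex.exp (Complex.I * ((tht γ s * hartree γ f x : ℝ) : ℂ)) *
          (Complex.I * ((-bet γ s * hartree γ f x : ℝ) : ℂ)))) s := by
      unfold prof
      exact ((((tht_hasDerivAt γ s).mul_const _).ofReal_comp.const_mul Complex.I).cexp).const_mul _
    rw [hartree_prof, dt, d.deriv, prof]
    push_cast
    linear_combination (-(bet γ s * hartree γ f x * f x * Complex.exp (Complex.I * (tht γ s * hartree γ f x))) : ℂ) * Complex.I_mul_I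
end

section
variable {n : ℕ}

lemma jensen_sq {φ : ℝ → ℝ} (hφ : Continuous φ) {τ : ℝ} (hτ : 0 < τ) :
    (∫ σ in (0:ℝ)..τ, φ σ) ^ 2 ≤ τ * ∫ σ in (0:ℝ)..τ, φ σ ^ 2 := by
  set m := ∫ σ in (0:ℝ)..τ, φ σ with hm
  have h0 : 0 ≤ ∫ σ in (0:ℝ)..τ, (τ * φ σ - m) ^ 2 :=
    intervalIntegral.integral_nonneg hτ.le fun σ _ => sq_nonneg _
  have e : (fun σ => (τ * φ σ - m) ^ 2) = fun σ => (τ ^ 2 * φ σ ^ 2 - (2 * τ * m) * φ σ) + m ^ 2 := by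
    funext σ; ring
  have i1 : IntervalIntegrable (fun σ => τ ^ 2 * φ σ ^ 2) volume 0 τ :=
    (continuous_const.mul (hφ.pow 2)).intervalIntegrable _ _
  have i2 : IntervalIntegrable (fun σ => (2 * τ * m) * φ σ) volume 0 τ :=
    (continuous_const.mul hφ).intervalIntegrable _ _
  rw [e, intervalIntegral.integral_add (i1.sub i2) (by simp), intervalIntegral.integral_sub i1 i2,
    intervalIntegral.integral_const_mul, intervalIntegral.integral_const_mul,
    intervalIntegral.integral_const, ← hm, smul_eq_mul] at h0
  have h1 : 0 ≤ τ * (τ * (∫ σ in (0:ℝ)..τ, φ σ ^ 2) - m ^ 2) := by nlinarith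
  have := nonneg_of_mul_nonneg_right h1 hτ
  linarith

/-- coordinate vector -/
def ev (j : Fin n) : Rn n := EuclideanSpace.single j 1

lemma line_hasDerivAt {g : Rn n → ℂ} (hg : ContDiff ℝ 1 g) (j : Fin n) (x : Rn n) (σ : ℝ) :
    HasDerivAt (fun σ : ℝ => g (x + σ • ev j)) (dj j g (x + σ • ev j)) σ := by
  have h1 : HasDerivAt (fun σ : ℝ => x + σ • ev j) (ev j) σ := by
    simpa using ((hasDerivAt_id σ).smul_const (ev j)).const_add x
  exact ((hg.differentiable (by norm_num) _).hasFDerivAt).comp_hasDerivAt σ h1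

lemma diff_sq_le {g : Rn n → ℂ} (hg : ContDiff ℝ 1 g) (j : Fin n) (x : Rn n) {τ : ℝ} (hτ : 0 < τ) :
    ‖g (x + τ • ev j) - g x‖ ^ 2 ≤ τ * ∫ σ in (0:ℝ)..τ, ‖dj j g (x + σ • ev j)‖ ^ 2 := by
  have hc : Continuous fun σ : ℝ => dj j g (x + σ • ev j) :=
    (dj_contDiff (k := 0) hg (by norm_num)).continuous.comp
      (continuous_const.add (continuous_id.smul continuous_const))
  have h := intervalIntegral.integral_eq_sub_of_hasDerivAt (a := 0) (b := τ)
    (fun σ _ => line_hasDerivAt hg j x σ) (hc.intervalIntegrable _ _)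
  simp only [zero_smul, add_zero] at h
  rw [← h]
  refine le_trans ?_ (jensen_sq hc.norm hτ)
  gcongr
  exact intervalIntegral.norm_integral_le_integral_norm hτ.le

lemma nrm_diff_le {g : Rn n → ℂ} (hg : IsH1 g) (j : Fin n) {τ : ℝ} (hτ : 0 < τ) :
    nrm (fun x => g (x + τ • ev j) - g x) ≤ τ * nrm (dj j g) := by
  have hm : MemLp (fun x => g (x + τ • ev j) - g x) 2 volume := (memLp_translate hg.mem _).sub hg.mem
  have hcd : Continuous (dj j g) := (dj_contDiff (k := 0) hg.diff (by norm_num)).continuous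
  have hT : 0 ≤ τ * nrm (dj j g) := mul_nonneg hτ.le (nrm_nonneg _)
  refine abs_le_of_sq_le_sq' ?_ hT |>.2
  rw [mul_pow, nrm_sq hm, nrm_sq (hg.dmem j)]
  rw [← ENNReal.ofReal_le_ofReal_iff (mul_nonneg (by positivity) (integral_nonneg fun x => by positivity))]
  rw [ofReal_integral_eq_lintegral_ofReal (memLp_sq_integrable hm) (Eventually.of_forall fun x => by positivity),
    ENNReal.ofReal_mul (by positivity),
    ofReal_integral_eq_lintegral_ofReal (memLp_sq_integrable (hg.dmem j)) (Eventually.of_forall fun x => by positivity)]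
  have hjoint : Continuous fun p : Rn n × ℝ => ENNReal.ofReal (‖dj j g (p.1 + p.2 • ev j)‖ ^ 2) :=
    ENNReal.continuous_ofReal.comp ((hcd.comp (by fun_prop)).norm.pow 2)
  calc ∫⁻ x, ENNReal.ofReal (‖g (x + τ • ev j) - g x‖ ^ 2)
      ≤ ∫⁻ x, ENNReal.ofReal τ * ∫⁻ σ in Set.Ioc 0 τ, ENNReal.ofReal (‖dj j g (x + σ • ev j)‖ ^ 2) := by
        refine lintegral_mono fun x => ?_
        have hc : Continuous fun σ : ℝ => ‖dj j g (x + σ • ev j)‖ ^ 2 :=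
          (hcd.comp (continuous_const.add (continuous_id.smul continuous_const))).norm.pow 2
        have h1 := diff_sq_le hg.diff j x hτ
        rw [intervalIntegral.integral_of_le hτ.le] at h1
        refine (ENNReal.ofReal_le_ofReal h1).trans ?_
        rw [ENNReal.ofReal_mul hτ.le, ofReal_integral_eq_lintegral_ofReal]
        · exact (intervalIntegrable_iff_integrableOn_Ioc_of_le hτ.le).1 (hc.intervalIntegrable _ _)
        · exact Eventually.of_forall fun x => by positivity
    _ = ENNReal.ofReal τ * ∫⁻ σ in Set.Ioc 0 τ, ∫⁻ x, ENNReal.ofReal (‖dj j g (x + σ • ev j)‖ ^ 2) := by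
        rw [lintegral_const_mul' _ _ ENNReal.ofReal_ne_top, lintegral_lintegral_swap]
        exact hjoint.measurable.aemeasurable
    _ = ENNReal.ofReal τ * ∫⁻ σ in Set.Ioc 0 τ, ∫⁻ x, ENNReal.ofReal (‖dj j g x‖ ^ 2) := by
        congr 1; refine lintegral_congr fun σ => ?_
        exact lintegral_add_right_eq_self (fun x => ENNReal.ofReal (‖dj j g x‖ ^ 2)) (σ • ev j)
    _ = _ := by
        rw [lintegral_const, Measure.restrict_apply_univ, Real.volume_Ioc, sub_zero, pow_two,
          ENNReal.ofReal_mul hτ.le]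
        ring

/-- difference quotients converge in norm -/
lemma diffq_tendsto {g : Rn n → ℂ} (hg : IsH1 g) (j : Fin n) :
    Tendsto (fun k : ℕ => ((k : ℝ) + 1) * nrm (fun x => g (x + ((k : ℝ) + 1)⁻¹ • ev j) - g x)) atTop
      (𝓝 (nrm (dj j g))) := by
  have hle : ∀ k : ℕ, ((k : ℝ) + 1) * nrm (fun x => g (x + ((k : ℝ) + 1)⁻¹ • ev j) - g x) ≤ nrm (dj j g) := by
    intro k
    have h := nrm_diff_le hg j (τ := ((k : ℝ) + 1)⁻¹) (by positivity)
    calc _ ≤ ((k : ℝ) + 1) * (((k : ℝ) + 1)⁻¹ * nrm (dj j g)) := by gcongr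
      _ = _ := by field_simp
  rw [Metric.tendsto_atTop]
  by_contra hcon
  push Not at hcon
  obtain ⟨η, hη, H⟩ := hcon
  -- extract a subsequence staying below
  have H' : ∀ N : ℕ, ∃ k ≥ N, ((k : ℝ) + 1) * nrm (fun x => g (x + ((k : ℝ) + 1)⁻¹ • ev j) - g x) ≤ nrm (dj j g) - η := by
    intro N
    obtain ⟨k, hk, h⟩ := H N
    refine ⟨k, hk, ?_⟩
    rw [Real.dist_eq, abs_sub_comm, abs_of_nonneg (by linarith [hle k])] at h
    linarith
  choose κ hκ Hκ using H'
  have hκt : Tendsto κ atTop atTop := tendsto_atTop_mono hκ tendsto_id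
  have hmem : ∀ k : ℕ, MemLp (fun x => (((k : ℝ) + 1 : ℝ) : ℂ) * (g (x + ((k : ℝ) + 1)⁻¹ • ev j) - g x)) 2 volume :=
    fun k => ((memLp_translate hg.mem _).sub hg.mem).const_mul _
  have hnn : ∀ k : ℕ, nrm (fun x => (((k : ℝ) + 1 : ℝ) : ℂ) * (g (x + ((k : ℝ) + 1)⁻¹ • ev j) - g x))
      = ((k : ℝ) + 1) * nrm (fun x => g (x + ((k : ℝ) + 1)⁻¹ • ev j) - g x) := by
    intro k
    rw [nrm_const_mul, Complex.norm_real, Real.norm_eq_abs, abs_of_nonneg (by positivity)]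
  have hlim : ∀ x, Tendsto (fun k : ℕ => (((k : ℝ) + 1 : ℝ) : ℂ) * (g (x + ((k : ℝ) + 1)⁻¹ • ev j) - g x)) atTop
      (𝓝 (dj j g x)) := by
    intro x
    have h := (line_hasDerivAt hg.diff j x 0).tendsto_slope_zero_right
    simp only [zero_smul, add_zero, zero_add] at h
    have ht : Tendsto (fun k : ℕ => ((k : ℝ) + 1)⁻¹) atTop (𝓝[>] 0) := by
      rw [tendsto_nhdsWithin_iff]
      refine ⟨?_, Eventually.of_forall fun k => by simp only [Set.mem_Ioi]; positivity⟩
      have := tendsto_one_div_add_atTop_nhds_zero_nat (𝕜 := ℝ)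
      simpa using this
    have h2 := h.comp ht
    refine h2.congr fun k => ?_
    simp [Function.comp]
  have := (memLp_nrm_of_tendsto (F := fun i => fun x => (((κ i : ℝ) + 1 : ℝ) : ℂ) * (g (x + ((κ i : ℝ) + 1)⁻¹ • ev j) - g x))
    (G := dj j g) (C := nrm (dj j g) - η) (fun i => hmem _) (fun i => by rw [hnn]; exact Hκ i)
    ((hg.dmem j).1) (Eventually.of_forall fun x => (hlim x).comp hκt)).2
  linarith
end

section
variable {n : ℕ}

lemma hartree_translate (γ : ℝ) (g : Rn n → ℂ) (h x : Rn n) :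
    hartree γ (fun y => g (y + h)) x = hartree γ g (x + h) := by
  unfold hartree conv
  rw [← integral_add_right_eq_self (fun y => ‖x + h - y‖ ^ (-γ) * Complex.normSq (g y)) h]
  simp only [add_sub_add_right_eq_sub]

/-- second difference of Hartree potentials -/
lemma HardyC.hartree_dd {γ C : ℝ} (H : HardyC n γ C) {p q p' q' : Rn n → ℂ} (hp : IsH1 p) (hq : IsH1 q)
    (hp' : IsH1 p') (hq' : IsH1 q') (x : Rn n) :
    |(hartree γ p' x - hartree γ q' x) - (hartree γ p x - hartree γ q x)| ≤
      C * (nrm (fun y => (p' y - q' y) - (p y - q y)) * H1n (fun y => p' y + q' y)) +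
      C * (nrm (fun y => (p' y + q' y) - (p y + q y)) * H1n (fun y => p y - q y)) := by
  set ρ₁ : Rn n → ℝ := fun y => (((p' y - q' y) - (p y - q y)) * conj (p' y + q' y)).re with h1
  set ρ₂ : Rn n → ℝ := fun y => ((p y - q y) * conj ((p' y + q' y) - (p y + q y))).re with h2
  have m1 := ((hp'.sub hq').sub (hp.sub hq)).mem
  have m2 := ((hp'.add hq').sub (hp.add hq)).mem
  have cp := hp.diff.continuous
  have cq := hq.diff.continuous
  have cp' := hp'.diff.continuous
  have cq' := hq'.diff.continuous
  have b1 : ∀ y, |ρ₁ y| ≤ ‖(p' y - q' y) - (p y - q y)‖ * ‖p' y + q' y‖ := fun y =>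
    (Complex.abs_re_le_norm _).trans (by rw [norm_mul, Complex.norm_conj])
  have b2 : ∀ y, |ρ₂ y| ≤ ‖(p' y + q' y) - (p y + q y)‖ * ‖p y - q y‖ := fun y =>
    (Complex.abs_re_le_norm _).trans (by rw [norm_mul, Complex.norm_conj, mul_comm])
  have s1 : AEStronglyMeasurable ρ₁ volume := by
    refine Continuous.aestronglyMeasurable ?_
    exact Complex.continuous_re.comp (((cp'.sub cq').sub (cp.sub cq)).mul (Complex.continuous_conj.comp (cp'.add cq')))
  have s2 : AEStronglyMeasurable ρ₂ volume := by
    refine Continuous.aestronglyMeasurable ?_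
    exact Complex.continuous_re.comp ((cp.sub cq).mul (Complex.continuous_conj.comp ((cp'.add cq').sub (cp.add cq))))
  have i1 := H.integrable m1 (hp'.add hq') s1 b1 x
  have i2 := H.integrable m2 (hp.sub hq) s2 b2 x
  have e : (hartree γ p' x - hartree γ q' x) - (hartree γ p x - hartree γ q x) = conv γ ρ₁ x + conv γ ρ₂ x := by
    have i3 : Integrable (fun y => ‖x - y‖ ^ (-γ) * Complex.normSq (p' y) - ‖x - y‖ ^ (-γ) * Complex.normSq (q' y)) volume :=
      (H.hartree_int hp' x).sub (H.hartree_int hq' x)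
    have i4 : Integrable (fun y => ‖x - y‖ ^ (-γ) * Complex.normSq (p y) - ‖x - y‖ ^ (-γ) * Complex.normSq (q y)) volume :=
      (H.hartree_int hp x).sub (H.hartree_int hq x)
    unfold hartree conv
    rw [← integral_sub (H.hartree_int hp' x) (H.hartree_int hq' x),
      ← integral_sub (H.hartree_int hp x) (H.hartree_int hq x),
      ← integral_sub i3 i4,
      ← integral_add i1 i2]
    congr 1; funext y
    simp only [h1, h2, Complex.normSq_apply, Complex.mul_re, Complex.sub_re, Complex.add_re, Complex.sub_im, Complex.add_im,
      Complex.conj_re, Complex.conj_im]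
    ring
  rw [e]
  exact (abs_add_le _ _).trans (add_le_add (H.bound m1 (hp'.add hq') b1 x) (H.bound m2 (hp.sub hq) b2 x))

/-- The standing data for the error estimate. -/
structure Err {n : ℕ} (γ C ε S A : ℝ) (v a : ℝ → Rn n → ℂ) : Prop where
  H : HardyC n γ C
  g1 : γ < 1
  ε0 : 0 < ε
  v : VSol γ ε v
  a : Prof γ S A a

/-- the source term -/
def GG {n : ℕ} (γ ε : ℝ) (v a : ℝ → Rn n → ℂ) (s : ℝ) (x : Rn n) : ℂ :=
  ((bet γ s * (hartree γ (v s) x - hartree γ (a s) x) : ℝ) : ℂ) * a s x - ((ε / 2 : ℝ) : ℂ) * lap (a s) x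

/-- the error -/
def rr {n : ℕ} (v a : ℝ → Rn n → ℂ) (s : ℝ) (x : Rn n) : ℂ := v s x - a s x

lemma Err.jc {γ C ε S A : ℝ} {v a : ℝ → Rn n → ℂ} (h : Err γ C ε S A v a) : JC 2 (rr v a) :=
  h.v.jc.sub h.a.jc

lemma Err.h1 {γ C ε S A : ℝ} {v a : ℝ → Rn n → ℂ} (h : Err γ C ε S A v a) {s : ℝ} (hs : s ∈ Set.Icc 0 S) :
    IsH1 (rr v a s) := (h.v.h1 s).sub (h.a.h1 s hs).1

lemma Err.eq {γ C ε S A : ℝ} {v a : ℝ → Rn n → ℂ} (h : Err γ C ε S A v a) (s : ℝ) (x : Rn n) :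
    FF ε (rr v a) s x = ((bet γ s * hartree γ (v s) x : ℝ) : ℂ) * rr v a s x + GG γ ε v a s x := by
  have := FF_sub h.v.jc h.a.jc ε s x
  change FF ε (rr v a) s x = _ at this
  rw [this, h.v.eq, h.a.eq]
  unfold GG rr; push_cast; ring

lemma Err.v_le {γ C ε S A : ℝ} {v a : ℝ → Rn n → ℂ} (h : Err γ C ε S A v a) {s : ℝ} (hs : s ∈ Set.Icc 0 S)
    {X : ℝ} (hX : H1n (rr v a s) ≤ X) : H1n (v s) ≤ X + A := by
  have e : v s = fun x => rr v a s x + a s x := by funext x; unfold rr; ring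
  rw [e]
  exact (H1n_add_le (h.h1 hs) (h.a.h1 s hs).1).trans (add_le_add hX (h.a.h1 s hs).2)

lemma Err.W_le {γ C ε S A : ℝ} {v a : ℝ → Rn n → ℂ} (h : Err γ C ε S A v a) {s : ℝ} (hs : s ∈ Set.Icc 0 S)
    {X : ℝ} (hX : H1n (rr v a s) ≤ X) (x : Rn n) :
    |hartree γ (v s) x - hartree γ (a s) x| ≤ C * (X * (X + 2 * A)) := by
  have h1 := h.H.hartree_sub_le (h.v.h1 s) (h.a.h1 s hs).1 x
  have h2 := h.v_le hs hX
  have h3 := (h.a.h1 s hs).2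
  have hC := h.H.1
  have hX0 : 0 ≤ X := (H1n_nonneg _).trans hX
  have h4 : nrm (fun y => v s y - a s y) ≤ X := (nrm_le_H1n (rr v a s)).trans hX
  refine h1.trans ?_
  have := H1n_nonneg (v s); have := H1n_nonneg (a s)
  calc _ ≤ C * (X * ((X + A) + A)) := by gcongr
    _ = _ := by ring

lemma bet_abs_mul {γ : ℝ} (hγ : γ < 1) (s w K : ℝ) (h : |w| ≤ K) : ‖((bet γ s * w : ℝ) : ℂ)‖ ≤ K := by
  rw [Complex.norm_real, Real.norm_eq_abs, abs_mul, abs_of_nonneg (bet_nonneg γ s)]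
  exact (mul_le_of_le_one_left (abs_nonneg _) (bet_le_one hγ s)).trans h

/-- L² (and weighted L²) bound on the source, in a form that covers both -/
lemma Err.G_le {γ C ε S A : ℝ} {v a : ℝ → Rn n → ℂ} (h : Err γ C ε S A v a) {s : ℝ} (hs : s ∈ Set.Icc 0 S)
    {X : ℝ} (hX : H1n (rr v a s) ≤ X) {ω : Rn n → ℂ} (hω : Continuous ω)
    (ha : MemLp (fun x => ω x * a s x) 2 volume) (hl : MemLp (fun x => ω x * lap (a s) x) 2 volume)
    (ha' : nrm (fun x => ω x * a s x) ≤ A) (hl' : nrm (fun x => ω x * lap (a s) x) ≤ A) :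
    MemLp (fun x => ω x * GG γ ε v a s x) 2 volume ∧
      nrm (fun x => ω x * GG γ ε v a s x) ≤ C * (X * (X + 2 * A)) * A + ε / 2 * A := by
  have hX0 : 0 ≤ X := (H1n_nonneg _).trans hX
  have hC := h.H.1
  have hA := h.a.A0
  have hK : 0 ≤ C * (X * (X + 2 * A)) := by positivity
  have hmeas : Measurable fun x => ((bet γ s * (hartree γ (v s) x - hartree γ (a s) x) : ℝ) : ℂ) :=
    Complex.measurable_ofReal.comp (((hartree_meas γ (h.v.h1 s).diff.continuous).measurable.sub
      (hartree_meas γ (h.a.h1 s hs).1.diff.continuous).measurable).const_mul _)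
  have p1 := nrm_bdd_mul (V := fun x => ((bet γ s * (hartree γ (v s) x - hartree γ (a s) x) : ℝ) : ℂ)) hK ha
    (hmeas.aestronglyMeasurable.mul ha.1) (fun x => bet_abs_mul h.g1 _ _ _ (h.W_le hs hX x))
  have e : (fun x => ω x * GG γ ε v a s x) = fun x =>
      ((bet γ s * (hartree γ (v s) x - hartree γ (a s) x) : ℝ) : ℂ) * (ω x * a s x)
      - ((ε / 2 : ℝ) : ℂ) * (ω x * lap (a s) x) := by
    funext x; unfold GG; ring
  rw [e]
  refine ⟨p1.1.sub (hl.const_mul _), (nrm_sub_le p1.1).trans ?_⟩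
  rw [nrm_const_mul, Complex.norm_real, Real.norm_eq_abs, abs_of_nonneg (by linarith [h.ε0])]
  have := h.ε0
  have := nrm_nonneg (fun x => ω x * lap (a s) x)
  refine add_le_add (p1.2.trans (by gcongr)) (by gcongr)

/-- the constant in the error estimate -/
def QQ (C A ε X : ℝ) : ℝ := C * (2 * (X + A) ^ 2 * X + 3 * (X * (X + 2 * A)) * A) + ε * A

lemma Err.mass {γ C ε S A : ℝ} {v a : ℝ → Rn n → ℂ} (h : Err γ C ε S A v a) {s₁ s₂ X : ℝ} (h0 : 0 ≤ s₁)
    (h12 : s₁ ≤ s₂) (h2 : s₂ ≤ S) (hX : ∀ s ∈ Set.Icc s₁ s₂, H1n (rr v a s) ≤ X) :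
    |nrm (rr v a s₂) ^ 2 - nrm (rr v a s₁) ^ 2| ≤ 2 * (QQ C A ε X * X) * (s₂ - s₁) := by
  have sub : ∀ s ∈ Set.Icc s₁ s₂, s ∈ Set.Icc 0 S := fun s hs => ⟨h0.trans hs.1, hs.2.trans h2⟩
  have G : ∀ s ∈ Set.Icc s₁ s₂, MemLp (GG γ ε v a s) 2 volume ∧
      nrm (GG γ ε v a s) ≤ C * (X * (X + 2 * A)) * A + ε / 2 * A := by
    intro s hs
    have := h.G_le (sub s hs) (hX s hs) (ω := fun _ => 1) continuous_const
      (by simpa using (h.a.h1 s (sub s hs)).1.mem) (by simpa using (h.a.l1 s (sub s hs)).1.mem)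
      (by simpa using (nrm_le_H1n _).trans (h.a.h1 s (sub s hs)).2)
      (by simpa using (nrm_le_H1n _).trans (h.a.l1 s (sub s hs)).2)
    simpa using this
  refine mass_est h.jc h12 (M := X) (fun s hs => ⟨h.h1 (sub s hs), hX s hs⟩)
    (fun s hs x => h.eq s x) (fun s hs => (G s hs).1) fun s hs => ?_
  have hX0 : 0 ≤ X := (H1n_nonneg _).trans (hX s hs)
  have hC := h.H.1
  have hA := h.a.A0
  have := h.ε0
  have := nrm_nonneg (rr v a s)
  have := nrm_nonneg (GG γ ε v a s)
  refine mul_le_mul ((G s hs).2.trans ?_) ((nrm_le_H1n _).trans (hX s hs)) (nrm_nonneg _) (by unfold QQ; positivity)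
  unfold QQ
  have t1 : 0 ≤ C * (2 * (X + A) ^ 2 * X) := by positivity
  have t2 : 0 ≤ C * (X * (X + 2 * A)) * A := by positivity
  have t3 : 0 ≤ ε * A := by positivity
  nlinarith

/-- spatial difference -/
def Dh {n : ℕ} (h : Rn n) (q : Rn n → ℂ) (x : Rn n) : ℂ := q (x + h) - q x

lemma Dh_h1 {q : Rn n → ℂ} (hq : IsH1 q) (h : Rn n) : IsH1 (Dh h q) := (hq.translate h).sub hq

lemma Dh_le {q : Rn n → ℂ} (hq : IsH1 q) (j : Fin n) {τ X : ℝ} (hτ : 0 < τ) (hX : H1n q ≤ X) :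
    nrm (Dh (τ • ev j) q) ≤ τ * X :=
  (nrm_diff_le hq j hτ).trans (by have := (nrm_dj_le_H1n q j).trans hX; gcongr)

/-- the source for the differenced equation -/
def FD {n : ℕ} (γ ε : ℝ) (h : Rn n) (v a : ℝ → Rn n → ℂ) (s : ℝ) (x : Rn n) : ℂ :=
  ((bet γ s * (hartree γ (v s) (x + h) - hartree γ (v s) x) : ℝ) : ℂ) * rr v a s (x + h)
  + ((bet γ s * ((hartree γ (v s) (x + h) - hartree γ (a s) (x + h)) - (hartree γ (v s) x - hartree γ (a s) x)) : ℝ) : ℂ)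
      * a s (x + h)
  + ((bet γ s * (hartree γ (v s) x - hartree γ (a s) x) : ℝ) : ℂ) * Dh h (a s) x
  - ((ε / 2 : ℝ) : ℂ) * Dh h (lap (a s)) x

lemma Err.eqD {γ C ε S A : ℝ} {v a : ℝ → Rn n → ℂ} (H : Err γ C ε S A v a) (h : Rn n) (s : ℝ) (x : Rn n) :
    FF ε (fun s => Dh h (rr v a s)) s x =
      ((bet γ s * hartree γ (v s) x : ℝ) : ℂ) * Dh h (rr v a s) x + FD γ ε h v a s x := by
  have := FF_sub (H.jc.translate h) H.jc ε s x
  change FF ε (fun s => Dh h (rr v a s)) s x = _ at this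
  rw [this, FF_translate, H.eq, H.eq]
  unfold FD GG Dh; push_cast; ring

lemma Err.FD_le {γ C ε S A : ℝ} {v a : ℝ → Rn n → ℂ} (H : Err γ C ε S A v a) (j : Fin n) {τ : ℝ} (hτ : 0 < τ)
    {s : ℝ} (hs : s ∈ Set.Icc 0 S) {X : ℝ} (hX : H1n (rr v a s) ≤ X) :
    MemLp (FD γ ε (τ • ev j) v a s) 2 volume ∧ nrm (FD γ ε (τ • ev j) v a s) ≤ τ * QQ C A ε X := by
  set h : Rn n := τ • ev j with hh
  have hX0 : 0 ≤ X := (H1n_nonneg _).trans hX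
  have hC := H.H.1
  have hA := H.a.A0
  have hε := H.ε0
  have hv := H.v.h1 s
  have ha := (H.a.h1 s hs).1
  have hr := H.h1 hs
  have bv := H.v_le hs hX
  have ba := (H.a.h1 s hs).2
  have cm : ∀ {g : Rn n → ℂ}, IsH1 g → Measurable (fun x => hartree γ g x) := fun hg =>
    (hartree_meas γ hg.diff.continuous).measurable
  have cmt : ∀ {g : Rn n → ℂ}, IsH1 g → Measurable (fun x => hartree γ g (x + h)) := fun hg =>
    (cm hg).comp (measurable_id.add_const h)
  -- potential differences
  have w1 : ∀ x, |hartree γ (v s) (x + h) - hartree γ (v s) x| ≤ τ * (C * (2 * (X + A) ^ 2)) := by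
    intro x
    have := H.H.hartree_sub_le (hv.translate h) hv x
    rw [hartree_translate, H1n_translate hv] at this
    have d : nrm (fun y => v s (y + h) - v s y) ≤ τ * (X + A) := Dh_le hv j hτ bv
    have := H1n_nonneg (v s)
    calc _ ≤ C * (nrm (fun y => v s (y + h) - v s y) * (H1n (v s) + H1n (v s))) := by assumption
      _ ≤ C * (τ * (X + A) * ((X + A) + (X + A))) := by gcongr
      _ = _ := by ring
  have w2 : ∀ x, |(hartree γ (v s) (x + h) - hartree γ (a s) (x + h)) - (hartree γ (v s) x - hartree γ (a s) x)| ≤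
      τ * (C * (2 * (X * (X + 2 * A)))) := by
    intro x
    have h1 := H.H.hartree_dd hv ha (hv.translate h) (ha.translate h) x
    rw [hartree_translate, hartree_translate] at h1
    have d1 : nrm (fun y => (v s (y + h) - a s (y + h)) - (v s y - a s y)) ≤ τ * X := Dh_le hr j hτ hX
    have hva := hv.add ha
    have bva : H1n (fun y => v s y + a s y) ≤ X + 2 * A := (H1n_add_le hv ha).trans (by linarith)
    have d2 : nrm (fun y => (v s (y + h) + a s (y + h)) - (v s y + a s y)) ≤ τ * (X + 2 * A) := Dh_le hva j hτ bva
    have d3 : H1n (fun y => v s (y + h) + a s (y + h)) ≤ X + 2 * A :=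
      (H1n_translate hva h).le.trans bva
    have d4 : H1n (fun y => v s y - a s y) ≤ X := hX
    have n1 := H1n_nonneg (fun y => v s (y + h) + a s (y + h))
    have n2 := H1n_nonneg (fun y => v s y - a s y)
    calc _ ≤ _ := h1
      _ ≤ C * (τ * X * (X + 2 * A)) + C * (τ * (X + 2 * A) * X) := by gcongr
      _ = _ := by ring
  have w3 := fun x => H.W_le hs hX x
  have p1 := nrm_bdd_mul (f := fun x => rr v a s (x + h))
    (V := fun x => ((bet γ s * (hartree γ (v s) (x + h) - hartree γ (v s) x) : ℝ) : ℂ))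
    (C := τ * (C * (2 * (X + A) ^ 2))) (by positivity) (hr.translate h).mem
    ((Complex.measurable_ofReal.comp (((cmt hv).sub (cm hv)).const_mul _)).aestronglyMeasurable.mul (hr.translate h).mem.1)
    (fun x => bet_abs_mul H.g1 _ _ _ (w1 x))
  have p2 := nrm_bdd_mul (f := fun x => a s (x + h))
    (V := fun x => ((bet γ s * ((hartree γ (v s) (x + h) - hartree γ (a s) (x + h)) - (hartree γ (v s) x - hartree γ (a s) x)) : ℝ) : ℂ))
    (C := τ * (C * (2 * (X * (X + 2 * A))))) (by positivity) (ha.translate h).mem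
    ((Complex.measurable_ofReal.comp ((((cmt hv).sub (cmt ha)).sub ((cm hv).sub (cm ha))).const_mul _)).aestronglyMeasurable.mul
      (ha.translate h).mem.1)
    (fun x => bet_abs_mul H.g1 _ _ _ (w2 x))
  have p3 := nrm_bdd_mul (f := Dh h (a s))
    (V := fun x => ((bet γ s * (hartree γ (v s) x - hartree γ (a s) x) : ℝ) : ℂ))
    (C := C * (X * (X + 2 * A))) (by positivity) (Dh_h1 ha h).mem
    ((Complex.measurable_ofReal.comp (((cm hv).sub (cm ha)).const_mul _)).aestronglyMeasurable.mul (Dh_h1 ha h).mem.1)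
    (fun x => bet_abs_mul H.g1 _ _ _ (w3 x))
  have hl := (H.a.l1 s hs).1
  have p4 : MemLp (fun x => ((ε / 2 : ℝ) : ℂ) * Dh h (lap (a s)) x) 2 volume := (Dh_h1 hl h).mem.const_mul _
  have p4' : nrm (fun x => ((ε / 2 : ℝ) : ℂ) * Dh h (lap (a s)) x) ≤ ε / 2 * (τ * A) := by
    rw [nrm_const_mul, Complex.norm_real, Real.norm_eq_abs, abs_of_nonneg (by linarith)]
    gcongr; exact Dh_le hl j hτ (H.a.l1 s hs).2
  refine ⟨((p1.1.add p2.1).add p3.1).sub p4, ?_⟩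
  have m12 := p1.1.add p2.1
  have t1 : nrm (fun x => rr v a s (x + h)) ≤ X := by
    rw [nrm_translate hr.mem]; exact (nrm_le_H1n _).trans hX
  have t2 : nrm (fun x => a s (x + h)) ≤ A := by
    rw [nrm_translate ha.mem]; exact (nrm_le_H1n _).trans ba
  have t3 : nrm (Dh h (a s)) ≤ τ * A := Dh_le ha j hτ ba
  calc nrm (FD γ ε h v a s) ≤ _ := nrm_sub_le (m12.add p3.1)
    _ ≤ _ := add_le_add (nrm_add_le m12) le_rfl
    _ ≤ _ := add_le_add (add_le_add (nrm_add_le p1.1) le_rfl) le_rfl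
    _ ≤ (τ * (C * (2 * (X + A) ^ 2)) * X + τ * (C * (2 * (X * (X + 2 * A)))) * A + C * (X * (X + 2 * A)) * (τ * A))
        + ε / 2 * (τ * A) := by
      refine add_le_add (add_le_add (add_le_add (p1.2.trans ?_) (p2.2.trans ?_)) (p3.2.trans ?_)) p4' <;> gcongr
    _ ≤ _ := by
      unfold QQ
      have : 0 ≤ τ * (ε * A) := by positivity
      nlinarith

lemma Err.dmass {γ C ε S A : ℝ} {v a : ℝ → Rn n → ℂ} (h : Err γ C ε S A v a) {s₁ s₂ X : ℝ} (h0 : 0 ≤ s₁)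
    (h12 : s₁ ≤ s₂) (h2 : s₂ ≤ S) (hX : ∀ s ∈ Set.Icc s₁ s₂, H1n (rr v a s) ≤ X) (j : Fin n) :
    |nrm (dj j (rr v a s₂)) ^ 2 - nrm (dj j (rr v a s₁)) ^ 2| ≤ 2 * (QQ C A ε X * X) * (s₂ - s₁) := by
  have sub : ∀ s ∈ Set.Icc s₁ s₂, s ∈ Set.Icc 0 S := fun s hs => ⟨h0.trans hs.1, hs.2.trans h2⟩
  have e1 := Set.left_mem_Icc.2 h12
  have e2 := Set.right_mem_Icc.2 h12
  have hX0 : 0 ≤ X := (H1n_nonneg _).trans (hX s₁ e1)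
  have hC := h.H.1
  have hA := h.a.A0
  have hε := h.ε0
  have hQ : 0 ≤ QQ C A ε X := by unfold QQ; positivity
  have key : ∀ τ : ℝ, 0 < τ → |nrm (Dh (τ • ev j) (rr v a s₂)) ^ 2 - nrm (Dh (τ • ev j) (rr v a s₁)) ^ 2| ≤
      2 * ((τ * QQ C A ε X) * (τ * X)) * (s₂ - s₁) := by
    intro τ hτ
    refine mass_est (q := fun s => Dh (τ • ev j) (rr v a s)) (M := X + X) ((h.jc.translate _).sub h.jc) h12
      (fun s hs => ⟨Dh_h1 (h.h1 (sub s hs)) _, ?_⟩)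
      (fun s hs x => h.eqD _ s x) (fun s hs => (h.FD_le j hτ (sub s hs) (hX s hs)).1) fun s hs => ?_
    · refine (H1n_sub_le ((h.h1 (sub s hs)).translate _) (h.h1 (sub s hs))).trans ?_
      rw [H1n_translate (h.h1 (sub s hs))]
      exact add_le_add (hX s hs) (hX s hs)
    · exact mul_le_mul (h.FD_le j hτ (sub s hs) (hX s hs)).2 (Dh_le (h.h1 (sub s hs)) j hτ (hX s hs))
        (nrm_nonneg _) (by positivity)
  have l1 := diffq_tendsto (h.h1 (sub s₁ e1)) j
  have l2 := diffq_tendsto (h.h1 (sub s₂ e2)) j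
  refine le_of_tendsto ((l2.pow 2).sub (l1.pow 2)).abs (Eventually.of_forall fun k => ?_)
  have hk := key ((k : ℝ) + 1)⁻¹ (by positivity)
  have hk0 : (0:ℝ) < (k : ℝ) + 1 := by positivity
  change |(((k : ℝ) + 1) * nrm (Dh (((k : ℝ) + 1)⁻¹ • ev j) (rr v a s₂))) ^ 2
    - (((k : ℝ) + 1) * nrm (Dh (((k : ℝ) + 1)⁻¹ • ev j) (rr v a s₁))) ^ 2| ≤ _
  rw [mul_pow, mul_pow, ← mul_sub, abs_mul, abs_of_nonneg (by positivity : (0:ℝ) ≤ ((k:ℝ) + 1) ^ 2)]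
  calc _ ≤ ((k:ℝ) + 1) ^ 2 * (2 * ((((k : ℝ) + 1)⁻¹ * QQ C A ε X) * (((k : ℝ) + 1)⁻¹ * X)) * (s₂ - s₁)) := by gcongr
    _ = _ := by field_simp

/-- the squared H¹ error -/
def Phi {n : ℕ} (q : Rn n → ℂ) : ℝ := nrm q ^ 2 + ∑ j, nrm (dj j q) ^ 2

lemma Err.phi {γ C ε S A : ℝ} {v a : ℝ → Rn n → ℂ} (h : Err γ C ε S A v a) {s₁ s₂ X : ℝ} (h0 : 0 ≤ s₁)
    (h12 : s₁ ≤ s₂) (h2 : s₂ ≤ S) (hX : ∀ s ∈ Set.Icc s₁ s₂, H1n (rr v a s) ≤ X) :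
    |Phi (rr v a s₂) - Phi (rr v a s₁)| ≤ (n + 1) * (2 * (QQ C A ε X * X) * (s₂ - s₁)) := by
  have e : Phi (rr v a s₂) - Phi (rr v a s₁) = (nrm (rr v a s₂) ^ 2 - nrm (rr v a s₁) ^ 2)
      + ∑ j, (nrm (dj j (rr v a s₂)) ^ 2 - nrm (dj j (rr v a s₁)) ^ 2) := by
    unfold Phi; rw [Finset.sum_sub_distrib]; ring
  rw [e]
  refine (abs_add_le _ _).trans ?_
  have t1 := h.mass h0 h12 h2 hX
  have t2 : |∑ j, (nrm (dj j (rr v a s₂)) ^ 2 - nrm (dj j (rr v a s₁)) ^ 2)| ≤ n * (2 * (QQ C A ε X * X) * (s₂ - s₁)) := by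
    refine (Finset.abs_sum_le_sum_abs _ _).trans ((Finset.sum_le_sum fun j _ => h.dmass h0 h12 h2 hX j).trans ?_)
    simp
  linarith

lemma H1n_sq_le_Phi (q : Rn n → ℂ) : H1n q ^ 2 ≤ (n + 1) * Phi q := by
  unfold H1n Phi
  have h1 : (∑ j : Fin n, nrm (dj j q)) ^ 2 ≤ n * ∑ j, nrm (dj j q) ^ 2 := by
    have := sq_sum_le_card_mul_sum_sq (s := Finset.univ) (f := fun j : Fin n => nrm (dj j q))
    simpa using this
  set s := ∑ j : Fin n, nrm (dj j q) with hs
  set t := ∑ j : Fin n, nrm (dj j q) ^ 2 with ht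
  have ht0 : 0 ≤ t := Finset.sum_nonneg fun j _ => sq_nonneg _
  rcases Nat.eq_zero_or_pos n with hn | hn
  · subst hn; simp at hs ht; rw [hs, ht]; simp
  have hn' : (0:ℝ) < n := by exact_mod_cast hn
  -- (a+s)^2 ≤ (1+n) a^2 + (1+1/n) s^2
  have h2 : 0 ≤ (n * nrm q - s) ^ 2 := sq_nonneg _
  have h3 : n * (nrm q + s) ^ 2 ≤ n * ((n + 1) * (nrm q ^ 2 + t)) := by nlinarith
  exact le_of_mul_le_mul_left h3 hn'
end

section
variable {n : ℕ}

/-- a bootstrap version of Gronwall's inequality -/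
lemma bootstrap {Ψ : ℝ → ℝ} {S K η : ℝ} (hc : ContinuousOn Ψ (Set.Icc 0 S)) (hK : 0 ≤ K)
    (h0 : Ψ 0 ≤ η) (hη : η * Real.exp (K * S) < 1) (hη0 : 0 ≤ η)
    (hstep : ∀ s₁ s₂ m, 0 ≤ s₁ → s₁ ≤ s₂ → s₂ ≤ S → m ≤ 1 → (∀ s ∈ Set.Icc s₁ s₂, Ψ s ≤ m) →
      Ψ s₂ ≤ Ψ s₁ + K * m * (s₂ - s₁)) :
    ∀ s ∈ Set.Icc 0 S, Ψ s ≤ η * Real.exp (K * S) := by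
  have hcf : ContinuousOn (fun s => min (Ψ s) 1) (Set.Icc 0 S) := hc.inf continuousOn_const
  have hg := le_gronwallBound_of_liminf_deriv_right_le (f := fun s => min (Ψ s) 1)
    (f' := fun s => K * min (Ψ s) 1) (δ := η) (K := K) (ε := 0) hcf (fun x hx r hr => by
      refine Eventually.frequently ?_
      rcases le_or_gt 1 (Ψ x) with h1 | h1
      · filter_upwards [self_mem_nhdsWithin] with z hz
        have hz' : 0 < z - x := sub_pos.2 hz
        have e : min (Ψ x) 1 = 1 := min_eq_right h1
        simp only [e] at hr ⊢
        have h2 : min (Ψ z) 1 - 1 ≤ 0 := by linarith [min_le_right (Ψ z) 1]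
        have h3 : (z - x)⁻¹ * (min (Ψ z) 1 - 1) ≤ 0 := mul_nonpos_of_nonneg_of_nonpos (by positivity) h2
        linarith
      · have e : min (Ψ x) 1 = Ψ x := min_eq_left h1.le
        simp only [e] at hr ⊢
        have hm : ∀ᶠ m in 𝓝[>] (Ψ x), m < 1 ∧ K * m < r := by
          have t1 : ∀ᶠ m in 𝓝 (Ψ x), m < 1 := Iio_mem_nhds h1
          have t2 : ∀ᶠ m in 𝓝 (Ψ x), K * m < r :=
            ((continuous_const.mul continuous_id).tendsto (Ψ x)).eventually (Iio_mem_nhds hr)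
          exact nhdsWithin_le_nhds (t1.and t2)
        obtain ⟨m, ⟨hm1, hm2⟩, hm3⟩ := (hm.and self_mem_nhdsWithin).exists
        have hx' : x ∈ Set.Icc 0 S := ⟨hx.1, hx.2.le⟩
        have hlt : ∀ᶠ z in 𝓝[Set.Icc 0 S] x, Ψ z < m := (hc x hx').eventually (Iio_mem_nhds hm3)
        have hlt2 : ∀ᶠ z in 𝓝[≥] x, z ∈ Set.Icc 0 S → Ψ z < m := by
          have := eventually_nhdsWithin_iff.1 hlt
          exact nhdsWithin_le_nhds this
        obtain ⟨w, hw, hws⟩ := mem_nhdsGE_iff_exists_Ico_subset.1 hlt2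
        have hmem : Set.Ioo x (min w S) ∈ 𝓝[>] x := Ioo_mem_nhdsGT (lt_min hw hx.2)
        filter_upwards [hmem] with z hz
        have hz' : 0 < z - x := sub_pos.2 hz.1
        have hzS : z < S := hz.2.trans_le (min_le_right _ _)
        have hzw : z < w := hz.2.trans_le (min_le_left _ _)
        have := hstep x z m hx.1 hz.1.le hzS.le hm1.le (fun s hs =>
          (hws ⟨hs.1, hs.2.trans_lt hzw⟩ ⟨hx.1.trans hs.1, hs.2.trans hzS.le⟩).le)
        have h2 : min (Ψ z) 1 - Ψ x ≤ K * m * (z - x) := by linarith [min_le_left (Ψ z) 1]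
        calc (z - x)⁻¹ * (min (Ψ z) 1 - Ψ x) ≤ (z - x)⁻¹ * (K * m * (z - x)) := by gcongr
          _ = K * m := by field_simp
          _ < r := hm2)
    ((min_le_left _ _).trans h0) (fun x _ => by simp)
  intro s hs
  have h1 := hg s hs
  rw [gronwallBound_ε0, sub_zero] at h1
  have h2 : η * Real.exp (K * s) ≤ η * Real.exp (K * S) := by
    have := hs.2
    gcongr
  have h3 : min (Ψ s) 1 < 1 := by linarith
  have h4 : min (Ψ s) 1 = Ψ s := by
    rcases min_choice (Ψ s) 1 with h | h
    · exact h
    · rw [h] at h3; exact absurd h3 (lt_irrefl _)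
  linarith

lemma Phi_nonneg (q : Rn n → ℂ) : 0 ≤ Phi q := by unfold Phi; positivity

def K1 (n : ℕ) (C A : ℝ) : ℝ := C * (2 * (n + 1 + A) ^ 2 + 3 * (n + 1 + 2 * A) * A) + A

lemma K1_nonneg {C A : ℝ} (hC : 0 ≤ C) (hA : 0 ≤ A) : 0 ≤ K1 n C A := by unfold K1; positivity

lemma QQ_le {C A ε X : ℝ} (hC : 0 ≤ C) (hA : 0 ≤ A) (hε : 0 ≤ ε) (hX : 0 ≤ X) (hX1 : X ≤ n + 1) :
    QQ C A ε X ≤ K1 n C A * (X + ε) := by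
  unfold QQ K1
  have h1 : C * (2 * (X + A) ^ 2 * X + 3 * (X * (X + 2 * A)) * A) ≤
      C * (2 * (n + 1 + A) ^ 2 * X + 3 * (X * (n + 1 + 2 * A)) * A) := by gcongr
  have h2 : 0 ≤ C * (2 * (n + 1 + A) ^ 2 + 3 * (n + 1 + 2 * A) * A) * ε := by positivity
  have h3 : 0 ≤ A * X := by positivity
  nlinarith

def K2 (n : ℕ) (C A : ℝ) : ℝ := 4 * (n + 1) * (n + 2) * K1 n C A

lemma Err.bdd {γ C ε S A : ℝ} {v a : ℝ → Rn n → ℂ} (h : Err γ C ε S A v a) :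
    ∃ M, 0 ≤ M ∧ ∀ s ∈ Set.Icc 0 S, H1n (rr v a s) ≤ M ∧ MemLp (xw (rr v a s)) 2 volume ∧ nrm (xw (rr v a s)) ≤ M := by
  obtain ⟨M, hM0, hM⟩ := h.v.bdd 0 S
  refine ⟨M + A, add_nonneg hM0 h.a.A0, fun s hs => ?_⟩
  have e : xw (rr v a s) = fun x => xw (v s) x - xw (a s) x := by
    funext x; unfold xw rr; ring
  refine ⟨?_, ?_, ?_⟩
  · exact (H1n_sub_le (h.v.h1 s) (h.a.h1 s hs).1).trans
      (add_le_add ((H1n_le_Nn _).trans (hM s hs)) (h.a.h1 s hs).2)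
  · rw [e]; exact (h.v.xm s).sub (h.a.xm s hs).1
  · rw [e]
    exact (nrm_sub_le (h.v.xm s)).trans (add_le_add ((nrm_xw_le_Nn _).trans (hM s hs)) (h.a.xm s hs).2)

lemma Phi_rr_zero {v a : ℝ → Rn n → ℂ} (h0 : v 0 = a 0) : rr v a 0 = fun _ => 0 := by
  funext x; simp [rr, h0]

lemma nrm_zero' : nrm (fun _ : Rn n => (0 : ℂ)) = 0 := by
  have := nrm_const_mul (n := n) 0 (fun _ => 0)
  simpa using this

lemma Phi_zero : Phi (fun _ : Rn n => (0 : ℂ)) = 0 := by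
  have : ∀ j : Fin n, dj j (fun _ : Rn n => (0 : ℂ)) = fun _ => 0 := fun j => by
    funext x; simp [dj]
  simp [Phi, this, nrm_zero']

lemma Err.h1_small {γ C ε S A : ℝ} {v a : ℝ → Rn n → ℂ} (h : Err γ C ε S A v a) (hv : v 0 = a 0)
    (hε : ε ^ 2 * Real.exp (K2 n C A * S) < 1) :
    ∀ s ∈ Set.Icc 0 S, H1n (rr v a s) ≤ ε * √((n + 1) * Real.exp (K2 n C A * S)) := by
  have hC := h.H.1
  have hA := h.a.A0
  have hε0 := h.ε0
  have hK1 : 0 ≤ K1 n C A := K1_nonneg hC hA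
  have hK2 : 0 ≤ K2 n C A := by unfold K2; positivity
  obtain ⟨M, hM0, hM⟩ := h.bdd
  have hQ0 : ∀ X, 0 ≤ X → 0 ≤ QQ C A ε X := fun X hX => by unfold QQ; positivity
  have hcont : ContinuousOn (fun s => Phi (rr v a s)) (Set.Icc 0 S) := by
    have hL : 0 ≤ ((n : ℝ) + 1) * (2 * (QQ C A ε M * M)) := by
      have := hQ0 M hM0
      positivity
    refine LipschitzOnWith.continuousOn (K := Real.toNNReal (((n : ℝ) + 1) * (2 * (QQ C A ε M * M)))) (LipschitzOnWith.of_dist_le_mul fun x hx y hy => ?_)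
    rw [Real.dist_eq, Real.dist_eq, Real.coe_toNNReal _ hL]
    rcases le_total x y with hxy | hxy
    · have := h.phi hx.1 hxy hy.2 (X := M) (fun s hs => (hM s ⟨hx.1.trans hs.1, hs.2.trans hy.2⟩).1)
      rw [abs_sub_comm, abs_sub_comm x y, abs_of_nonneg (sub_nonneg.2 hxy)]
      linarith
    · have := h.phi hy.1 hxy hx.2 (X := M) (fun s hs => (hM s ⟨hy.1.trans hs.1, hs.2.trans hx.2⟩).1)
      rw [abs_of_nonneg (sub_nonneg.2 hxy)]
      linarith
  have hb := bootstrap (Ψ := fun s => Phi (rr v a s) + ε ^ 2) (S := S) (K := K2 n C A) (η := ε ^ 2)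
    (hcont.add continuousOn_const) hK2 (by simp [Phi_rr_zero hv, Phi_zero]) hε (sq_nonneg _)
    (fun s₁ s₂ m h1 h12 h2 hm hs => by
      have hm0 : 0 ≤ m := by
        have h3 := hs s₁ ⟨le_rfl, h12⟩
        have h4 := Phi_nonneg (rr v a s₁)
        have h5 := sq_nonneg ε
        linarith
      set X : ℝ := √((n + 1) * m) with hXd
      have hX0 : 0 ≤ X := Real.sqrt_nonneg _
      have hXsq : X ^ 2 = (n + 1) * m := Real.sq_sqrt (by positivity)
      have hn0 : (0 : ℝ) ≤ n := Nat.cast_nonneg n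
      have hX1 : X ≤ n + 1 := by
        refine Real.sqrt_le_iff.2 ⟨by positivity, ?_⟩
        nlinarith
      have hXs : ∀ s ∈ Set.Icc s₁ s₂, H1n (rr v a s) ≤ X := fun s hs' => by
        refine Real.le_sqrt_of_sq_le ((H1n_sq_le_Phi _).trans ?_)
        have h3 := hs s hs'
        have : Phi (rr v a s) ≤ m := by nlinarith [sq_nonneg ε]
        gcongr
      have hεm : ε ^ 2 ≤ m := by
        have h3 := hs s₁ ⟨le_rfl, h12⟩
        have h4 := Phi_nonneg (rr v a s₁)
        linarith
      have hphi := (abs_le.1 (h.phi h1 h12 h2 hXs)).2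
      have hq : QQ C A ε X * X ≤ K1 n C A * (2 * ((n + 2) * m)) := by
        calc QQ C A ε X * X ≤ (K1 n C A * (X + ε)) * X := by
              have := QQ_le (n := n) hC hA hε0.le hX0 hX1
              gcongr
          _ = K1 n C A * ((X + ε) * X) := by ring
          _ ≤ K1 n C A * (2 * ((n + 2) * m)) := by
              refine mul_le_mul_of_nonneg_left ?_ hK1
              nlinarith [sq_nonneg (X - ε)]
      have h12' : 0 ≤ s₂ - s₁ := sub_nonneg.2 h12
      have : ((n : ℝ) + 1) * (2 * (QQ C A ε X * X) * (s₂ - s₁)) ≤ K2 n C A * m * (s₂ - s₁) := by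
        calc _ ≤ ((n : ℝ) + 1) * (2 * (K1 n C A * (2 * ((n + 2) * m))) * (s₂ - s₁)) := by gcongr
          _ = _ := by unfold K2; ring
      linarith)
  intro s hs
  have h1 := hb s hs
  have h2 := H1n_sq_le_Phi (rr v a s)
  have e : ε * √((n + 1) * Real.exp (K2 n C A * S)) = √((n + 1) * (ε ^ 2 * Real.exp (K2 n C A * S))) := by
    rw [show (n + 1 : ℝ) * (ε ^ 2 * Real.exp (K2 n C A * S)) = ε ^ 2 * ((n + 1) * Real.exp (K2 n C A * S)) by ring,
      Real.sqrt_mul (sq_nonneg _), Real.sqrt_sq hε0.le]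
  rw [e]
  refine Real.le_sqrt_of_sq_le (h2.trans ?_)
  have : Phi (rr v a s) ≤ ε ^ 2 * Real.exp (K2 n C A * S) := by
    linarith [sq_nonneg ε]
  gcongr

/-- the weight -/
def psi (n : ℕ) (R : ℝ) (x : Rn n) : ℂ := chi n R x * ((‖x‖ ^ 2 : ℝ) : ℂ)

lemma nsq_contDiff : ContDiff ℝ 1 (fun x : Rn n => ((‖x‖ ^ 2 : ℝ) : ℂ)) :=
  Complex.ofRealCLM.contDiff.comp (contDiff_norm_sq ℝ)

lemma dj_nsq (j : Fin n) : dj j (fun x : Rn n => ((‖x‖ ^ 2 : ℝ) : ℂ)) = fun x => ((2 * x j : ℝ) : ℂ) := by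
  ext y
  have h1 : HasFDerivAt (fun y : Rn n => ‖y‖ ^ 2) (2 • innerSL ℝ y) y :=
    (hasStrictFDerivAt_norm_sq y).hasFDerivAt
  have h2 := Complex.ofRealCLM.hasFDerivAt.comp y h1
  unfold dj
  have h4 : fderiv ℝ (fun x : Rn n => ((‖x‖ ^ 2 : ℝ) : ℂ)) y = _ := h2.fderiv
  rw [h4]
  simp [EuclideanSpace.inner_single_right]

lemma psi_contDiff (R : ℝ) : ContDiff ℝ 1 (psi n R) := (chi_contDiff R 1).mul nsq_contDiff

lemma psi_compact {R : ℝ} (hR : 0 < R) : HasCompactSupport (psi n R) := (chi_compact hR).mul_right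

lemma psi_norm_le (R : ℝ) (x : Rn n) : ‖psi n R x‖ ≤ ‖x‖ ^ 2 := by
  unfold psi
  rw [norm_mul, Complex.norm_real, Real.norm_eq_abs, abs_of_nonneg (by positivity)]
  exact mul_le_of_le_one_left (by positivity) (chi_norm_le R x)

lemma exists_psi_deriv (n : ℕ) : ∃ D, 0 ≤ D ∧ ∀ R : ℝ, 0 < R → ∀ (x : Rn n) (j : Fin n),
    ‖dj j (psi n R) x‖ ≤ D * ‖x‖ := by
  obtain ⟨C, hC, h⟩ := exists_chi_deriv n
  refine ⟨C + 2, by positivity, fun R hR x j => ?_⟩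
  have e : dj j (psi n R) = _ := dj_mul ((chi_contDiff R 1).differentiable (by norm_num)) (nsq_contDiff.differentiable (by norm_num))
  rw [e, dj_nsq]
  refine (norm_add_le _ _).trans ?_
  rw [norm_mul, norm_mul, Complex.norm_real, Complex.norm_real, Real.norm_eq_abs, Real.norm_eq_abs,
    abs_of_nonneg (by positivity : 0 ≤ ‖x‖ ^ 2), abs_mul, abs_two]
  have h1 := chi_norm_le R x
  have h2 := coord_le_norm x j
  have h3 := (h R hR x j).2
  calc _ ≤ 1 * (2 * ‖x‖) + ‖x‖ * (‖x‖ * ‖dj j (chi n R) x‖) := by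
        refine add_le_add ?_ (by rw [sq]; linarith)
        gcongr
    _ ≤ 1 * (2 * ‖x‖) + ‖x‖ * C := by gcongr
    _ = _ := by ring

lemma norm_xw (h : Rn n → ℂ) (x : Rn n) : ‖xw h x‖ = ‖x‖ * ‖h x‖ := by
  unfold xw; rw [norm_mul, Complex.norm_real, norm_norm]

/-- the weighted energy estimate -/
lemma wmass_est (n : ℕ) : ∃ D, 0 ≤ D ∧ ∀ {q F' : ℝ → Rn n → ℂ} {V : ℝ → Rn n → ℝ} {ε a b X Y G : ℝ},
    JC 2 q → 0 ≤ ε → a ≤ b →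
    (∀ s ∈ Set.Icc a b, IsH1 (q s) ∧ H1n (q s) ≤ X) →
    (∀ s ∈ Set.Icc a b, MemLp (xw (q s)) 2 volume ∧ nrm (xw (q s)) ≤ Y) →
    (∀ s ∈ Set.Icc a b, ∀ x, FF ε q s x = (V s x : ℂ) * q s x + F' s x) →
    (∀ s ∈ Set.Icc a b, MemLp (xw (F' s)) 2 volume ∧ nrm (xw (F' s)) ≤ G) →
    |nrm (xw (q b)) ^ 2 - nrm (xw (q a)) ^ 2| ≤ (ε * D * X + 2 * G) * Y * (b - a) := by
  obtain ⟨D, hD, hpsi⟩ := exists_psi_deriv n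
  refine ⟨n * D, by positivity, fun {q F' V ε a b X Y G} hq hε hab H1 Hx HF HG => ?_⟩
  have ha : a ∈ Set.Icc a b := ⟨le_rfl, hab⟩
  have hb : b ∈ Set.Icc a b := ⟨hab, le_rfl⟩
  have hX : 0 ≤ X := (H1n_nonneg _).trans (H1 a ha).2
  have hY : 0 ≤ Y := (nrm_nonneg _).trans (Hx a ha).2
  have hG : 0 ≤ G := (nrm_nonneg _).trans (HG a ha).2
  have hkey : ∀ k : ℕ, ‖(∫ x, psi n ((k : ℝ) + 1) x * (q b x * conj (q b x)))
      - (∫ x, psi n ((k : ℝ) + 1) x * (q a x * conj (q a x)))‖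
      ≤ ((ε * (n * D) * X + 2 * G) * Y) * (b - a) := by
    intro k
    have hpos : 0 < (k : ℝ) + 1 := by positivity
    refine norm_image_sub_le_of_norm_deriv_le_segment'
      (fun s hs => (lemmaD hq hq (psi_contDiff _) (psi_compact hpos) ε s).hasDerivWithinAt) (fun s hs' => ?_) b hb
    have hs : s ∈ Set.Icc a b := ⟨hs'.1, hs'.2.le⟩
    have h3 : ‖∑ j, ∫ x, dj j (psi n ((k : ℝ) + 1)) x * flux (q s) (q s) j x‖ ≤ n * (D * (2 * (Y * X))) := by
      refine (norm_sum_le _ _).trans ?_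
      refine (Finset.sum_le_card_nsmul _ _ (D * (2 * (Y * X))) fun j _ => ?_).trans (by simp)
      have h1 := l2_cs (Hx s hs).1 ((H1 s hs).1.dmem j)
      refine (norm_integral_le_of_norm_le (h1.1.const_mul (2 * D)) (Eventually.of_forall fun x => ?_)).trans ?_
      · unfold flux
        rw [norm_mul, norm_xw]
        have t1 := hpsi _ hpos x j
        have t2 : ‖dj j (q s) x * conj (q s x) - q s x * conj (dj j (q s) x)‖ ≤ 2 * (‖q s x‖ * ‖dj j (q s) x‖) := by
          refine (norm_sub_le _ _).trans (le_of_eq ?_)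
          rw [norm_mul, norm_mul, Complex.norm_conj, Complex.norm_conj]; ring
        calc _ ≤ (D * ‖x‖) * (2 * (‖q s x‖ * ‖dj j (q s) x‖)) := by gcongr
          _ = _ := by ring
      · rw [integral_const_mul]
        have t1 : nrm (xw (q s)) * nrm (dj j (q s)) ≤ Y * X :=
          mul_le_mul (Hx s hs).2 ((nrm_dj_le_H1n _ _).trans (H1 s hs).2) (nrm_nonneg _) hY
        calc _ ≤ 2 * D * (Y * X) := by
              refine mul_le_mul_of_nonneg_left (h1.2.trans t1) (by positivity)
          _ = _ := by ring
    have h4 : ‖∫ x, psi n ((k : ℝ) + 1) x * (FF ε q s x * conj (q s x) - q s x * conj (FF ε q s x))‖ ≤ 2 * (G * Y) := by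
      have h1 := l2_cs (HG s hs).1 (Hx s hs).1
      refine (norm_integral_le_of_norm_le (h1.1.const_mul 2) (Eventually.of_forall fun x => ?_)).trans ?_
      · rw [HF s hs x, norm_mul, norm_xw, norm_xw]
        have e : ((V s x : ℂ) * q s x + F' s x) * conj (q s x)
            - q s x * conj ((V s x : ℂ) * q s x + F' s x)
            = F' s x * conj (q s x) - q s x * conj (F' s x) := by
          simp only [map_add, map_mul, Complex.conj_ofReal]; ring
        rw [e]
        have t2 : ‖F' s x * conj (q s x) - q s x * conj (F' s x)‖ ≤ 2 * (‖F' s x‖ * ‖q s x‖) := by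
          refine (norm_sub_le _ _).trans (le_of_eq ?_)
          rw [norm_mul, norm_mul, Complex.norm_conj, Complex.norm_conj]; ring
        calc _ ≤ ‖x‖ ^ 2 * (2 * (‖F' s x‖ * ‖q s x‖)) := by
              gcongr
              exact psi_norm_le _ _
          _ = _ := by ring
      · rw [integral_const_mul]
        have t1 : nrm (xw (F' s)) * nrm (xw (q s)) ≤ G * Y :=
          mul_le_mul (HG s hs).2 (Hx s hs).2 (nrm_nonneg _) hG
        linarith [h1.2]
    refine (norm_sub_le _ _).trans ?_
    rw [norm_mul, norm_neg, norm_mul, Complex.norm_I, one_mul, Complex.norm_real, Real.norm_eq_abs,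
      abs_of_nonneg (by positivity), norm_mul, Complex.norm_I, one_mul]
    calc _ ≤ ε / 2 * (n * (D * (2 * (Y * X)))) + 2 * (G * Y) := by gcongr
      _ = _ := by ring
  have hIntg : ∀ s ∈ Set.Icc a b, Tendsto (fun k : ℕ => ∫ x, psi n ((k : ℝ) + 1) x * (q s x * conj (q s x)))
      atTop (𝓝 ((nrm (xw (q s)) ^ 2 : ℝ) : ℂ)) := fun s hs => by
    have := chi_pr_tendsto (pr_integrable (Hx s hs).1 (Hx s hs).1)
    have e := pr_self (Hx s hs).1
    unfold pr at e
    rw [e] at this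
    refine this.congr fun k => ?_
    congr 1; funext x
    unfold psi xw
    rw [map_mul, Complex.conj_ofReal]; push_cast; ring
  have hl := ((hIntg b hb).sub (hIntg a ha)).norm
  have := le_of_tendsto' hl hkey
  rwa [← Complex.ofReal_sub, Complex.norm_real, Real.norm_eq_abs] at this

lemma sup_trick {I : Set ℝ} {g : ℝ → ℝ} {Z M : ℝ} (hg : ∀ s ∈ I, 0 ≤ g s) (hM : ∀ s ∈ I, g s ≤ M)
    (h : ∀ Y, (∀ s ∈ I, g s ≤ Y) → ∀ s ∈ I, g s ^ 2 ≤ Z * Y) (hZ : 0 ≤ Z) : ∀ s ∈ I, g s ≤ Z := by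
  intro s hs
  have hbdd : BddAbove (g '' I) := ⟨M, by rintro _ ⟨t, ht, rfl⟩; exact hM t ht⟩
  set Y := sSup (g '' I) with hY
  have hle : ∀ t ∈ I, g t ≤ Y := fun t ht => le_csSup hbdd ⟨t, ht, rfl⟩
  have hY0 : 0 ≤ Y := (hg s hs).trans (hle s hs)
  have h1 : Y ≤ √(Z * Y) := csSup_le ⟨_, s, hs, rfl⟩ (by
    rintro _ ⟨t, ht, rfl⟩
    exact Real.le_sqrt_of_sq_le (h Y hle t ht))
  have h2 : Y ^ 2 ≤ Z * Y := (Real.le_sqrt hY0 (by positivity)).1 h1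
  refine (hle s hs).trans ?_
  by_contra hlt
  push Not at hlt
  nlinarith

lemma Err.xw_small {n : ℕ} : ∃ D, 0 ≤ D ∧ ∀ {γ C ε S A : ℝ} {v a : ℝ → Rn n → ℂ}, Err γ C ε S A v a → 0 ≤ S → v 0 = a 0 →
    ∀ {X : ℝ}, (∀ s ∈ Set.Icc 0 S, H1n (rr v a s) ≤ X) →
    ∀ s ∈ Set.Icc 0 S, MemLp (xw (rr v a s)) 2 volume ∧
      nrm (xw (rr v a s)) ≤ S * (ε * D * X + 2 * (C * (X * (X + 2 * A)) * A + ε / 2 * A)) := by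
  obtain ⟨D, hD, hw⟩ := wmass_est n
  refine ⟨D, hD, fun {γ C ε S A v a} h hS hv X hX => ?_⟩
  obtain ⟨M, hM0, hM⟩ := h.bdd
  have hX0 : 0 ≤ X := (H1n_nonneg _).trans (hX 0 ⟨le_rfl, hS⟩)
  have hC := h.H.1
  have hA := h.a.A0
  have hε0 := h.ε0
  have hZ : 0 ≤ ε * D * X + 2 * (C * (X * (X + 2 * A)) * A + ε / 2 * A) := by positivity
  have key := sup_trick (I := Set.Icc 0 S) (g := fun s => nrm (xw (rr v a s))) (M := M)
    (Z := S * (ε * D * X + 2 * (C * (X * (X + 2 * A)) * A + ε / 2 * A)))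
    (fun s _ => nrm_nonneg _) (fun s hs => (hM s hs).2.2) (fun Y hY s hs => by
      have sub : ∀ r ∈ Set.Icc 0 s, r ∈ Set.Icc 0 S := fun r hr => ⟨hr.1, hr.2.trans hs.2⟩
      have := hw (V := fun s x => bet γ s * hartree γ (v s) x) (F' := GG γ ε v a) (X := X) (Y := Y)
        (G := C * (X * (X + 2 * A)) * A + ε / 2 * A) h.jc hε0.le hs.1
        (fun r hr => ⟨h.h1 (sub r hr), hX r (sub r hr)⟩)
        (fun r hr => ⟨(hM r (sub r hr)).2.1, hY r (sub r hr)⟩)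
        (fun r hr x => h.eq r x)
        (fun r hr => h.G_le (sub r hr) (hX r (sub r hr)) (ω := fun x => ((‖x‖ : ℝ) : ℂ))
          (Complex.continuous_ofReal.comp continuous_norm)
          (h.a.xm r (sub r hr)).1 (h.a.lx r (sub r hr)).1 (h.a.xm r (sub r hr)).2 (h.a.lx r (sub r hr)).2)
      have e0 : nrm (xw (rr v a 0)) = 0 := by
        have : xw (rr v a 0) = fun _ => 0 := by
          rw [Phi_rr_zero hv]; funext x; simp [xw]
        rw [this, nrm_zero']
      have hY0 : 0 ≤ Y := (nrm_nonneg _).trans (hY s hs)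
      rw [e0] at this
      have h3 := (abs_le.1 this).2
      simp only [ne_eq, OfNat.ofNat_ne_zero, not_false_eq_true, zero_pow, sub_zero] at h3
      refine h3.trans ?_
      calc _ ≤ (ε * D * X + 2 * (C * (X * (X + 2 * A)) * A + ε / 2 * A)) * Y * S := by
            have := hs.2
            gcongr
        _ = _ := by ring) (by positivity)
  exact fun s hs => ⟨(hM s hs).2.1, key s hs⟩
end

section
variable {n : ℕ}

lemma lensv_zero (ε : ℝ) (u : ℝ → Rn n → ℂ) : lensv ε u 0 = u 0 := by
  funext y
  simp [lensv, Lens, cc, mm, ss, chirp]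

lemma main_est (hn : 2 ≤ n) {γ : ℝ} (hγ0 : 0 < γ) (hγ1 : γ < 1) (f : SchwartzMap (Rn n) ℂ) {S : ℝ} (hS : 0 ≤ S) :
    ∃ K ε₀, 0 ≤ K ∧ 0 < ε₀ ∧ ∀ ε, 0 < ε → ε ≤ 1 → ε < ε₀ → ∀ u, IsSolutionH n 1 γ ε (⇑f) u → ∀ s ∈ Set.Icc 0 S,
      IsH1 (rr (lensv ε u) (prof γ (⇑f)) s) ∧ MemLp (xw (rr (lensv ε u) (prof γ (⇑f)) s)) 2 volume ∧
      H1n (rr (lensv ε u) (prof γ (⇑f)) s) ≤ K * ε ∧ nrm (xw (rr (lensv ε u) (prof γ (⇑f)) s)) ≤ K * ε := by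
  obtain ⟨C, H⟩ := exists_hardyC hn hγ0 hγ1
  obtain ⟨A, P⟩ := H.exists_prof hγ0 f S
  obtain ⟨D, hD, hx⟩ := Err.xw_small (n := n)
  have hC := H.1
  have hA := P.A0
  set L : ℝ := √((n + 1) * Real.exp (K2 n C A * S)) with hL
  have hL0 : 0 ≤ L := Real.sqrt_nonneg _
  set K' : ℝ := S * (D * L + 2 * (C * (L * (L + 2 * A)) * A + A / 2)) with hK'
  have hK0 : 0 ≤ K' := by positivity
  refine ⟨L + K', Real.exp (-(K2 n C A * S)), by positivity, Real.exp_pos _, fun ε hε hε1 hεs u hu s hs => ?_⟩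
  have E : Err γ C ε S A (lensv ε u) (prof γ (⇑f)) :=
    ⟨H, hγ1, hε, lensv_vsol hε H (sol_of_isSolutionH hε hu), P⟩
  have h0 : lensv ε u 0 = prof γ (⇑f) 0 := by rw [lensv_zero, prof_zero, hu.init]
  have hsm : ε ^ 2 * Real.exp (K2 n C A * S) < 1 := by
    have h1 : ε ^ 2 ≤ ε := by nlinarith
    calc ε ^ 2 * Real.exp (K2 n C A * S) ≤ ε * Real.exp (K2 n C A * S) := by gcongr
      _ < Real.exp (-(K2 n C A * S)) * Real.exp (K2 n C A * S) := by gcongr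
      _ = 1 := by rw [← Real.exp_add]; simp
  have h1 := E.h1_small h0 hsm
  have h2 := hx E hS h0 h1 s hs
  refine ⟨E.h1 hs, h2.1, (h1 s hs).trans ?_, h2.2.trans ?_⟩
  · rw [← hL]; nlinarith
  · rw [← hL]
    have hεL : ε * L ≤ L := mul_le_of_le_one_left hL0 hε1
    calc S * (ε * D * (ε * L) + 2 * (C * (ε * L * (ε * L + 2 * A)) * A + ε / 2 * A))
        ≤ S * (ε * D * L + 2 * (C * (ε * L * (L + 2 * A)) * A + ε / 2 * A)) := by gcongr
      _ = K' * ε := by rw [hK']; ring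
      _ ≤ (L + K') * ε := by nlinarith

lemma tht_tan {γ τ : ℝ} (h0 : 0 ≤ τ) (h1 : τ < π / 2) :
    tht γ (Real.tan τ) = -∫ σ in (0 : ℝ)..τ, |Real.cos σ| ^ (-γ) := by
  have hcos : ∀ x ∈ Set.uIcc 0 τ, 0 < Real.cos x := fun x hx => by
    rw [Set.uIcc_of_le h0] at hx
    exact Real.cos_pos_of_mem_Ioo ⟨by linarith [hx.1, Real.pi_pos], by linarith [hx.2]⟩
  have hb : Continuous (bet γ) := (rpow_cc_contDiff 0 (2 - γ)).continuous
  have h := intervalIntegral.integral_comp_mul_deriv (a := 0) (b := τ) (f := Real.tan) (f' := fun x => 1 / Real.cos x ^ 2)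
    (g := bet γ) (fun x hx => Real.hasDerivAt_tan (hcos x hx).ne')
    (ContinuousOn.div continuousOn_const (Real.continuous_cos.pow 2).continuousOn (fun x hx => by
      have := hcos x hx; positivity)) hb
  rw [Real.tan_zero] at h
  unfold tht
  rw [← h]
  congr 1
  refine intervalIntegral.integral_congr fun x hx => ?_
  have hc := hcos x hx
  have hx' := hx
  rw [Set.uIcc_of_le h0] at hx'
  have e : cc (Real.tan x) = Real.cos x := by
    rw [← cos_arctan_cc, Real.arctan_tan (by linarith [hx'.1, Real.pi_pos]) (by linarith [hx'.2])]
  simp only [Function.comp, bet, e, abs_of_pos hc]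
  rw [show (2 - γ) = (-γ) + (2 : ℕ) by push_cast; ring, Real.rpow_add_natCast hc.ne']
  field_simp

/-- the error in the original variables is the inverse lens transform of the error in the new ones -/
lemma wkb_eq {γ ε τ : ℝ} (h0 : 0 ≤ τ) (h1 : τ < π / 2) (f : Rn n → ℂ) (u : ℝ → Rn n → ℂ) :
    (fun x => u τ x - wkbProfile n γ f ε τ x) =
      Lens (Real.cos τ ^ (-(n : ℝ) / 2)) (Real.cos τ)⁻¹ (-(Real.tan τ / (2 * ε)))
        (rr (lensv ε u) (prof γ f) (Real.tan τ)) := by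
  have hc : 0 < Real.cos τ := Real.cos_pos_of_mem_Ioo ⟨by linarith [Real.pi_pos], h1⟩
  have ea : Real.arctan (Real.tan τ) = τ := Real.arctan_tan (by linarith [Real.pi_pos]) h1
  have e : cc (Real.tan τ) = Real.cos τ := by rw [← cos_arctan_cc, ea]
  funext x
  have hm : Real.cos τ ^ (-(n : ℝ) / 2) * mm n (Real.tan τ) = 1 := by
    unfold mm
    rw [e, ← Real.rpow_add hc]
    simp [neg_div]
  have hm' : ((Real.cos τ ^ (-(n : ℝ) / 2) : ℝ) : ℂ) * ((mm n (Real.tan τ) : ℝ) : ℂ) = 1 := by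
    exact_mod_cast hm
  have p1 : Lens (mm n (Real.tan τ)) (cc (Real.tan τ)) (ss ε (Real.tan τ)) (u τ) ((Real.cos τ)⁻¹ • x) =
      ((mm n (Real.tan τ) : ℝ) : ℂ) * u τ x * chirp (Real.tan τ / (2 * ε)) x := by
    unfold Lens chirp ss
    rw [e, smul_smul, mul_inv_cancel₀ hc.ne', one_smul, norm_smul, norm_inv, Real.norm_eq_abs, abs_of_pos hc]
    congr 4
    field_simp
  have p2 : chirp (Real.tan τ / (2 * ε)) x * chirp (-(Real.tan τ / (2 * ε))) x = 1 := by
    unfold chirp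
    rw [← Complex.exp_add, ← Complex.exp_zero]
    congr 1; push_cast; ring
  have p3 : wkbProfile n γ f ε τ x = ((Real.cos τ ^ (-(n : ℝ) / 2) : ℝ) : ℂ) *
      prof γ f (Real.tan τ) ((Real.cos τ)⁻¹ • x) * chirp (-(Real.tan τ / (2 * ε))) x := by
    unfold wkbProfile prof chirp gphase
    rw [tht_tan h0 h1]
    rw [mul_assoc, mul_assoc, mul_assoc, ← Complex.exp_add]
    congr 3
    unfold hartree
    push_cast; ring
  rw [p3]
  unfold Lens rr lensv
  rw [ea, p1]
  linear_combination (-(u τ x)) * hm' - ((Real.cos τ ^ (-(n : ℝ) / 2) : ℝ) : ℂ) * ((mm n (Real.tan τ) : ℝ) : ℂ) * u τ x * p2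
end

section
variable {n : ℕ}

lemma euclid_norm_le (v : EuclideanSpace ℂ (Fin n)) : ‖v‖ ≤ ∑ j, ‖v j‖ := by
  rw [EuclideanSpace.norm_eq]
  exact Real.sqrt_le_iff.2 ⟨by positivity, Finset.sum_sq_le_sq_sum_of_nonneg fun j _ => norm_nonneg _⟩

lemma eLpNorm_euclid_le {F : Rn n → Fin n → ℂ} {B : ℝ} (hB : 0 ≤ B)
    (h : ∀ j, MemLp (fun x => F x j) 2 volume ∧ nrm (fun x => F x j) ≤ B) :
    eLpNorm (fun x => ((WithLp.equiv 2 (Fin n → ℂ)).symm (F x) : EuclideanSpace ℂ (Fin n))) 2 volume ≤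
      ENNReal.ofReal (n * B) := by
  have h1 : eLpNorm (fun x => ((WithLp.equiv 2 (Fin n → ℂ)).symm (F x) : EuclideanSpace ℂ (Fin n))) 2 volume ≤
      eLpNorm (∑ j, fun x => ‖F x j‖) 2 volume := by
    refine eLpNorm_mono_real fun x => ?_
    rw [Finset.sum_apply]
    exact euclid_norm_le _
  refine h1.trans ((eLpNorm_sum_le (fun j _ => (h j).1.1.norm) (by norm_num)).trans ?_)
  refine (Finset.sum_le_card_nsmul _ _ (ENNReal.ofReal B) fun j _ => ?_).trans ?_
  · rw [eLpNorm_norm, ← ofReal_nrm (h j).1]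
    exact ENNReal.ofReal_le_ofReal (h j).2
  · rw [Finset.card_univ, Fintype.card_fin, nsmul_eq_mul, ENNReal.ofReal_mul (by positivity), ENNReal.ofReal_natCast]

lemma tendsto_sup {F : ℝ → ℝ → ℝ≥0∞} {t K ε₀ : ℝ} (hε₀ : 0 < ε₀)
    (h : ∀ ε ∈ Set.Ioc (0 : ℝ) 1, ε < ε₀ → ∀ τ ∈ Set.Icc (0 : ℝ) t, F ε τ ≤ ENNReal.ofReal (K * ε)) :
    Tendsto (fun ε => ⨆ τ ∈ Set.Icc (0 : ℝ) t, F ε τ) (𝓝[Set.Ioc (0 : ℝ) 1] 0) (𝓝 0) := by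
  have hl : Tendsto (fun ε => ENNReal.ofReal (K * ε)) (𝓝[Set.Ioc (0 : ℝ) 1] 0) (𝓝 0) := by
    have : Tendsto (fun ε : ℝ => ENNReal.ofReal (K * ε)) (𝓝 0) (𝓝 (ENNReal.ofReal (K * 0))) :=
      (ENNReal.continuous_ofReal.comp (continuous_const.mul continuous_id)).tendsto 0
    rw [mul_zero, ENNReal.ofReal_zero] at this
    exact this.mono_left nhdsWithin_le_nhds
  refine tendsto_of_tendsto_of_tendsto_of_le_of_le' tendsto_const_nhds hl (Eventually.of_forall fun _ => bot_le) ?_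
  have h2 : ∀ᶠ ε in 𝓝[Set.Ioc (0 : ℝ) 1] 0, ε < ε₀ := nhdsWithin_le_nhds (Iio_mem_nhds hε₀)
  filter_upwards [self_mem_nhdsWithin, h2] with ε h3 h4
  exact iSup₂_le fun τ hτ => h ε h3 h4 τ hτ

lemma Jop_Lens {ε τ m : ℝ} (hε : 0 < ε) (hc : 0 < Real.cos τ) {φ : Rn n → ℂ} (hφ : Differentiable ℝ φ) (j : Fin n) :
    (fun x => Jop ε τ (Lens m (Real.cos τ)⁻¹ (-(Real.tan τ / (2 * ε))) φ) x j) =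
      fun x => -Complex.I * Lens m (Real.cos τ)⁻¹ (-(Real.tan τ / (2 * ε))) (dj j φ) x := by
  funext x
  have hd := congrFun (dj_Lens j m (Real.cos τ)⁻¹ (-(Real.tan τ / (2 * ε))) hφ) x
  have hg : grad (Lens m (Real.cos τ)⁻¹ (-(Real.tan τ / (2 * ε))) φ) x j = _ := hd
  unfold Jop
  rw [hg, Real.tan_eq_sin_div_cos]
  have hcC : (Complex.cos (τ : ℂ)) ≠ 0 := by
    rw [← Complex.ofReal_cos]; exact_mod_cast hc.ne'
  have hεC : (ε : ℂ) ≠ 0 := by exact_mod_cast hε.ne'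
  generalize Lens m (Real.cos τ)⁻¹ (-(Real.sin τ / Real.cos τ / (2 * ε))) φ x = w
  generalize Lens m (Real.cos τ)⁻¹ (-(Real.sin τ / Real.cos τ / (2 * ε))) (dj j φ) x = w'
  push_cast
  field_simp
  linear_combination (Complex.sin (τ : ℂ) * (x j : ℂ) * w) * Complex.I_sq

lemma Hop_Lens {ε τ m : ℝ} (hε : 0 < ε) (hc : 0 < Real.cos τ) {φ : Rn n → ℂ} (hφ : Differentiable ℝ φ) (j : Fin n) :
    (fun x => Hop ε τ (Lens m (Real.cos τ)⁻¹ (-(Real.tan τ / (2 * ε))) φ) x j) =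
      fun x => Lens m (Real.cos τ)⁻¹ (-(Real.tan τ / (2 * ε))) (fun y => ((y j : ℝ) : ℂ) * φ y) x +
        (Complex.I * ((ε * Real.tan τ : ℝ) : ℂ)) * Lens m (Real.cos τ)⁻¹ (-(Real.tan τ / (2 * ε))) (dj j φ) x := by
  funext x
  have hd := congrFun (dj_Lens j m (Real.cos τ)⁻¹ (-(Real.tan τ / (2 * ε))) hφ) x
  have hg : grad (Lens m (Real.cos τ)⁻¹ (-(Real.tan τ / (2 * ε))) φ) x j = _ := hd
  unfold Hop
  rw [hg, Real.tan_eq_sin_div_cos]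
  have hy : Lens m (Real.cos τ)⁻¹ (-(Real.sin τ / Real.cos τ / (2 * ε))) (fun y => ((y j : ℝ) : ℂ) * φ y) x =
      (((Real.cos τ)⁻¹ * x j : ℝ) : ℂ) * Lens m (Real.cos τ)⁻¹ (-(Real.sin τ / Real.cos τ / (2 * ε))) φ x := by
    unfold Lens
    simp only [PiLp.smul_apply, smul_eq_mul]
    ring
  rw [hy]
  have hcC : (Complex.cos (τ : ℂ)) ≠ 0 := by
    rw [← Complex.ofReal_cos]; exact_mod_cast hc.ne'
  have hεC : (ε : ℂ) ≠ 0 := by exact_mod_cast hε.ne'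
  generalize Lens m (Real.cos τ)⁻¹ (-(Real.sin τ / Real.cos τ / (2 * ε))) φ x = w
  generalize Lens m (Real.cos τ)⁻¹ (-(Real.sin τ / Real.cos τ / (2 * ε))) (dj j φ) x = w'
  push_cast
  field_simp
  have hsc := Complex.sin_sq_add_cos_sq (τ : ℂ)
  linear_combination ((x j : ℂ) * w) * hsc
    - ((x j : ℂ) * Complex.sin (τ : ℂ) ^ 2 * w) * Complex.I_sq

end

/-- nonlinear WKB asymptotics before the focus, in the case α = 1, 0 < γ < 1:
for 0 ≤ t < π/2, sup_{0≤τ≤t} ‖A^ε(τ)(u^ε(τ) − wkbProfile)‖_{L²} → 0 as ε → 0, where A^ε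
is any of Id, J^ε, H^ε. -/
theorem stmt8 (n : ℕ) (hn : 2 ≤ n) (γ : ℝ) (hγ0 : 0 < γ) (hγ1 : γ < 1)
    (f : SchwartzMap (Rn n) ℂ) (u : ℝ → ℝ → Rn n → ℂ)
    (hu : ∀ ε ∈ Set.Ioc (0 : ℝ) 1, IsSolutionH n 1 γ ε (⇑f) (u ε))
    (t : ℝ) (ht0 : 0 ≤ t) (ht : t < π / 2) :
    Tendsto (fun ε : ℝ => ⨆ τ ∈ Set.Icc (0 : ℝ) t,
        eLpNorm (fun x => u ε τ x - wkbProfile n γ (⇑f) ε τ x) 2 volume)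
      (𝓝[Set.Ioc (0 : ℝ) 1] 0) (𝓝 0)
    ∧ Tendsto (fun ε : ℝ => ⨆ τ ∈ Set.Icc (0 : ℝ) t,
        eLpNorm (JopE ε τ (fun x => u ε τ x - wkbProfile n γ (⇑f) ε τ x)) 2 volume)
      (𝓝[Set.Ioc (0 : ℝ) 1] 0) (𝓝 0)
    ∧ Tendsto (fun ε : ℝ => ⨆ τ ∈ Set.Icc (0 : ℝ) t,
        eLpNorm (HopE ε τ (fun x => u ε τ x - wkbProfile n γ (⇑f) ε τ x)) 2 volume)
      (𝓝[Set.Ioc (0 : ℝ) 1] 0) (𝓝 0) := by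
  have htan : ∀ τ ∈ Set.Icc 0 t, Real.tan τ ∈ Set.Icc 0 (Real.tan t) := fun τ hτ => by
    refine ⟨Real.tan_nonneg_of_nonneg_of_le_pi_div_two hτ.1 (hτ.2.trans ht.le), ?_⟩
    rcases hτ.2.eq_or_lt with h | h
    · rw [h]
    · exact (Real.tan_lt_tan_of_lt_of_lt_pi_div_two (by linarith [hτ.1, Real.pi_pos]) ht h).le
  have hS : 0 ≤ Real.tan t := (htan t ⟨ht0, le_rfl⟩).1
  obtain ⟨K, ε₀, hK, hε₀, hmain⟩ := main_est hn hγ0 hγ1 f hS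
  have hcos : ∀ τ ∈ Set.Icc 0 t, 0 < Real.cos τ := fun τ hτ =>
    Real.cos_pos_of_mem_Ioo ⟨by linarith [hτ.1, Real.pi_pos], by linarith [hτ.2]⟩
  have hm0 : ∀ τ ∈ Set.Icc 0 t, 0 ≤ Real.cos τ ^ (-(n : ℝ) / 2) := fun τ hτ => Real.rpow_nonneg (hcos τ hτ).le _
  have hm : ∀ τ ∈ Set.Icc 0 t, (Real.cos τ ^ (-(n : ℝ) / 2)) ^ 2 = (Real.cos τ)⁻¹ ^ n := fun τ hτ => by
    rw [← Real.rpow_natCast (_ ^ _) 2, ← Real.rpow_mul (hcos τ hτ).le, inv_pow, ← Real.rpow_natCast,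
      ← Real.rpow_neg (hcos τ hτ).le]
    congr 1
    push_cast; ring
  refine ⟨tendsto_sup (K := K) hε₀ fun ε hε hεs τ hτ => ?_, tendsto_sup (K := n * K) hε₀ fun ε hε hεs τ hτ => ?_,
    tendsto_sup (K := n * (K + Real.tan t * K)) hε₀ fun ε hε hεs τ hτ => ?_⟩ <;>
  obtain ⟨h1, h2, h3, h4⟩ := hmain ε hε.1 hε.2 hεs (u ε) (hu ε hε) (Real.tan τ) (htan τ hτ) <;>
  rw [wkb_eq hτ.1 (hτ.2.trans_lt ht)] <;>
  have hc := hcos τ hτ <;>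
  have hN : ∀ {φ : Rn n → ℂ}, MemLp φ 2 volume → Continuous φ →
      MemLp (Lens (Real.cos τ ^ (-(n : ℝ) / 2)) (Real.cos τ)⁻¹ (-(Real.tan τ / (2 * ε))) φ) 2 volume ∧
      nrm (Lens (Real.cos τ ^ (-(n : ℝ) / 2)) (Real.cos τ)⁻¹ (-(Real.tan τ / (2 * ε))) φ) = nrm φ :=
    fun h h' => nrm_Lens (inv_pos.2 hc) (hm0 τ hτ) (hm τ hτ) _ h h' <;>
  have hcd : ∀ j, Continuous (dj j (rr (lensv ε (u ε)) (prof γ (⇑f)) (Real.tan τ))) := fun j =>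
    (dj_contDiff (k := 0) h1.diff (by norm_num)).continuous
  · have h5 := hN h1.mem h1.diff.continuous
    rw [← ofReal_nrm h5.1, h5.2]
    exact ENNReal.ofReal_le_ofReal ((nrm_le_H1n _).trans h3)
  · have hKε : 0 ≤ K * ε := mul_nonneg hK hε.1.le
    have := eLpNorm_euclid_le (F := Jop ε τ (Lens (Real.cos τ ^ (-(n : ℝ) / 2)) (Real.cos τ)⁻¹ (-(Real.tan τ / (2 * ε)))
      (rr (lensv ε (u ε)) (prof γ (⇑f)) (Real.tan τ)))) hKε (fun j => by
        have h5 := hN (h1.dmem j) (hcd j)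
        rw [Jop_Lens hε.1 hc h1.differentiable j, nrm_const_mul, norm_neg, Complex.norm_I, one_mul, h5.2]
        exact ⟨h5.1.const_mul _, (nrm_dj_le_H1n _ _).trans h3⟩)
    rw [mul_assoc]
    exact this
  · have hKε : 0 ≤ K * ε := mul_nonneg hK hε.1.le
    have hB : 0 ≤ (K + Real.tan t * K) * ε := by have := hε.1; positivity
    have := eLpNorm_euclid_le (F := Hop ε τ (Lens (Real.cos τ ^ (-(n : ℝ) / 2)) (Real.cos τ)⁻¹ (-(Real.tan τ / (2 * ε)))
      (rr (lensv ε (u ε)) (prof γ (⇑f)) (Real.tan τ)))) hB (fun j => by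
        have h5 := hN (h1.dmem j) (hcd j)
        have h6 := coord_mul_mem j h1.diff.continuous h2
        have h7 := hN h6.1 ((Complex.continuous_ofReal.comp (by fun_prop)).mul h1.diff.continuous)
        rw [Hop_Lens hε.1 hc h1.differentiable j]
        refine ⟨h7.1.add (h5.1.const_mul _), (nrm_add_le h7.1).trans ?_⟩
        rw [nrm_const_mul, h7.2, h5.2, norm_mul, Complex.norm_I, one_mul, Complex.norm_real, Real.norm_eq_abs,
          abs_of_nonneg (mul_nonneg hε.1.le (htan τ hτ).1)]
        have t1 : ε * Real.tan τ ≤ 1 * Real.tan t :=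
          mul_le_mul hε.2 (htan τ hτ).2 (htan τ hτ).1 zero_le_one
        have t2 : ε * Real.tan τ * nrm (dj j (rr (lensv ε (u ε)) (prof γ (⇑f)) (Real.tan τ))) ≤ 1 * Real.tan t * (K * ε) :=
          mul_le_mul t1 ((nrm_dj_le_H1n _ _).trans h3) (nrm_nonneg _) (by linarith)
        linarith [h6.2])
    rw [mul_assoc]
    exact this

end
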